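/- Let f ∈ Diff¹_ω(D) be a C² diffeomorphism such that f(0) = 0 and f has no periodic point other than 0 (for every z ∈ D∖{0} and every integer n ≥ 1, f^n(z) ≠ z), i.e. f is a C² irrational pseudo-rotation. Let α ∈ ℝ be the translation number of a lift of the circle diffeomorphism f|_{S¹}. Assume that α is irrational and not of Bruno type, i.e. the denominators (q_n) of the continued fraction expansion of α satisfy Σ_{n≥0} log(q_{n+1})/q_n = +∞. Then Cal₁(f) = 0. -/

import Mathlib

open MeasureTheory Metric Set Filter Topology
open scoped Real

noncomputable section

/-- The closed unit disk in `ℂ ≅ ℝ²`. -/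
def Disk : Set ℂ := Metric.closedBall 0 1

/-- The unit circle, boundary of the closed unit disk. -/
def Circ : Set ℂ := Metric.sphere 0 1

/-- The standard Liouville form `λ_z(w) = (z₁ w₂ - z₂ w₁)/(2π)`, whose exterior
derivative is the normalized area form `ω = (1/π) du ∧ dv`. -/
def lform (z w : ℂ) : ℝ := (z.re * w.im - z.im * w.re) / (2 * Real.pi)

/-- An element of `Diff¹_ω(D)`: a `C¹` diffeomorphism of the closed unit disk onto itself
whose Jacobian determinant equals `1` at every point. -/
structure SympDiff where
  toFun : ℂ → ℂ
  invFun : ℂ → ℂ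
  mapsTo : Set.MapsTo toFun Disk Disk
  inv_mapsTo : Set.MapsTo invFun Disk Disk
  left_inv : ∀ z ∈ Disk, invFun (toFun z) = z
  right_inv : ∀ z ∈ Disk, toFun (invFun z) = z
  contDiffOn : ContDiffOn ℝ 1 toFun Disk
  inv_contDiffOn : ContDiffOn ℝ 1 invFun Disk
  jacobian : ∀ z ∈ Disk,
    LinearMap.det (fderivWithin ℝ toFun Disk z).toLinearMap = 1

/-- `A` is an action function of `f`: a `C¹` function with `dA = f*λ - λ` on the disk. -/
def IsAction (f : SympDiff) (A : ℂ → ℝ) : Prop :=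
  ContDiffOn ℝ 1 A Disk ∧
    ∀ z ∈ Disk, ∀ w : ℂ,
      fderivWithin ℝ A Disk z w =
        lform (f.toFun z) (fderivWithin ℝ f.toFun Disk z w) - lform z w

/-- `μ` is a Borel probability measure concentrated on the unit circle and invariant
under `f|_{S¹}`. -/
def IsInvariantCircleMeasure (f : SympDiff) (μ : Measure ℂ) : Prop :=
  IsProbabilityMeasure μ ∧ μ Circᶜ = 0 ∧ Measure.map f.toFun μ = μ

/-- `A` is a normalized action function of `f`: an action function whose integral over the
circle with respect to some `f|_{S¹}`-invariant probability measure vanishes. -/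
def IsNormalizedAction (f : SympDiff) (A : ℂ → ℝ) : Prop :=
  IsAction f A ∧
    ∃ μ : Measure ℂ, IsInvariantCircleMeasure f μ ∧ ∫ z, A z ∂μ = 0

/-- The `C⁰` distance between two disk diffeomorphisms (given with their inverses). -/
def d0 (f fi g gi : ℂ → ℂ) : ℝ :=
  max (⨆ z : Disk, ‖f (z : ℂ) - g (z : ℂ)‖) (⨆ z : Disk, ‖fi (z : ℂ) - gi (z : ℂ)‖)

/-- The `C¹` distance between two disk diffeomorphisms (given with their inverses). -/
def d1 (f fi g gi : ℂ → ℂ) : ℝ :=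
  max (d0 f fi g gi)
    (max (⨆ z : Disk, ‖fderivWithin ℝ f Disk (z : ℂ) - fderivWithin ℝ g Disk (z : ℂ)‖)
      (⨆ z : Disk, ‖fderivWithin ℝ fi Disk (z : ℂ) - fderivWithin ℝ gi Disk (z : ℂ)‖))

namespace PlaneTop

theorem exists_continuous_log {X : Type*} [TopologicalSpace X] [SimplyConnectedSpace X]
    [LocallyPathConnectedSpace X] {f : X → ℂ} (hf : Continuous f) (h0 : ∀ x, f x ≠ 0) :
    ∃ g : X → ℂ, Continuous g ∧ ∀ x, Complex.exp (g x) = f x := by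
  obtain ⟨x₀⟩ : Nonempty X := inferInstance
  rcases Complex.isCoveringMapOn_exp.existsUnique_continuousMap_lifts
    ⟨f, hf⟩ (Complex.exp_log (h0 x₀)) (fun x ↦ h0 x) with ⟨g, ⟨-, hg⟩, -⟩
  exact ⟨g, map_continuous g, fun x => by simpa using congrFun hg x⟩

theorem exists_int_of_exp_eq {X : Type*} [TopologicalSpace X] {S : Set X}
    (hS : IsPreconnected S) {g₁ g₂ : X → ℂ} (h₁ : ContinuousOn g₁ S) (h₂ : ContinuousOn g₂ S)
    (h : ∀ x ∈ S, Complex.exp (g₁ x) = Complex.exp (g₂ x)) :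
    ∃ k : ℤ, ∀ x ∈ S, g₁ x = g₂ x + k * (2 * π * Complex.I) := by
  rcases S.eq_empty_or_nonempty with rfl | ⟨x₀, hx₀⟩
  · exact ⟨0, by simp⟩
  have key : ∀ x ∈ S, ∃ k : ℤ, g₁ x = g₂ x + k * (2 * π * Complex.I) := fun x hx =>
    Complex.exp_eq_exp_iff_exists_int.1 (h x hx)
  choose! k hk using key
  refine ⟨k x₀, fun x hx => ?_⟩
  have hc : ContinuousOn (fun x => ((g₁ x - g₂ x) / (2 * π * Complex.I)).re) S :=
    Complex.continuous_re.comp_continuousOn ((h₁.sub h₂).div_const _)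
  have hv : ∀ x ∈ S, ((g₁ x - g₂ x) / (2 * π * Complex.I)).re = k x := fun x hx => by
    rw [hk x hx]
    have : (2 * π * Complex.I : ℂ) ≠ 0 := by simp [Real.pi_ne_zero]
    rw [add_sub_cancel_left, mul_div_cancel_right₀ _ this]; simp
  have hd : ContinuousOn k S := by
    rw [Int.isClosedEmbedding_coe_real.isInducing.continuousOn_iff]
    exact hc.congr fun x hx => (hv x hx).symm
  have := hS.constant hd hx hx₀
  rw [hk x hx, this]

theorem two_pi_I_ne_zero' : (2 * π * Complex.I : ℂ) ≠ 0 := by simp [Real.pi_ne_zero]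

theorem exists_int_of_exp_eq' {X : Type*} [TopologicalSpace X] [PreconnectedSpace X]
    {g₁ g₂ : X → ℂ} (h₁ : Continuous g₁) (h₂ : Continuous g₂)
    (h : ∀ x, Complex.exp (g₁ x) = Complex.exp (g₂ x)) :
    ∃ k : ℤ, ∀ x, g₁ x = g₂ x + k * (2 * π * Complex.I) := by
  obtain ⟨k, hk⟩ := exists_int_of_exp_eq (isPreconnected_univ (α := X)) h₁.continuousOn
    h₂.continuousOn (fun x _ => h x)
  exact ⟨k, fun x => hk x (mem_univ _)⟩

/-- Orientation preservation, expressed through a continuous lift of differences. -/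
def OP (h : ℂ → ℂ) : Prop :=
  ∃ L : ℂ × ℂ → ℂ, Continuous L ∧
    (∀ z ζ, h (z + Complex.exp ζ) - h z = Complex.exp (L (z, ζ))) ∧
    ∀ z ζ, L (z, ζ + 2 * π * Complex.I) = L (z, ζ) + 2 * π * Complex.I

theorem OP.comp {g h : ℂ → ℂ} (hg : OP g) (hh : OP h) (hc : Continuous h) : OP (g ∘ h) := by
  obtain ⟨L, Lc, L1, L2⟩ := hg
  obtain ⟨M, Mc, M1, M2⟩ := hh
  refine ⟨fun p => L (h p.1, M p), by fun_prop, fun z ζ => ?_, fun z ζ => ?_⟩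
  · have := L1 (h z) (M (z, ζ))
    rw [← M1] at this
    simpa using this
  · simp only [M2, L2]

theorem OP.id : OP _root_.id :=
  ⟨fun p => p.2, by fun_prop, by simp, by simp⟩

theorem exists_lift_differences (h : ℂ ≃ₜ ℂ) :
    ∃ L : ℂ × ℂ → ℂ, Continuous L ∧
    (∀ z ζ, h (z + Complex.exp ζ) - h z = Complex.exp (L (z, ζ))) ∧
    ∃ k : ℤ, ∀ z ζ, L (z, ζ + 2 * π * Complex.I) = L (z, ζ) + k * (2 * π * Complex.I) := by
  have hc := h.continuous
  obtain ⟨L, Lc, hL⟩ := exists_continuous_log (X := ℂ × ℂ)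
    (f := fun p => h (p.1 + Complex.exp p.2) - h p.1) (by fun_prop) (by
      intro p hp
      have := h.injective (sub_eq_zero.1 hp)
      simp [Complex.exp_ne_zero] at this)
  refine ⟨L, Lc, fun z ζ => (hL (z, ζ)).symm, ?_⟩
  obtain ⟨k, hk⟩ := exists_int_of_exp_eq' (g₁ := fun p : ℂ × ℂ => L (p.1, p.2 + 2 * π * Complex.I))
    (g₂ := L) (by fun_prop) Lc (by
      intro p; simp only [hL, Complex.exp_periodic p.2])
  exact ⟨k, fun z ζ => hk (z, ζ)⟩

theorem OP.of_slit (h : ℂ ≃ₜ ℂ) (z₀ : ℂ)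
    (H : ∀ w, w ≠ 0 → (h (z₀ + w) - h z₀) / w ∈ Complex.slitPlane) : OP h := by
  obtain ⟨L, Lc, L1, k, hk⟩ := exists_lift_differences h
  refine ⟨L, Lc, L1, ?_⟩
  have hc := h.continuous
  have hR : Continuous fun ζ : ℂ =>
      Complex.log ((h (z₀ + Complex.exp ζ) - h z₀) / Complex.exp ζ) := by
    refine Continuous.clog ?_ fun ζ => H _ (Complex.exp_ne_zero _)
    exact Continuous.div (by fun_prop) (by fun_prop) fun ζ => Complex.exp_ne_zero _
  obtain ⟨m, hm⟩ := exists_int_of_exp_eq' (g₁ := fun ζ => L (z₀, ζ))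
    (g₂ := fun ζ => ζ + Complex.log ((h (z₀ + Complex.exp ζ) - h z₀) / Complex.exp ζ))
    (by fun_prop) (by fun_prop) (by
      intro ζ
      rw [← L1, Complex.exp_add, Complex.exp_log (Complex.slitPlane_ne_zero
        (H _ (Complex.exp_ne_zero _))), mul_div_cancel₀ _ (Complex.exp_ne_zero _)])
  have h1 := hk z₀ 0
  have e1 := hm (0 + 2 * π * Complex.I)
  have e2 := hm 0
  simp only [Complex.exp_periodic (0 : ℂ)] at e1
  have : (k : ℂ) * (2 * π * Complex.I) = 1 * (2 * π * Complex.I) := by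
    rw [e1, e2] at h1
    linear_combination -h1
  have hk1 := mul_right_cancel₀ two_pi_I_ne_zero' this
  intro z ζ
  rw [hk, hk1, one_mul]

theorem shift_int {M : ℂ × ℂ → ℂ}
    (M2 : ∀ z ζ, M (z, ζ + 2 * π * Complex.I) = M (z, ζ) + 2 * π * Complex.I)
    (z ζ : ℂ) (n : ℤ) :
    M (z, ζ + n * (2 * π * Complex.I)) = M (z, ζ) + n * (2 * π * Complex.I) := by
  induction n using Int.induction_on with
  | zero => simp
  | succ i ih =>
    have := M2 z (ζ + (i : ℤ) * (2 * π * Complex.I))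
    have e : ζ + (i : ℤ) * (2 * π * Complex.I) + 2 * π * Complex.I =
      ζ + (i + 1 : ℤ) * (2 * π * Complex.I) := by push_cast; ring
    rw [e, ih] at this
    rw [this]
    push_cast
    ring
  | pred i ih =>
    have := M2 z (ζ + (-(i:ℤ) - 1 : ℤ) * (2 * π * Complex.I))
    have e : ζ + (-(i:ℤ) - 1 : ℤ) * (2 * π * Complex.I) + 2 * π * Complex.I =
      ζ + (-(i : ℤ) : ℤ) * (2 * π * Complex.I) := by push_cast; ring
    rw [e, ih] at this
    push_cast at *
    linear_combination -this

theorem OP.symm {h : ℂ ≃ₜ ℂ} (hh : OP h) : OP h.symm := by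
  obtain ⟨L, Lc, L1, k, hk⟩ := exists_lift_differences h.symm
  refine ⟨L, Lc, L1, ?_⟩
  obtain ⟨M, Mc, M1, M2⟩ := hh
  have hM := shift_int M2
  have hc := h.symm.continuous
  obtain ⟨m, hm⟩ := exists_int_of_exp_eq' (g₁ := fun ζ => M (h.symm 0, L (0, ζ)))
    (g₂ := fun ζ => ζ) (by fun_prop) (by fun_prop) (by
      intro ζ
      rw [← M1, ← L1]; simp)
  have e1 := hm (0 + 2 * π * Complex.I)
  have e2 := hm 0
  simp only [hk, hM, e2] at e1
  have : (k : ℂ) * (2 * π * Complex.I) = 1 * (2 * π * Complex.I) := by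
    linear_combination e1
  have hk1 := mul_right_cancel₀ two_pi_I_ne_zero' this
  intro z ζ
  rw [hk, hk1, one_mul]

theorem OP.of_approx (h : ℂ ≃ₜ ℂ) {k : ℝ} (hk : k < 1)
    (H : ∀ z w, ‖h (z + w) - h z - w‖ ≤ k * ‖w‖) : OP h := by
  refine OP.of_slit h 0 fun w hw => ?_
  have h1 := H 0 w
  have : ‖(h (0 + w) - h 0) / w - 1‖ < 1 := by
    have e : (h (0 + w) - h 0) / w - 1 = (h (0 + w) - h 0 - w) / w := by field_simp
    rw [e, norm_div, div_lt_one (by positivity)]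
    have : 0 < ‖w‖ := by positivity
    nlinarith
  left
  have h2 := (Complex.abs_re_le_norm _).trans_lt this
  rw [Complex.sub_re, Complex.one_re, abs_lt] at h2
  linarith

/-- A fixed point free orientation preserving homeomorphism has no point of period two. -/
theorem no_period_two {h : ℂ ≃ₜ ℂ} (hh : OP h) (hfix : ∀ z, h z ≠ z) (x : ℂ) :
    h (h x) ≠ x := by
  intro hx
  have hc := h.continuous
  obtain ⟨L, Lc, L1, L2⟩ := hh
  obtain ⟨M, Mc, hM⟩ := exists_continuous_log (X := ℂ) (f := fun z => h z - z) (by fun_prop)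
    (fun z hz => hfix z (sub_eq_zero.1 hz))
  have hL := shift_int L2
  obtain ⟨m, hm⟩ := exists_int_of_exp_eq' (g₁ := fun z => M (h z)) (g₂ := fun z => L (z, M z))
    (by fun_prop) (by fun_prop) (by
      intro z
      rw [← L1, hM, hM]; simp)
  obtain ⟨c, hcc⟩ := exists_int_of_exp_eq'
    (g₁ := fun p : ℂ × ℂ => L (p.1 + Complex.exp p.2, p.2 + π * Complex.I))
    (g₂ := fun p => L p + π * Complex.I) (by fun_prop) (by fun_prop) (by
      intro p
      rw [← L1, Complex.exp_add, Complex.exp_pi_mul_I, Complex.exp_add, Complex.exp_pi_mul_I,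
        ← L1 p.1 p.2]
      simp)
  have hc0 : c = 0 := by
    have e1 := hcc (0, 0)
    have e2 := hcc (0 + Complex.exp 0, 0 + π * Complex.I)
    simp only [Complex.exp_add, Complex.exp_pi_mul_I] at e2 e1
    have e3 := L2 0 0
    have e4 : (0 : ℂ) + Complex.exp 0 + Complex.exp 0 * -1 = 0 := by simp
    have e5 : (0 : ℂ) + π * Complex.I + π * Complex.I = 0 + 2 * π * Complex.I := by ring
    rw [e4, e5, e3, e1] at e2
    have : (c : ℂ) * (2 * π * Complex.I) = 0 := by linear_combination (-1/2) * e2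
    have := (mul_eq_zero.1 this).resolve_right two_pi_I_ne_zero'
    exact_mod_cast this
  subst hc0
  obtain ⟨r, hr⟩ : ∃ r : ℤ, M (h x) = M x + π * Complex.I + r * (2 * π * Complex.I) := by
    refine Complex.exp_eq_exp_iff_exists_int.1 ?_
    rw [hM, hx, Complex.exp_add, hM, Complex.exp_pi_mul_I]; ring
  have a1 := hm x
  have a2 := hm (h x)
  simp only [hx] at a2
  have a3 := hcc (x, M x)
  simp only [hM, add_sub_cancel] at a3
  rw [hr, hL, a3] at a2
  rw [hr] at a1
  have : ((2 * r + 1 : ℤ) : ℂ) * (2 * π * Complex.I) = 0 := by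
    push_cast at *
    linear_combination a1 - a2
  have := (mul_eq_zero.1 this).resolve_right two_pi_I_ne_zero'
  have : (2 * r + 1 : ℤ) = 0 := by exact_mod_cast this
  omega

theorem exists_push_local {c a : ℂ} {R : ℝ} (ha : a ∈ ball c R) :
    ∃ φ : ℂ ≃ₜ ℂ, OP φ ∧ φ c = a ∧ ∀ z, z ∉ ball c R → φ z = z := by
  have hR : 0 < R := dist_nonneg.trans_lt (mem_ball.1 ha)
  set b : ℂ → ℝ := fun z => max 0 (1 - ‖z - c‖ / R) with hb
  set k : ℝ := ‖a - c‖ / R with hk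
  have hk0 : 0 ≤ k := by positivity
  have hk1 : k < 1 := by
    rw [hk, div_lt_one hR]; simpa [dist_eq_norm] using ha
  set f : ℂ → ℂ := fun z => z + b z * (a - c) with hf
  have hbl : ∀ x y, |b x - b y| ≤ ‖x - y‖ / R := by
    intro x y
    refine (abs_max_sub_max_le_max _ _ _ _).trans ?_
    rw [sub_self, abs_zero, max_le_iff]
    refine ⟨by positivity, ?_⟩
    rw [show 1 - ‖x - c‖ / R - (1 - ‖y - c‖ / R) = (‖y - c‖ - ‖x - c‖) / R by ring, abs_div,
      abs_of_pos hR]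
    gcongr
    have := abs_norm_sub_norm_le (y - c) (x - c)
    rwa [sub_sub_sub_cancel_right, norm_sub_rev y x] at this
  have hkey : ∀ x y, ‖f x - f y - (x - y)‖ ≤ k * ‖x - y‖ := by
    intro x y
    have : f x - f y - (x - y) = ((b x - b y : ℝ) : ℂ) * (a - c) := by
      simp only [hf]; push_cast; ring
    rw [this, norm_mul, Complex.norm_real, Real.norm_eq_abs]
    calc _ ≤ ‖x - y‖ / R * ‖a - c‖ := by gcongr; exact hbl x y
      _ = _ := by rw [hk]; ring
  have happ : ApproximatesLinearOn f ((ContinuousLinearEquiv.refl ℝ ℂ : ℂ ≃L[ℝ] ℂ) : ℂ →L[ℝ] ℂ)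
      univ ⟨k, hk0⟩ := by
    intro x _ y _
    exact hkey x y
  have hcn : Subsingleton ℂ ∨ (⟨k, hk0⟩ : NNReal) <
      ‖((ContinuousLinearEquiv.refl ℝ ℂ).symm : ℂ →L[ℝ] ℂ)‖₊⁻¹ := by
    right
    have : ‖((ContinuousLinearEquiv.refl ℝ ℂ).symm : ℂ →L[ℝ] ℂ)‖₊ = 1 := by
      have := ContinuousLinearMap.norm_id (𝕜 := ℝ) (E := ℂ)
      exact NNReal.eq this
    rw [this, inv_one]
    exact hk1
  refine ⟨happ.toHomeomorph f hcn, ?_, ?_, ?_⟩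
  · refine OP.of_approx _ hk1 fun z w => ?_
    have := hkey (z + w) z
    rw [add_sub_cancel_left] at this
    exact this
  · change f c = a
    simp [hf, hb]
  · intro z hz
    change f z = z
    have : b z = 0 := by
      simp only [hb, max_eq_left_iff]
      rw [mem_ball, dist_eq_norm, not_lt] at hz
      have := (one_le_div hR).2 hz
      linarith
    simp [hf, this]

theorem exists_push {W : Set ℂ} (hW : IsOpen W) (hc : IsPreconnected W) {p q : ℂ}
    (hp : p ∈ W) (hq : q ∈ W) :
    ∃ φ : ℂ ≃ₜ ℂ, OP φ ∧ φ p = q ∧ ∀ z, z ∉ W → φ z = z := by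
  refine hc.induction₂ (fun p q => ∃ φ : ℂ ≃ₜ ℂ, OP φ ∧ φ p = q ∧ ∀ z, z ∉ W → φ z = z)
    ?_ ?_ ?_ hp hq
  · intro x hx
    obtain ⟨R, hR, hRW⟩ := Metric.isOpen_iff.1 hW x hx
    filter_upwards [mem_nhdsWithin_of_mem_nhds (ball_mem_nhds x hR)] with y hy
    obtain ⟨φ, h1, h2, h3⟩ := exists_push_local hy
    exact ⟨φ, h1, h2, fun z hz => h3 z fun h => hz (hRW h)⟩
  · rintro x y z _ _ _ ⟨φ, h1, h2, h3⟩ ⟨ψ, g1, g2, g3⟩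
    exact ⟨φ.trans ψ, g1.comp h1 φ.continuous, by simp [h2, g2], fun w hw => by
      simp [h3 w hw, g3 w hw]⟩
  · rintro x y _ _ ⟨φ, h1, h2, h3⟩
    exact ⟨φ.symm, h1.symm, by rw [← h2]; simp, fun w hw => by
      rw [Homeomorph.symm_apply_eq, h3 w hw]⟩

structure FreeFamily (h : ℂ → ℂ) {ι : Type} (V : ι → Set ℂ) : Prop where
  isOpen : ∀ i, IsOpen (V i)
  isPreconnected : ∀ i, IsPreconnected (V i)
  disj : ∀ i j, i ≠ j → Disjoint (V i) (V j)
  free : ∀ i, ∀ z ∈ V i, h z ∉ V i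

def NoCycle (n : ℕ) : Prop :=
  ∀ h : ℂ ≃ₜ ℂ, OP h → (∀ z, h z ≠ z) → ∀ (ι : Type) (V : ι → Set ℂ), FreeFamily h V →
    ∀ z : ℕ → ℂ, z n = z 0 →
      (∀ t < n, z (t + 1) = h (z t) ∨ ∃ i, h (z t) ∈ V i ∧ z (t + 1) ∈ V i) → False

theorem noCycle_periodic {n : ℕ} (hn : 1 ≤ n) (IH : ∀ m, 1 ≤ m → m < n → NoCycle m)
    (Horb : ∀ h : ℂ ≃ₜ ℂ, OP h → (∀ z, h z ≠ z) → ∀ x, h^[n] x ≠ x) {ι : Type} (V : ι → Set ℂ)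
    (k : ℕ) : ∀ h : ℂ ≃ₜ ℂ, OP h → (∀ z, h z ≠ z) → FreeFamily h V →
    ∀ z : ℕ → ℂ, (∀ t, z (t + n) = z t) →
      (∀ t, z (t + 1) = h (z t) ∨ ∃ i, h (z t) ∈ V i ∧ z (t + 1) ∈ V i) →
      ((Finset.range n).filter fun t => z (t + 1) ≠ h (z t)).card = k → False := by
  induction k using Nat.strong_induction_on with
  | _ k ih =>
  intro h hop hfix hV z hper hstep hk
  by_cases hj : ∀ t < n, z (t + 1) = h (z t)
  · refine Horb h hop hfix (z 0) ?_
    have : ∀ t ≤ n, z t = h^[t] (z 0) := by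
      intro t
      induction t with
      | zero => simp
      | succ t iht => intro ht; rw [hj t ht, iht (by omega), Function.iterate_succ_apply']
    rw [← this n le_rfl]
    simpa using hper 0
  push Not at hj
  obtain ⟨t₀, ht₀, hne⟩ := hj
  obtain ⟨i, hi₁, hi₂⟩ := (hstep t₀).resolve_left hne
  by_cases hcut : ∃ t₁, t₀ < t₁ ∧ t₁ < t₀ + n ∧ h (z t₁) ∈ V i
  · obtain ⟨t₁, h1, h2, h3⟩ := hcut
    refine IH (t₁ - t₀) (by omega) (by omega) h hop hfix ι V hV
      (fun s => if s < t₁ - t₀ then z (t₀ + 1 + s) else z (t₀ + 1)) ?_ ?_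
    · simp [show 0 < t₁ - t₀ by omega]
    · intro s hs
      simp only [hs, if_true]
      split_ifs with h4
      · exact hstep (t₀ + 1 + s)
      · right
        refine ⟨i, ?_, hi₂⟩
        rwa [show t₀ + 1 + s = t₁ by omega]
  push Not at hcut
  obtain ⟨φ, hφ, hφ1, hφ2⟩ := exists_push (hV.isOpen i) (hV.isPreconnected i) hi₁ hi₂
  have hφ3 : ∀ w, φ w ∈ V i → w ∈ V i := by
    intro w hw
    by_contra hw'
    rw [hφ2 w hw'] at hw
    exact hw' hw
  have hφ4 : ∀ w, w ∈ V i → φ w ∈ V i := by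
    intro w hw
    by_contra hw'
    have := hφ2 _ hw'
    rw [φ.injective this] at hw'
    exact hw' hw
  have hnot : ∀ t < n, t ≠ t₀ → h (z t) ∉ V i := by
    intro t ht hne
    rcases lt_or_gt_of_ne hne with h | h
    · rw [← hper]; exact hcut _ (by omega) (by omega)
    · exact hcut _ h (by omega)
  have hper' : ∀ j t, z (t + n * j) = z t := by
    intro j
    induction j with
    | zero => simp
    | succ j ihj => intro t; rw [mul_add, ← add_assoc, mul_one, hper, ihj]
  have hmod : ∀ t, z t = z (t % n) := by
    intro t
    conv_lhs => rw [← Nat.mod_add_div t n]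
    exact hper' _ _
  have hfilt : ∀ t < n, z (t + 1) ≠ φ (h (z t)) → t ≠ t₀ ∧ z (t + 1) ≠ h (z t) := by
    intro t ht hne'
    have h1 : t ≠ t₀ := by
      rintro rfl
      exact hne' hφ1.symm
    refine ⟨h1, ?_⟩
    rwa [hφ2 _ (hnot t ht h1)] at hne'
  refine ih _ ?_ (h.trans φ) (hφ.comp hop h.continuous) ?_ ?_ z hper ?_ rfl
  · rw [← hk]
    refine Finset.card_lt_card ((Finset.ssubset_iff_of_subset ?_).2 ⟨t₀, ?_, ?_⟩)
    · intro t ht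
      rw [Finset.mem_filter, Finset.mem_range] at ht ⊢
      exact ⟨ht.1, (hfilt t ht.1 ht.2).2⟩
    · simp [ht₀, hne]
    · rw [Finset.mem_filter]
      exact fun hh => hh.2 hφ1.symm
  · intro w hw
    simp only [Homeomorph.trans_apply] at hw
    by_cases hwi : h w ∈ V i
    · have := hφ4 _ hwi
      rw [hw] at this
      exact hV.free i w this hwi
    · rw [hφ2 _ hwi] at hw
      exact hfix w hw
  · refine ⟨hV.isOpen, hV.isPreconnected, hV.disj, ?_⟩
    intro j w hw hw2
    simp only [Homeomorph.trans_apply] at hw2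
    by_cases hji : j = i
    · subst hji
      exact hV.free j w hw (hφ3 _ hw2)
    · by_cases hwi : h w ∈ V i
      · exact (hV.disj j i hji).le_bot ⟨hw2, hφ4 _ hwi⟩
      · rw [hφ2 _ hwi] at hw2
        exact hV.free j w hw hw2
  · have key : ∀ t < n, z (t + 1) = (h.trans φ) (z t) ∨
        ∃ i, (h.trans φ) (z t) ∈ V i ∧ z (t + 1) ∈ V i := by
      intro t ht
      by_cases htt : t = t₀
      · left; subst htt; exact hφ1.symm
      · simp only [Homeomorph.trans_apply, hφ2 _ (hnot t ht htt)]
        exact hstep t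
    intro t
    have h1 := key (t % n) (Nat.mod_lt _ hn)
    rw [← hmod] at h1
    have : z (t % n + 1) = z (t + 1) := by
      have := hper' (t / n) (t % n + 1)
      rw [add_right_comm, Nat.mod_add_div] at this
      exact this.symm
    rwa [this] at h1

theorem noCycle_of {n : ℕ} (hn : 1 ≤ n) (IH : ∀ m, 1 ≤ m → m < n → NoCycle m)
    (Horb : ∀ h : ℂ ≃ₜ ℂ, OP h → (∀ z, h z ≠ z) → ∀ x, h^[n] x ≠ x) : NoCycle n := by
  intro h hop hfix ι V hV z hz hstep
  refine noCycle_periodic hn IH Horb V _ h hop hfix hV (fun t => z (t % n)) (by simp) ?_ rfl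
  intro t
  have hlt := Nat.mod_lt t hn
  have : z ((t + 1) % n) = z (t % n + 1) := by
    rcases Nat.lt_or_ge (t % n + 1) n with h | h
    · rw [Nat.add_mod, ← Nat.mod_eq_of_lt h, Nat.add_mod (t % n)]; simp
    · have e : t % n + 1 = n := by omega
      rw [e, hz]
      congr 1
      rw [← Nat.mod_add_div t n, add_right_comm, e]; simp
  simp only [this]
  exact hstep _ hlt

theorem isPreconnected_thickening {K : Set ℂ} (hK : IsPreconnected K) (δ : ℝ) :
    IsPreconnected (thickening δ K) := by
  rcases le_or_gt δ 0 with h | h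
  · rw [thickening_of_nonpos h]; exact isPreconnected_empty
  refine isPreconnected_of_forall_pair fun x hx y hy => ?_
  rw [mem_thickening_iff] at hx hy
  obtain ⟨a, ha, hxa⟩ := hx
  obtain ⟨b, hb, hyb⟩ := hy
  refine ⟨ball a δ ∪ K ∪ ball b δ, ?_, Or.inl (Or.inl hxa), Or.inr hyb, ?_⟩
  · rintro w ((hw | hw) | hw)
    · exact mem_thickening_iff.2 ⟨a, ha, hw⟩
    · exact self_subset_thickening h _ hw
    · exact mem_thickening_iff.2 ⟨b, hb, hw⟩
  · refine IsPreconnected.union b (Or.inr hb) (mem_ball_self h) ?_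
      (convex_ball b δ).isPreconnected
    exact IsPreconnected.union a (mem_ball_self h) ha (convex_ball a δ).isPreconnected hK

theorem NoCycle.compact {m : ℕ} (H : NoCycle m) {h : ℂ ≃ₜ ℂ} (hop : OP h)
    (hfix : ∀ z, h z ≠ z) (K : ℕ → Set ℂ) (hK : ∀ i < m, IsCompact (K i))
    (hKc : ∀ i < m, IsPreconnected (K i)) (hd : ∀ i < m, ∀ j < m, i < j → Disjoint (K i) (K j))
    (hfree : ∀ i < m, ∀ z ∈ K i, h z ∉ K i) (z : ℕ → ℂ) (hz : z m = z 0)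
    (hstep : ∀ t < m, h (z t) ∈ K t ∧ z (t + 1) ∈ K t) : False := by
  have hd' : ∀ i < m, ∀ j < m, i ≠ j → Disjoint (K i) (K j) := fun i hi j hj hij =>
    (lt_or_gt_of_ne hij).elim (hd i hi j hj) fun h => (hd j hj i hi h).symm
  have mono : ∀ {δ δ' : ℝ} {A B : Set ℂ}, δ' ≤ δ → Disjoint (thickening δ A) (thickening δ B) →
      Disjoint (thickening δ' A) (thickening δ' B) := fun hle hh =>
    hh.mono (thickening_mono hle _) (thickening_mono hle _)
  have ev1 : ∀ i : Fin m, ∀ j : Fin m, ∀ᶠ δ in 𝓝[>] (0 : ℝ), i ≠ j →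
      Disjoint (thickening δ (K i)) (thickening δ (K j)) := by
    intro i j
    by_cases hij : i = j
    · simp [hij]
    obtain ⟨δ, hδ, hdis⟩ := (hd' i i.2 j j.2 (fun h => hij (Fin.ext h))).exists_thickenings
      (hK i i.2) (hK j j.2).isClosed
    filter_upwards [Ioc_mem_nhdsGT hδ] with δ' hδ' _
    exact mono hδ'.2 hdis
  have ev2 : ∀ i : Fin m, ∀ᶠ δ in 𝓝[>] (0 : ℝ), ∀ w ∈ thickening δ (K i),
      h w ∉ thickening δ (K i) := by
    intro i
    have hdis : Disjoint (K i) (h '' K i) := by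
      rw [Set.disjoint_left]
      rintro _ hw ⟨v, hv, rfl⟩
      exact hfree i i.2 v hv hw
    obtain ⟨δ, hδ, hdis⟩ := hdis.exists_thickenings (hK i i.2)
      ((hK i i.2).image h.continuous).isClosed
    obtain ⟨δ₂, hδ₂, hsub⟩ := (hK i i.2).exists_thickening_subset_open
      (isOpen_thickening.preimage h.continuous)
      (fun w hw => self_subset_thickening hδ _ (mem_image_of_mem h hw) :
        K i ⊆ h ⁻¹' thickening δ (h '' K i))
    filter_upwards [Ioc_mem_nhdsGT hδ, Ioc_mem_nhdsGT hδ₂] with δ' h1 h2 w hw hw2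
    exact hdis.le_bot ⟨thickening_mono h1.2 _ hw2, hsub (thickening_mono h2.2 _ hw)⟩
  have ev := (eventually_all.2 fun i => eventually_all.2 (ev1 i)).and (eventually_all.2 ev2)
  obtain ⟨δ, ⟨hδ1, hδ2⟩, hδ0⟩ := (ev.and self_mem_nhdsWithin).exists
  refine H h hop hfix (Fin m) (fun i => thickening δ (K i)) ⟨fun i => isOpen_thickening,
    fun i => isPreconnected_thickening (hKc i i.2) δ, fun i j hij => hδ1 i j hij, hδ2⟩ z hz ?_
  intro t ht
  exact Or.inr ⟨⟨t, ht⟩, self_subset_thickening hδ0 _ (hstep t ht).1,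
    self_subset_thickening hδ0 _ (hstep t ht).2⟩

/-- The broken radius from `q` through `x` to `p`. -/
def vee (q x p : ℂ) (u : ℝ) : ℂ :=
  x + (max 0 (1 - 2 * u) : ℝ) * (q - x) + (max 0 (2 * u - 1) : ℝ) * (p - x)

theorem continuous_vee (q x p : ℂ) : Continuous (vee q x p) := by
  unfold vee; fun_prop

theorem vee_zero (q x p : ℂ) : vee q x p 0 = q := by simp [vee]
theorem vee_one (q x p : ℂ) : vee q x p 1 = p := by norm_num [vee]
theorem vee_half (q x p : ℂ) : vee q x p (1 / 2) = x := by norm_num [vee]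

theorem dist_vee {q x p : ℂ} {r : ℝ} (hq : dist q x = r) (hp : dist p x = r) (u : ℝ) :
    dist (vee q x p u) x = |1 - 2 * u| * r := by
  rw [dist_eq_norm] at *
  rcases le_total (2 * u) 1 with h | h
  · rw [vee, max_eq_right (by linarith), max_eq_left (by linarith), abs_of_nonneg (by linarith)]
    simp only [Complex.ofReal_zero, zero_mul, add_zero, add_sub_cancel_left, norm_mul, hq,
      Complex.norm_real, Real.norm_eq_abs]
    rw [abs_of_nonneg (by linarith)]
  · rw [vee, max_eq_left (by linarith), max_eq_right (by linarith), abs_of_nonpos (by linarith)]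
    simp only [Complex.ofReal_zero, zero_mul, add_zero, add_sub_cancel_left, norm_mul, hp,
      Complex.norm_real, Real.norm_eq_abs]
    rw [abs_of_nonneg (by linarith)]; ring

theorem injOn_vee {q x p : ℂ} {r : ℝ} (hr : 0 < r) (hq : dist q x = r) (hp : dist p x = r)
    (hqp : q ≠ p) : InjOn (vee q x p) (Icc 0 1) := by
  intro u _ v _ huv
  have h1 : |1 - 2 * u| = |1 - 2 * v| := by
    have := dist_vee hq hp u
    rw [huv, dist_vee hq hp v] at this
    exact (mul_right_cancel₀ hr.ne' this).symm
  rcases abs_eq_abs.1 h1 with h | h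
  · linarith
  have aux : ∀ u v : ℝ, vee q x p u = vee q x p v → 2 * u < 1 → 1 - 2 * u = -(1 - 2 * v) → False := by
    intro u v huv hu h
    rw [vee, vee, max_eq_right (by linarith : (0:ℝ) ≤ 1 - 2 * u),
      max_eq_left (by linarith : 2 * u - 1 ≤ 0), max_eq_left (by linarith : 1 - 2 * v ≤ 0),
      max_eq_right (by linarith : 0 ≤ 2 * v - 1), show 2 * v - 1 = 1 - 2 * u by linarith] at huv
    simp only [Complex.ofReal_zero, zero_mul, add_zero, add_right_inj] at huv
    have := mul_left_cancel₀ (by exact_mod_cast (by linarith : (1 - 2 * u) ≠ 0)) huv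
    exact hqp (sub_left_injective this)
  rcases lt_trichotomy (2 * u) 1 with h2 | h2 | h2
  · exact (aux u v huv h2 h).elim
  · linarith
  · exact (aux v u huv.symm (by linarith) (by linarith)).elim

/-- A translation arc through any point. -/
theorem exists_translation_arc (h : ℂ ≃ₜ ℂ) (hfix : ∀ z, h z ≠ z) (h2 : ∀ z, h (h z) ≠ z) (x : ℂ) :
    ∃ α : ℝ → ℂ, Continuous α ∧ InjOn α (Icc 0 1) ∧ α 1 = h (α 0) ∧ α (1 / 2) = x ∧
      ∀ u ∈ Icc (0 : ℝ) 1, ∀ v ∈ Icc (0 : ℝ) 1, h (α u) = α v → u = 0 ∧ v = 1 := by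
  have hc := h.continuous
  obtain ⟨q, hq⟩ := Continuous.exists_forall_le
    (f := fun z => max (dist z x) (dist (h z) x)) (by fun_prop)
    (tendsto_atTop_mono (fun z => le_max_left _ _) (tendsto_dist_right_cocompact_atTop x))
  set r := max (dist q x) (dist (h q) x) with hrdef
  have hr : 0 < r := by
    by_contra hneg
    have h1 : dist q x ≤ 0 := (le_max_left _ _).trans (not_lt.1 hneg)
    have h2 : dist (h q) x ≤ 0 := (le_max_right _ _).trans (not_lt.1 hneg)
    rw [dist_le_zero] at h1 h2
    exact hfix q (h2.trans h1.symm)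
  have hS : ∀ z, dist z x ≤ r → dist (h z) x ≤ r → dist z x = r ∧ dist (h z) x = r := by
    intro z h1 h2
    constructor
    · by_contra hne
      have hlt := lt_of_le_of_ne h1 hne
      have hmem : h z ∈ closure (ball x r) := by
        rw [closure_ball x hr.ne']; exact h2
      obtain ⟨w, hw1, hw2⟩ := mem_closure_iff.1 hmem (h.symm ⁻¹' ball x r)
        (isOpen_ball.preimage h.symm.continuous) (by simpa using hlt)
      have := hq (h.symm w)
      simp only [h.apply_symm_apply] at this
      exact absurd (max_lt hw1 hw2) (not_lt.2 this)
    · by_contra hne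
      have hlt := lt_of_le_of_ne h2 hne
      have hmem : z ∈ closure (ball x r) := by
        rw [closure_ball x hr.ne']; exact h1
      obtain ⟨w, hw1, hw2⟩ := mem_closure_iff.1 hmem (h ⁻¹' ball x r)
        (isOpen_ball.preimage hc) (by simpa using hlt)
      exact absurd (max_lt hw2 hw1) (not_lt.2 (hq w))
  obtain ⟨e1, e2⟩ := hS q (le_max_left _ _) (le_max_right _ _)
  have hqp : q ≠ h q := (hfix q).symm
  have hinj := injOn_vee hr e1 e2 hqp
  refine ⟨vee q x (h q), continuous_vee _ _ _, hinj, ?_, vee_half _ _ _, ?_⟩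
  · rw [vee_one, vee_zero]
  have hle : ∀ u ∈ Icc (0 : ℝ) 1, dist (vee q x (h q) u) x ≤ r := by
    intro u hu
    rw [dist_vee e1 e2]
    have : |1 - 2 * u| ≤ 1 := abs_le.2 ⟨by linarith [hu.2], by linarith [hu.1]⟩
    nlinarith
  have hend : ∀ u, dist (vee q x (h q) u) x = r → u = 0 ∨ u = 1 := by
    intro u hu
    rw [dist_vee e1 e2] at hu
    have : |1 - 2 * u| = 1 := by
      have : |1 - 2 * u| * r = 1 * r := by linarith
      exact mul_right_cancel₀ hr.ne' this
    rcases eq_or_eq_neg_of_abs_eq this with h | h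
    · left; linarith
    · right; linarith
  intro u hu v hv huv
  obtain ⟨g1, g2⟩ := hS _ (hle u hu) (huv ▸ hle v hv)
  rw [huv] at g2
  rcases hend u g1 with rfl | rfl <;> rcases hend v g2 with rfl | rfl
  · exact (hfix _ huv).elim
  · exact ⟨rfl, rfl⟩
  · rw [vee_one, vee_zero] at huv
    exact (h2 q huv).elim
  · exact (hfix _ huv).elim

/-- The half-infinite path obtained by iterating a translation arc. -/
def iterPath (h : ℂ → ℂ) (α : ℝ → ℂ) (u : ℝ) : ℂ := h^[⌊u⌋₊] (α (max u 0 - ⌊u⌋₊))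

theorem iterPath_of_mem {h : ℂ → ℂ} {α : ℝ → ℂ} (h1 : α 1 = h (α 0)) {k : ℕ} {u : ℝ}
    (hu : u ∈ Icc (k : ℝ) (k + 1)) : iterPath h α u = h^[k] (α (u - k)) := by
  have hk : (0 : ℝ) ≤ k := Nat.cast_nonneg k
  have hmax : max u 0 = u := max_eq_left (hk.trans hu.1)
  rcases hu.2.lt_or_eq with h2 | h2
  · have : ⌊u⌋₊ = k := (Nat.floor_eq_iff (hk.trans hu.1)).2 ⟨hu.1, h2⟩
    rw [iterPath, this, hmax]
  · have : ⌊u⌋₊ = k + 1 := (Nat.floor_eq_iff (hk.trans hu.1)).2 (by rw [h2]; push_cast; simp)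
    rw [iterPath, this, hmax, h2, Function.iterate_succ_apply]
    simp [h1]

theorem iterPath_add_one {h : ℂ → ℂ} {α : ℝ → ℂ} {u : ℝ} (hu : 0 ≤ u) :
    iterPath h α (u + 1) = h (iterPath h α u) := by
  rw [iterPath, iterPath, Nat.floor_add_one hu, Function.iterate_succ_apply',
    max_eq_left hu, max_eq_left (by linarith)]
  push_cast
  rw [add_sub_add_right_eq_sub]

theorem iterPath_add_nat {h : ℂ → ℂ} {α : ℝ → ℂ} {u : ℝ} (hu : 0 ≤ u) (k : ℕ) :
    iterPath h α (u + k) = h^[k] (iterPath h α u) := by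
  induction k with
  | zero => simp
  | succ k ih =>
    rw [Function.iterate_succ_apply', ← ih, ← iterPath_add_one (h := h) (by positivity)]
    push_cast; ring_nf

theorem continuous_iterPath {h : ℂ → ℂ} (hc : Continuous h) {α : ℝ → ℂ} (hα : Continuous α)
    (h1 : α 1 = h (α 0)) (N : ℕ) : ContinuousOn (iterPath h α) (Icc 0 N) := by
  induction N with
  | zero => simp
  | succ k ih =>
    have e : Icc (0 : ℝ) (k + 1 : ℕ) = Icc 0 (k : ℝ) ∪ Icc (k : ℝ) (k + 1) := by
      rw [Icc_union_Icc_eq_Icc (Nat.cast_nonneg k) (by linarith)]; push_cast; rfl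
    rw [e]
    refine ih.union_of_isClosed ?_ isClosed_Icc isClosed_Icc
    refine ContinuousOn.congr (f := fun u => h^[k] (α (u - k))) ?_ fun u hu => iterPath_of_mem h1 hu
    have := hc.iterate k
    fun_prop

theorem iterate_ne_of_noCycle {n : ℕ} (hn : 3 ≤ n) (IH : ∀ m, 1 ≤ m → m < n → NoCycle m)
    (h : ℂ ≃ₜ ℂ) (hop : OP h) (hfix : ∀ z, h z ≠ z) (x : ℂ) : h^[n] x ≠ x := by
  intro hx
  obtain ⟨α, hα, hαinj, hα1, hαx, hαh⟩ := exists_translation_arc h hfix (no_period_two hop hfix) x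
  set a := iterPath h α with ha
  have ac := fun N => continuous_iterPath h.continuous hα hα1 N
  have hadd : ∀ u, 0 ≤ u → a (u + 1) = h (a u) := fun u hu => iterPath_add_one hu
  have haddn : ∀ u, 0 ≤ u → ∀ k : ℕ, a (u + k) = h^[k] (a u) := fun u hu k =>
    iterPath_add_nat hu k
  have a01 : ∀ u ∈ Icc (0 : ℝ) 1, a u = α u := fun u hu => by
    have := iterPath_of_mem (k := 0) hα1 (u := u) (by simpa using hu)
    simpa using this
  have a12 : ∀ u ∈ Icc (1 : ℝ) 2, a u = h (α (u - 1)) := fun u hu => by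
    have := iterPath_of_mem (k := 1) hα1 (u := u) (by constructor <;> norm_num <;> linarith [hu.1, hu.2])
    simpa using this
  have inj2 : InjOn a (Icc 0 2) := by
    have aux : ∀ u v, u ∈ Icc (0 : ℝ) 1 → v ∈ Icc (1 : ℝ) 2 → a u = a v → u = v := by
      intro u v hu hv huv
      rw [a01 u hu, a12 v hv] at huv
      obtain ⟨e1, e2⟩ := hαh (v - 1) ⟨by linarith [hv.1], by linarith [hv.2]⟩ u hu huv.symm
      linarith
    intro u hu v hv huv
    rcases le_total u 1 with hu1 | hu1 <;> rcases le_total v 1 with hv1 | hv1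
    · rw [a01 u ⟨hu.1, hu1⟩, a01 v ⟨hv.1, hv1⟩] at huv
      exact hαinj ⟨hu.1, hu1⟩ ⟨hv.1, hv1⟩ huv
    · exact aux u v ⟨hu.1, hu1⟩ ⟨hv1, hv.2⟩ huv
    · exact (aux v u ⟨hv.1, hv1⟩ ⟨hu1, hu.2⟩ huv.symm).symm
    · rw [a12 u ⟨hu1, hu.2⟩, a12 v ⟨hv1, hv.2⟩] at huv
      have := hαinj ⟨by linarith, by linarith [hu.2]⟩ ⟨by linarith, by linarith [hv.2]⟩
        (h.injective huv)
      linarith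
  have gap : ∀ u v, 0 ≤ u → u < v → a u = a v → 1 < v - u := by
    intro u v hu huv heq
    by_contra hle
    have f1 := Nat.floor_le hu
    have f2 := Nat.lt_floor_add_one u
    have e1 := haddn (u - ⌊u⌋₊) (by linarith) ⌊u⌋₊
    have e2 := haddn (v - ⌊u⌋₊) (by linarith) ⌊u⌋₊
    rw [sub_add_cancel] at e1 e2
    rw [e1, e2] at heq
    have := inj2 ⟨by linarith, by linarith⟩ ⟨by linarith, by linarith⟩
      (h.injective.iterate _ heq)
    linarith
  -- first self-intersection
  set N : ℕ := n + 1
  have hNr : (N : ℝ) = n + 1 := by simp [N]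
  set K : Set (ℝ × ℝ) := {p | (p.1 ∈ Icc (0 : ℝ) N ∧ p.2 ∈ Icc (0 : ℝ) (n + 1 / 2)) ∧
    p.1 + 1 ≤ p.2 ∧ a p.1 = a p.2} with hKdef
  have hKc : IsCompact K := by
    have hb : IsCompact (Icc (0 : ℝ) N ×ˢ Icc (0 : ℝ) N) := isCompact_Icc.prod isCompact_Icc
    have hcl : IsClosed K := by
      have cont : ContinuousOn (fun p : ℝ × ℝ => a p.1 - a p.2) (Icc (0 : ℝ) N ×ˢ Icc (0 : ℝ) N) :=
        ((ac N).comp continuousOn_fst fun p hp => hp.1).sub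
          ((ac N).comp continuousOn_snd fun p hp => hp.2)
      have c1 := cont.preimage_isClosed_of_isClosed (isClosed_Icc.prod isClosed_Icc)
        (isClosed_singleton (x := (0 : ℂ)))
      have c2 : IsClosed {p : ℝ × ℝ | p.1 + 1 ≤ p.2 ∧ p.2 ≤ n + 1 / 2} :=
        (isClosed_le (continuous_fst.add continuous_const) continuous_snd).inter
          (isClosed_le continuous_snd continuous_const)
      convert c1.inter c2 using 1
      ext p
      simp only [hKdef, mem_ofPred_eq, mem_inter_iff, mem_prod, mem_preimage, mem_singleton_iff,
        sub_eq_zero, mem_Icc, hNr]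
      constructor
      · rintro ⟨⟨⟨h1, h2⟩, h3, h4⟩, h5, h6⟩
        exact ⟨⟨⟨⟨h1, h2⟩, h3, by linarith⟩, h6⟩, h5, h4⟩
      · rintro ⟨⟨⟨⟨h1, h2⟩, h3, h4⟩, h5⟩, h6, h7⟩
        exact ⟨⟨⟨h1, h2⟩, h3, h7⟩, h6, h5⟩
    refine hb.of_isClosed_subset hcl fun p hp => ⟨hp.1.1, hp.1.2.1, ?_⟩
    rw [hNr]; linarith [hp.1.2.2]
  have hn3 : (3 : ℝ) ≤ n := by exact_mod_cast hn
  have hKn : K.Nonempty := by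
    refine ⟨(1 / 2, 1 / 2 + n), ⟨⟨by norm_num, ?_⟩, by positivity, by linarith⟩, by linarith, ?_⟩
    · show (1 / 2 : ℝ) ≤ N
      rw [hNr]; linarith
    · show a (1 / 2) = a (1 / 2 + n)
      rw [haddn _ (by norm_num), a01 _ (by norm_num), hαx, hx]
  obtain ⟨⟨s, t⟩, hst, hmin⟩ := hKc.exists_isMinOn hKn continuousOn_snd
  have hmin' : ∀ u v, 0 ≤ u → u < v → v < t → a u ≠ a v := by
    intro u v hu huv hvt heq
    have g := gap u v hu huv heq
    have hvn : v ≤ n + 1 / 2 := hvt.le.trans hst.1.2.2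
    have : (u, v) ∈ K := ⟨⟨⟨hu, by simp only [hNr]; linarith⟩, by simp only; linarith, hvn⟩,
      by simp only; linarith, heq⟩
    have := hmin this
    simp only [mem_ofPred_eq] at this
    linarith
  obtain ⟨⟨⟨hs0, -⟩, ht0, htn⟩, hst1, hast⟩ := hst
  simp only at hs0 ht0 htn hst1 hast
  have hgt := gap s t hs0 (by linarith) hast
  have hs1 : s < 1 := by
    by_contra hge
    rw [not_lt] at hge
    refine hmin' (s - 1) (t - 1) (by linarith) (by linarith) (by linarith) (h.injective ?_)
    rw [← hadd _ (by linarith), ← hadd _ (by linarith), sub_add_cancel, sub_add_cancel, hast]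
  have ht2 : 2 < t := by
    by_contra hle
    rw [not_lt] at hle
    have := inj2 ⟨hs0, by linarith⟩ ⟨ht0, hle⟩ hast
    linarith
  have hmint : ∀ u, 0 ≤ u → u < t → a u = a t → u = s := by
    intro u hu hut heq
    rcases lt_trichotomy u s with hlt | hlt | hlt
    · exact (hmin' u s hu hlt (by linarith) (heq.trans hast.symm)).elim
    · exact hlt
    · exact (hmin' s u hs0 hlt hut (hast.trans heq.symm)).elim
  -- injectivity on `(s, t]`
  have hinj : ∀ u v, 0 ≤ u → s < v → v ≤ t → u < v → a u = a v → u = s ∧ v = t := by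
    intro u v hu hv hvt huv heq
    rcases hvt.lt_or_eq with h1 | h1
    · exact (hmin' u v hu huv h1 heq).elim
    · subst h1
      exact ⟨hmint u hu huv heq, rfl⟩
  have acon : ∀ l r : ℝ, 0 ≤ l → r ≤ N → ContinuousOn a (Icc l r) := fun l r hl hr =>
    (ac N).mono (Icc_subset_Icc hl hr)
  have htN : t ≤ N := by rw [hNr]; linarith
  rcases lt_or_ge (t - s) 2 with hT | hT
  · refine (IH 2 (by norm_num) (by omega)).compact hop hfix
      (fun i => if i = 0 then a '' Icc (t - 1) (s + 1) else {a t}) ?_ ?_ ?_ ?_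
      (fun i => if i = 1 then a (t - 1) else a s) (by simp) ?_
    · intro i _
      split_ifs
      · exact isCompact_Icc.image_of_continuousOn (acon _ _ (by linarith) (by linarith))
      · exact isCompact_singleton
    · intro i _
      split_ifs
      · exact isPreconnected_Icc.image _ (acon _ _ (by linarith) (by linarith))
      · exact isPreconnected_singleton
    · intro i hi j hj hij
      obtain rfl : i = 0 := by omega
      obtain rfl : j = 1 := by omega
      simp only [if_true, one_ne_zero, if_false, disjoint_singleton_right]
      rintro ⟨u, hu, hut⟩
      have := hmint u (by linarith [hu.1]) (by linarith [hu.2]) hut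
      linarith [hu.1]
    · intro i hi z hz
      split_ifs at hz ⊢ with h0
      · obtain ⟨u, hu, rfl⟩ := hz
        rintro ⟨v, hv, hvu⟩
        have e1 := hadd (u - 1) (by linarith [hu.1])
        have e2 := hadd (v - 1) (by linarith [hv.1])
        rw [sub_add_cancel] at e1 e2
        rw [e2] at hvu
        have := inj2 ⟨by linarith [hv.1], by linarith [hv.2]⟩ ⟨by linarith [hu.1], by linarith [hu.2]⟩
          (h.injective hvu)
        linarith [hv.2, hu.1]
      · rw [mem_singleton_iff] at hz ⊢
        rw [hz]
        exact hfix _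
    · intro i hi
      have : i = 0 ∨ i = 1 := by omega
      rcases this with rfl | rfl
      · simp only [if_true, zero_ne_one, if_false, zero_add]
        rw [← hadd s hs0]
        exact ⟨⟨s + 1, ⟨by linarith, le_rfl⟩, rfl⟩, ⟨t - 1, ⟨le_rfl, by linarith⟩, rfl⟩⟩
      · simp only [if_true, one_ne_zero, if_false]
        rw [← hadd _ (by linarith)]
        norm_num [hast]
  · set T := t - s with hTdef
    obtain ⟨m, hm1, hm2, hmn⟩ : ∃ m : ℕ, (m : ℝ) ≤ T ∧ T < 2 * m ∧ m < n := by
      refine ⟨⌊T / 2⌋₊ + 1, ?_, ?_, ?_⟩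
      · push_cast; linarith [Nat.floor_le (show 0 ≤ T / 2 by linarith)]
      · push_cast; linarith [Nat.lt_floor_add_one (T / 2)]
      · have : ((⌊T / 2⌋₊ + 1 : ℕ) : ℝ) < n := by
          push_cast; linarith [Nat.floor_le (show 0 ≤ T / 2 by linarith)]
        exact_mod_cast this
    have hm0 : (0 : ℝ) < m := by linarith
    have hm0' : 1 ≤ m := by
      have : 0 < m := by exact_mod_cast hm0
      omega
    set τ := T / m with hτ
    have hτ1 : 1 ≤ τ := by rw [hτ, le_div_iff₀ hm0]; linarith
    have hτ2 : τ < 2 := by rw [hτ, div_lt_iff₀ hm0]; linarith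
    have hmτ : m * τ = T := by rw [hτ]; field_simp
    have hbd : ∀ i < m, 0 ≤ (i : ℝ) * τ ∧ (i + 1 : ℝ) * τ ≤ T := by
      intro i hi
      refine ⟨by positivity, ?_⟩
      rw [← hmτ]
      have : (i + 1 : ℝ) ≤ m := by exact_mod_cast hi
      nlinarith
    refine (IH m hm0' hmn).compact hop hfix
      (fun i => a '' Icc (s + i * τ + 1) (s + (i + 1) * τ)) ?_ ?_ ?_ ?_
      (fun i => a (s + i * τ)) ?_ ?_
    · intro i hi
      obtain ⟨b1, b2⟩ := hbd i hi
      exact isCompact_Icc.image_of_continuousOn (acon _ _ (by linarith) (by linarith))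
    · intro i hi
      obtain ⟨b1, b2⟩ := hbd i hi
      exact isPreconnected_Icc.image _ (acon _ _ (by linarith) (by linarith))
    · intro i hi j hj hij
      rw [Set.disjoint_left]
      rintro _ ⟨u, hu, rfl⟩ ⟨v, hv, huv⟩
      obtain ⟨b1, b2⟩ := hbd i hi
      obtain ⟨b3, b4⟩ := hbd j hj
      have : (i + 1 : ℝ) ≤ j := by exact_mod_cast hij
      have hlt : u < v := by nlinarith [hu.2, hv.1]
      have := (hinj u v (by linarith [hu.1]) (by linarith [hv.1]) (by linarith [hv.2]) hlt huv.symm).1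
      linarith [hu.1]
    · rintro i hi _ ⟨u, hu, rfl⟩ ⟨v, hv, huv⟩
      obtain ⟨b1, b2⟩ := hbd i hi
      have e2 := hadd (v - 1) (by linarith [hv.1])
      rw [sub_add_cancel] at e2
      rw [e2] at huv
      have := hinj (v - 1) u (by linarith [hv.1]) (by linarith [hu.1]) (by linarith [hu.2])
        (by linarith [hv.2, hu.1]) (h.injective huv)
      linarith [hv.1, hu.2, add_one_mul (i : ℝ) τ]
    · simp only [hmτ, Nat.cast_zero, zero_mul, add_zero]
      rw [hast]; congr 1; rw [hTdef]; ring
    · intro i hi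
      obtain ⟨b1, b2⟩ := hbd i hi
      rw [← hadd _ (by linarith)]
      refine ⟨⟨_, ⟨le_rfl, ?_⟩, rfl⟩, ⟨_, ⟨?_, le_rfl⟩, ?_⟩⟩
      · nlinarith
      · nlinarith
      · push_cast; rfl

/-- Franks' lemma: a fixed point free orientation preserving homeomorphism of the plane has no
periodic chain of free sets. -/
theorem noCycle (n : ℕ) (hn : 1 ≤ n) : NoCycle n := by
  induction n using Nat.strong_induction_on with
  | _ n ih =>
  refine noCycle_of hn (fun m h1 h2 => ih m h2 h1) fun h hop hfix x => ?_
  rcases Nat.lt_or_ge n 3 with h3 | h3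
  · have : n = 1 ∨ n = 2 := by omega
    rcases this with rfl | rfl
    · exact hfix x
    · exact no_period_two hop hfix x
  · exact iterate_ne_of_noCycle h3 (fun m h1 h2 => ih m h2 h1) h hop hfix x

/-- A chain of iterates and jumps inside members of `V`, from `V i` to `V j`. -/
def ChainRel (h : ℂ → ℂ) {ι : Type} (V : ι → Set ℂ) (i j : ι) : Prop :=
  ∃ n : ℕ, ∃ z : ℕ → ℂ, 1 ≤ n ∧ z 0 ∈ V i ∧
    (∀ t, t + 1 < n → z (t + 1) = h (z t) ∨ ∃ i, h (z t) ∈ V i ∧ z (t + 1) ∈ V i) ∧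
    h (z (n - 1)) ∈ V j

theorem ChainRel.trans {h : ℂ → ℂ} {ι : Type} {V : ι → Set ℂ} {i j k : ι}
    (h1 : ChainRel h V i j) (h2 : ChainRel h V j k) : ChainRel h V i k := by
  obtain ⟨n, z, hn, z0, zs, ze⟩ := h1
  obtain ⟨m, w, hm, w0, ws, we⟩ := h2
  refine ⟨n + m, fun t => if t < n then z t else w (t - n), by omega, ?_, ?_, ?_⟩
  · show (if 0 < n then z 0 else w (0 - n)) ∈ V i
    rwa [if_pos (show 0 < n by omega)]
  · intro t ht
    dsimp only
    rcases lt_trichotomy (t + 1) n with h | h | h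
    · rw [if_pos h, if_pos (by omega)]; exact zs t h
    · rw [if_neg (by omega), if_pos (by omega), h, Nat.sub_self]
      refine Or.inr ⟨j, ?_, w0⟩
      rwa [show t = n - 1 by omega]
    · rw [if_neg (by omega), if_neg (by omega), show t + 1 - n = t - n + 1 by omega]
      exact ws _ (by omega)
  · dsimp only
    rwa [if_neg (by omega), show n + m - 1 - n = m - 1 by omega]

theorem ChainRel.of_iterate {h : ℂ → ℂ} {ι : Type} {V : ι → Set ℂ} {i j : ι} {k : ℕ} (hk : 1 ≤ k)
    {z : ℂ} (hz : z ∈ V i) (hkz : h^[k] z ∈ V j) : ChainRel h V i j := by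
  refine ⟨k, fun t => h^[t] z, hk, by simpa, fun t _ => Or.inl (Function.iterate_succ_apply' _ _ _),
    ?_⟩
  rw [← Function.iterate_succ_apply' h, show (k - 1).succ = k by omega]
  exact hkz

theorem not_chainRel_self {h : ℂ ≃ₜ ℂ} (hop : OP h) (hfix : ∀ z, h z ≠ z) {ι : Type}
    {V : ι → Set ℂ} (hV : FreeFamily h V) (i : ι) : ¬ ChainRel h V i i := by
  rintro ⟨n, z, hn, z0, zs, ze⟩
  refine noCycle n hn h hop hfix ι V hV (fun t => if t < n then z t else z 0) (by simp) ?_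
  intro t ht
  rw [if_pos ht]
  rcases Nat.lt_or_ge (t + 1) n with h | h
  · rw [if_pos h]; exact zs t h
  · rw [if_neg (by omega)]
    refine Or.inr ⟨i, ?_, z0⟩
    rwa [show t = n - 1 by omega]

/-- `G` commutes with the deck transformation. -/
def Comm (G : ℂ → ℂ) : Prop := ∀ ζ, G (ζ + 2 * π * Complex.I) = G ζ + 2 * π * Complex.I

theorem Comm.int {G : ℂ → ℂ} (hG : Comm G) (ζ : ℂ) (n : ℤ) :
    G (ζ + n * (2 * π * Complex.I)) = G ζ + n * (2 * π * Complex.I) :=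
  shift_int (M := fun p => G p.2) (fun _ ζ => hG ζ) 0 ζ n

theorem Comm.iterate {G : ℂ → ℂ} (hG : Comm G) (k : ℕ) : Comm G^[k] := by
  induction k with
  | zero => intro ζ; rfl
  | succ k ih => intro ζ; rw [Function.iterate_succ_apply', ih, hG, Function.iterate_succ_apply']

structure Good (G : ℂ → ℂ) (U : Set ℂ) : Prop where
  isOpen : IsOpen U
  isPreconnected : IsPreconnected U
  free : ∀ z ∈ U, G z ∉ U
  transl : ∀ m : ℤ, m ≠ 0 → ∀ z ∈ U, z + m * (2 * π * Complex.I) ∉ U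

theorem Good.mono {G : ℂ → ℂ} {U U' : Set ℂ} (h : Good G U) (ho : IsOpen U')
    (hc : IsPreconnected U') (hs : U' ⊆ U) : Good G U' :=
  ⟨ho, hc, fun z hz hz' => h.free z (hs hz) (hs hz'), fun m hm z hz hz' =>
    h.transl m hm z (hs hz) (hs hz')⟩

/-- `m` is the winding of some return to `U`. -/
def Ret (G : ℂ → ℂ) (U : Set ℂ) (m : ℤ) : Prop :=
  ∃ k : ℕ, 1 ≤ k ∧ ∃ z ∈ U, G^[k] z - m * (2 * π * Complex.I) ∈ U

theorem Ret.mono {G : ℂ → ℂ} {U U' : Set ℂ} {m : ℤ} (h : Ret G U m) (hs : U ⊆ U') : Ret G U' m := by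
  obtain ⟨k, hk, z, hz, hz'⟩ := h
  exact ⟨k, hk, z, hs hz, hs hz'⟩

def shiftSet (U : Set ℂ) (j : ℤ) : Set ℂ := {z | z - j * (2 * π * Complex.I) ∈ U}

theorem Good.freeFamily {G : ℂ → ℂ} (hG : Comm G) {U : Set ℂ} (h : Good G U) :
    FreeFamily G (shiftSet U) := by
  refine ⟨fun j => h.isOpen.preimage (by fun_prop), fun j => ?_, fun i j hij => ?_, fun j z hz hz' => ?_⟩
  · have : shiftSet U j = (fun z => z + j * (2 * π * Complex.I)) '' U := by
      ext z
      simp only [shiftSet, mem_ofPred_eq, mem_image]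
      exact ⟨fun h => ⟨_, h, by ring⟩, by rintro ⟨w, hw, rfl⟩; simpa⟩
    rw [this]
    exact h.isPreconnected.image _ (by fun_prop)
  · rw [Set.disjoint_left]
    intro z hz hz'
    refine h.transl (i - j) (sub_ne_zero.2 hij) _ hz ?_
    have h2 : z - j * (2 * π * Complex.I) ∈ U := hz'
    convert! h2 using 1
    push_cast; ring
  · have := hG.int (z - j * (2 * π * Complex.I)) j
    rw [sub_add_cancel] at this
    refine h.free _ hz ?_
    have h2 : G z - j * (2 * π * Complex.I) ∈ U := hz'
    rwa [this, add_sub_cancel_right] at h2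

theorem Ret.chainRel {G : ℂ → ℂ} (hG : Comm G) {U : Set ℂ} {m : ℤ} (h : Ret G U m) (i : ℤ) :
    ChainRel G (shiftSet U) i (i + m) := by
  obtain ⟨k, hk, z, hz, hkz⟩ := h
  refine ChainRel.of_iterate hk (z := z + i * (2 * π * Complex.I)) ?_ ?_
  · simpa [shiftSet]
  · show _ - _ ∈ U
    rw [(hG.iterate k).int]
    convert! hkz using 1
    push_cast; ring

theorem Ret.chainRel_mul {G : ℂ → ℂ} (hG : Comm G) {U : Set ℂ} {m : ℤ} (h : Ret G U m) (i : ℤ)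
    (n : ℕ) (hn : 1 ≤ n) : ChainRel G (shiftSet U) i (i + n * m) := by
  induction n, hn using Nat.le_induction with
  | base => simpa using h.chainRel hG i
  | succ n hn ih =>
    have := ih.trans (h.chainRel hG _)
    convert! this using 1
    push_cast; ring

theorem Ret.sign {G : ℂ ≃ₜ ℂ} (hop : OP G) (hfix : ∀ z, G z ≠ z) (hG : Comm G) {U : Set ℂ}
    (hU : Good G U) {m m' : ℤ} (h : Ret G U m) (h' : Ret G U m') (hm : 0 ≤ m) (hm' : m' ≤ 0) :
    False := by
  have key := not_chainRel_self hop hfix (hU.freeFamily hG)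
  rcases hm.eq_or_lt with rfl | hm
  · exact key 0 (by simpa using h.chainRel hG 0)
  rcases hm'.eq_or_lt with rfl | hm'
  · exact key 0 (by simpa using h'.chainRel hG 0)
  have a := h.chainRel_mul hG 0 m'.natAbs (by omega)
  have b := h'.chainRel_mul hG (0 + m'.natAbs * m) m.natAbs (by omega)
  have c := a.trans b
  refine key 0 ?_
  convert! c using 1
  have e1 : (m'.natAbs : ℤ) = -m' := by omega
  have e2 : (m.natAbs : ℤ) = m := by omega
  rw [e1, e2]; ring

/-- Small balls are good. -/
theorem exists_good_ball {G : ℂ → ℂ} (hc : Continuous G) (hfix : ∀ z, G z ≠ z) (x : ℂ) :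
    ∃ ε > 0, ∀ ε' ≤ ε, Good G (ball x ε') := by
  have h1 : ∀ᶠ z in 𝓝 x, dist z x < dist (G x) x / 2 ∧ dist (G z) (G x) < dist (G x) x / 2 := by
    have hd : 0 < dist (G x) x / 2 := by have := dist_pos.2 (hfix x); linarith
    have a : ∀ᶠ z in 𝓝 x, dist z x < dist (G x) x / 2 := ball_mem_nhds x hd
    have b : ∀ᶠ z in 𝓝 x, dist (G z) (G x) < dist (G x) x / 2 :=
      hc.continuousAt (ball_mem_nhds (G x) hd)
    exact a.and b
  obtain ⟨ε, hε, hb⟩ := Metric.eventually_nhds_iff.1 h1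
  refine ⟨min ε 1, by positivity, fun ε' hε' => ⟨isOpen_ball, (convex_ball _ _).isPreconnected, ?_, ?_⟩⟩
  · intro z hz hz'
    have a := (hb (lt_of_lt_of_le (mem_ball.1 hz) (hε'.trans (min_le_left _ _)))).2
    have b := (hb (lt_of_lt_of_le (mem_ball.1 hz') (hε'.trans (min_le_left _ _)))).1
    have c := dist_triangle (G x) (G z) x
    rw [dist_comm (G x) (G z)] at c
    linarith
  · intro m hm z hz hz'
    have a := mem_ball.1 hz
    have b := mem_ball.1 hz'
    have c := dist_triangle_right (z + m * (2 * π * Complex.I)) z x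
    have d : dist (z + m * (2 * π * Complex.I)) z = |(m : ℝ)| * (2 * π) := by
      rw [dist_eq_norm, add_sub_cancel_left]
      simp [abs_of_pos Real.pi_pos]
    have e : (1 : ℝ) ≤ |(m : ℝ)| := by
      have : 1 ≤ |m| := Int.one_le_abs hm
      exact_mod_cast this
    have := hε'.trans (min_le_right _ _)
    nlinarith [Real.pi_gt_three]

/-- If every nonempty open set of the left half plane returns and the imaginary axis moves up, then
all returns to good sets have positive winding. -/
theorem returns_pos {G : ℂ ≃ₜ ℂ} (hop : OP G) (hfix : ∀ z, G z ≠ z) (hG : Comm G)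
    (hrec : ∀ U : Set ℂ, IsOpen U → U.Nonempty → (∀ z ∈ U, z.re < 0) → ∃ m, Ret G U m)
    (hGH : ∀ z, z.re < 0 → (G z).re < 0)
    (haxis : ∀ z, z.re = 0 → (G z).re = 0 ∧ z.im < (G z).im)
    {U : Set ℂ} (hU : Good G U) (hUH : ∀ z ∈ U, z.re < 0) {m : ℤ} (hm : Ret G U m) : 0 < m := by
  set H : Set ℂ := {z | z.re < 0} with hH
  have hHo : IsOpen H := isOpen_lt (by fun_prop) (by fun_prop)
  have hHc : IsPreconnected H := (convex_halfSpace_re_lt 0).isPreconnected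
  have hHn : H.Nonempty := ⟨-1, by simp [hH]⟩
  -- points with good neighbourhoods of given sign
  let P : (ℤ → Prop) → Set ℂ := fun p => {x | x ∈ H ∧ ∃ W, Good G W ∧ W ⊆ H ∧ x ∈ W ∧ ∃ m, p m ∧ Ret G W m}
  have hPo : ∀ p, IsOpen (P p) := by
    intro p
    rw [isOpen_iff_mem_nhds]
    rintro x ⟨hx, W, hW, hWH, hxW, hm⟩
    filter_upwards [hW.isOpen.mem_nhds hxW] with y hy
    exact ⟨hWH hy, W, hW, hWH, hy, hm⟩
  have hsmall : ∀ x ∈ H, ∀ W, IsOpen W → x ∈ W → ∃ W', Good G W' ∧ W' ⊆ H ∧ x ∈ W' ∧ W' ⊆ W := by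
    intro x hx W hW hxW
    obtain ⟨ε, hε, hg⟩ := exists_good_ball G.continuous hfix x
    obtain ⟨δ, hδ, hd⟩ := Metric.isOpen_iff.1 (hW.inter hHo) x ⟨hxW, hx⟩
    have hs : ball x (min ε δ) ⊆ W ∩ H := (ball_subset_ball (min_le_right _ _)).trans hd
    exact ⟨_, hg _ (min_le_left _ _), fun z hz => (hs hz).2, mem_ball_self (by positivity),
      fun z hz => (hs hz).1⟩
  have hcover : H ⊆ P (fun m => 0 < m) ∪ P (fun m => m < 0) := by
    intro x hx
    obtain ⟨W, hW, hWH, hxW, -⟩ := hsmall x hx univ isOpen_univ (mem_univ _)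
    obtain ⟨m, hm⟩ := hrec W hW.isOpen ⟨x, hxW⟩ hWH
    rcases lt_trichotomy m 0 with h | h | h
    · exact Or.inr ⟨hx, W, hW, hWH, hxW, m, h, hm⟩
    · exact (hm.sign hop hfix hG hW hm h.ge h.le).elim
    · exact Or.inl ⟨hx, W, hW, hWH, hxW, m, h, hm⟩
  have hdisj : ∀ x, x ∈ P (fun m => 0 < m) → x ∈ P (fun m => m < 0) → False := by
    rintro x ⟨hx, W, hW, hWH, hxW, m, hm0, hm⟩ ⟨-, W', hW', -, hxW', m', hm0', hm'⟩
    obtain ⟨W₂, hW₂, hH₂, hx₂, hs⟩ := hsmall x hx (W ∩ W') (hW.isOpen.inter hW'.isOpen) ⟨hxW, hxW'⟩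
    obtain ⟨k, hk⟩ := hrec W₂ hW₂.isOpen ⟨x, hx₂⟩ hH₂
    rcases le_total 0 k with h | h
    · exact (hk.mono fun z hz => (hs hz).2).sign hop hfix hG hW' hm' h hm0'.le
    · exact hm.sign hop hfix hG hW (hk.mono fun z hz => (hs hz).1) hm0.le h
  -- a positive return near the axis
  have hpos : (P (fun m => 0 < m)).Nonempty := by
    let e : ℕ → ℂ := fun k => Complex.exp (G^[k] 0)
    have hre : ∀ k, (G^[k] 0).re = 0 := by
      intro k
      induction k with
      | zero => simp
      | succ k ih => rw [Function.iterate_succ_apply']; exact (haxis _ ih).1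
    have hmono : StrictMono fun k => (G^[k] 0).im := strictMono_nat_of_lt_succ fun k => by
      rw [Function.iterate_succ_apply']; exact (haxis _ (hre k)).2
    have he : ∀ k, e k ∈ sphere (0 : ℂ) 1 := by
      intro k
      simp [e, Complex.norm_exp, hre k]
    obtain ⟨c, hc, φ, hφ, hlim⟩ := (isCompact_sphere (0 : ℂ) 1).tendsto_subseq he
    have hc0 : c ≠ 0 := by
      rintro rfl
      simp at hc
    set x := Complex.log c with hx
    have hxc : Complex.exp x = c := Complex.exp_log hc0
    have hxre : x.re = 0 := by
      have : ‖c‖ = 1 := by simpa using hc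
      rw [hx, Complex.log_re, this, Real.log_one]
    obtain ⟨ε, hε, hg⟩ := exists_good_ball G.continuous hfix x
    set δ := min ε 1 with hδ
    have hδ0 : 0 < δ := by positivity
    have hgood := hg δ (min_le_left _ _)
    have hopen : Complex.exp '' ball x δ ∈ 𝓝 c := by
      rw [← hxc]
      exact Complex.isOpenMap_exp.image_mem_nhds (ball_mem_nhds x hδ0)
    have hev : ∀ᶠ j in atTop, e (φ j) ∈ Complex.exp '' ball x δ := hlim hopen
    obtain ⟨j, hj⟩ := hev.exists_forall_of_atTop
    have hrep : ∀ i, j ≤ i → ∃ m : ℤ, G^[φ i] 0 - m * (2 * π * Complex.I) ∈ ball x δ := by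
      intro i hi
      obtain ⟨w, hw, hwe⟩ := hj i hi
      obtain ⟨m, hm⟩ := Complex.exp_eq_exp_iff_exists_int.1 hwe.symm
      exact ⟨m, by rw [hm, add_sub_cancel_right]; exact hw⟩
    obtain ⟨m₁, h1⟩ := hrep j le_rfl
    obtain ⟨m₂, h2⟩ := hrep (j + 1) (by omega)
    have hlt : φ j < φ (j + 1) := hφ (by omega)
    set k := φ (j + 1) - φ j with hk
    set w := G^[φ j] 0 - m₁ * (2 * π * Complex.I) with hw
    have hwre : w.re = 0 := by simp [hw, hre]
    have hGw : G^[k] w - (m₂ - m₁ : ℤ) * (2 * π * Complex.I) ∈ ball x δ := by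
      have := (hG.iterate k).int (G^[φ j] 0) (-m₁)
      rw [hw, sub_eq_add_neg (G^[φ j] 0), ← neg_mul, ← Int.cast_neg, this,
        ← Function.iterate_add_apply, show k + φ j = φ (j + 1) by omega]
      convert! h2 using 1
      push_cast; ring
    have hmpos : 0 < m₂ - m₁ := by
      have hge : -1 < m₂ - m₁ := by
        have i1 : |(w - x).im| < 1 := (Complex.abs_im_le_norm _).trans_lt
          ((mem_ball_iff_norm.1 h1).trans_le (min_le_right _ _))
        have i2 : |(G^[φ (j + 1)] 0 - m₂ * (2 * π * Complex.I) - x).im| < 1 :=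
          (Complex.abs_im_le_norm _).trans_lt ((mem_ball_iff_norm.1 h2).trans_le (min_le_right _ _))
        have i3 := hmono hlt
        rw [abs_lt] at i1 i2
        simp only [hw, Complex.sub_im, Complex.mul_im, Complex.intCast_re, Complex.intCast_im,
          Complex.mul_re, Complex.re_ofNat, Complex.im_ofNat, Complex.ofReal_re, Complex.ofReal_im,
          Complex.I_re, Complex.I_im] at i1 i2 i3
        have : (-1 : ℝ) < m₂ - m₁ := by
          have := Real.pi_gt_three
          by_contra hcon
          nlinarith
        exact_mod_cast this
      rcases (show 0 ≤ m₂ - m₁ by omega).eq_or_lt with h | h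
      · exfalso
        have hr : Ret G (ball x δ) (m₂ - m₁) := ⟨k, by omega, w, h1, hGw⟩
        exact hr.sign hop hfix hG hgood hr h.le h.ge
      · exact h
    -- perturb into the half plane
    have hGHk : ∀ n z, z.re < 0 → (G^[n] z).re < 0 := by
      intro n
      induction n with
      | zero => intro z hz; simpa
      | succ n ih => intro z hz; rw [Function.iterate_succ_apply']; exact hGH _ (ih z hz)
    have hO : IsOpen (ball x δ ∩ {z | G^[k] z - (m₂ - m₁ : ℤ) * (2 * π * Complex.I) ∈ ball x δ}) := by
      have := G.continuous.iterate k
      exact isOpen_ball.inter (isOpen_ball.preimage (by fun_prop))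
    have hcl : w ∈ closure H := by
      have : closure H = {z | z.re ≤ 0} := Complex.closure_setOfPred_re_lt 0
      rw [this]; exact hwre.le
    obtain ⟨v, ⟨hv1, hv2⟩, hvH⟩ := mem_closure_iff.1 hcl _ hO ⟨h1, hGw⟩
    refine ⟨v, hvH, ball x δ ∩ H, hgood.mono (isOpen_ball.inter hHo)
      ((convex_ball x δ).inter (convex_halfSpace_re_lt 0)).isPreconnected inter_subset_left,
      inter_subset_right, ⟨hv1, hvH⟩, m₂ - m₁, hmpos, k, by omega, v, ⟨hv1, hvH⟩, hv2, ?_⟩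
    have := hGHk k v hvH
    simpa [hH] using this
  have hall : H ⊆ P (fun m => 0 < m) := by
    refine hHc.subset_left_of_subset_union (hPo _) (hPo _) ?_ hcover ?_
    · rw [Set.disjoint_left]; exact hdisj
    · obtain ⟨v, hv⟩ := hpos
      exact ⟨v, hv.1, hv⟩
  by_contra hcon
  obtain ⟨k, hk, z, hz, hz'⟩ := hm
  obtain ⟨hx, W, hW, hWH, hxW, -⟩ := hall (hUH z hz)
  rcases (not_lt.1 hcon).eq_or_lt with h0 | h0
  · exact Ret.sign hop hfix hG hU ⟨k, hk, z, hz, hz'⟩ ⟨k, hk, z, hz, hz'⟩ h0.ge h0.le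
  · exact hdisj z (hall (hUH z hz)) ⟨hUH z hz, U, hU, hUH, hz, m, h0, k, hk, z, hz, hz'⟩

/-- `z` lies in some deck translate of `U`. -/
def Vis (U : Set ℂ) (z : ℂ) : Prop := ∃ m : ℤ, z - m * (2 * π * Complex.I) ∈ U

theorem vis_iff_exp_mem {U : Set ℂ} {z : ℂ} : Vis U z ↔ Complex.exp z ∈ Complex.exp '' U := by
  constructor
  · rintro ⟨m, hm⟩
    exact ⟨_, hm, Complex.exp_eq_exp_iff_exists_int.2 ⟨-m, by push_cast; ring⟩⟩
  · rintro ⟨w, hw, hwe⟩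
    obtain ⟨m, hm⟩ := Complex.exp_eq_exp_iff_exists_int.1 hwe.symm
    exact ⟨m, by rw [hm, add_sub_cancel_right]; exact hw⟩

/-- All returns to `U` wind positively and `U` is short. -/
structure PosSet (G : ℂ → ℂ) (U : Set ℂ) : Prop where
  pos : ∀ m, Ret G U m → 0 < m
  short : ∀ u ∈ U, ∀ v ∈ U, |u.im - v.im| ≤ π

theorem ret_of_visits {G : ℂ → ℂ} (hG : Comm G) {U : Set ℂ} {x y : ℂ} {k : ℕ} (hk : 1 ≤ k)
    {m m' : ℤ} (hm : x - m * (2 * π * Complex.I) ∈ U) (hy : y = G^[k] x)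
    (hm' : y - m' * (2 * π * Complex.I) ∈ U) : Ret G U (m' - m) := by
  refine ⟨k, hk, _, hm, ?_⟩
  have := (hG.iterate k).int x (-m)
  rw [sub_eq_add_neg x, ← neg_mul, ← Int.cast_neg, this, ← hy]
  convert! hm' using 1
  push_cast; ring

theorem im_sub_ge {U : Set ℂ} (hs : ∀ u ∈ U, ∀ v ∈ U, |u.im - v.im| ≤ π) {x y : ℂ} {m m' : ℤ}
    (hm : x - m * (2 * π * Complex.I) ∈ U) (hm' : y - m' * (2 * π * Complex.I) ∈ U) :
    2 * π * (m' - m) - π ≤ y.im - x.im := by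
  have := (abs_le.1 (hs _ hm' _ hm)).1
  simp only [Complex.sub_im, Complex.mul_im, Complex.intCast_re, Complex.intCast_im,
          Complex.mul_re, Complex.re_ofNat, Complex.im_ofNat, Complex.ofReal_re, Complex.ofReal_im,
          Complex.I_re, Complex.I_im] at this
  linarith

open Classical in
/-- Erasing loops: the vertical displacement of an orbit segment is bounded below. -/
theorem im_iterate_ge {G : ℂ → ℂ} (hG : Comm G) {C : ℝ} (hC : 0 ≤ C)
    (hGH : ∀ z, z.re < 0 → (G z).re < 0)
    (hb : ∀ z, z.re < 0 → -C ≤ (G z).im - z.im) {ι : Type} (B : ι → Set ℂ)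
    (hB : ∀ i, PosSet G (B i)) (n : ℕ) :
    ∀ (I : Finset ι) (x : ℂ), x.re < 0 →
      -C * I.card - C * ((Finset.range n).filter fun t => ∀ i ∈ I, ¬ Vis (B i) (G^[t] x)).card
        ≤ (G^[n] x).im - x.im := by
  have hGHk : ∀ n z, z.re < 0 → (G^[n] z).re < 0 := by
    intro n
    induction n with
    | zero => intro z hz; simpa
    | succ n ih => intro z hz; rw [Function.iterate_succ_apply']; exact hGH _ (ih z hz)
  induction n using Nat.strong_induction_on with
  | _ n ih =>
  intro I x hx
  rcases Nat.eq_zero_or_pos n with rfl | hn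
  · simp; positivity
  by_cases hcov : ∀ i ∈ I, ¬ Vis (B i) x
  · have h1 := ih (n - 1) (by omega) I (G x) (hGH x hx)
    have h2 := hb x hx
    rw [← Function.iterate_succ_apply, show (n - 1).succ = n by omega] at h1
    have h3 : ((Finset.range n).filter fun t => ∀ i ∈ I, ¬ Vis (B i) (G^[t] x)).card =
        ((Finset.range (n - 1)).filter fun t => ∀ i ∈ I, ¬ Vis (B i) (G^[t] (G x))).card + 1 := by
      rw [show n = (n - 1) + 1 by omega, Finset.range_add_one', Finset.filter_insert, if_pos (by simpa),
        Finset.card_insert_of_notMem (by simp)]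
      congr 1
      rw [Finset.filter_map, Finset.card_map]
      rfl
    rw [h3]
    push_cast
    linarith
  · push Not at hcov
    obtain ⟨i, hi, m, hm⟩ := hcov
    set b := Nat.findGreatest (fun t => Vis (B i) (G^[t] x)) (n - 1) with hbdef
    have hbv : Vis (B i) (G^[b] x) :=
      Nat.findGreatest_spec (P := fun t => Vis (B i) (G^[t] x)) (Nat.zero_le _) ⟨m, hm⟩
    have hbn : b ≤ n - 1 := Nat.findGreatest_le _
    have hlast : ∀ t, b < t → t < n → ¬ Vis (B i) (G^[t] x) := fun t h1 h2 =>
      Nat.findGreatest_is_greatest h1 (by omega)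
    have hdisp : 0 ≤ (G^[b] x).im - x.im := by
      rcases Nat.eq_zero_or_pos b with h0 | h0
      · simp [h0]
      obtain ⟨m', hm'⟩ := hbv
      have h1 := (hB i).pos _ (ret_of_visits hG h0 hm rfl hm')
      have h2 := im_sub_ge (hB i).short hm hm'
      have h3 : (1 : ℝ) ≤ m' - m := by exact_mod_cast h1
      nlinarith [Real.pi_gt_three]
    have hstep := hb _ (hGHk b x hx)
    have h1 := ih (n - (b + 1)) (by omega) (I.erase i) (G^[b + 1] x) (hGHk _ x hx)
    rw [← Function.iterate_add_apply, show n - (b + 1) + (b + 1) = n by omega,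
      Finset.card_erase_of_mem hi] at h1
    have hIpos : 1 ≤ I.card := Finset.card_pos.2 ⟨i, hi⟩
    have h2 : ((Finset.range (n - (b + 1))).filter fun t => ∀ j ∈ I.erase i,
        ¬ Vis (B j) (G^[t] (G^[b + 1] x))).card ≤
        ((Finset.range n).filter fun t => ∀ i ∈ I, ¬ Vis (B i) (G^[t] x)).card := by
      refine Finset.card_le_card_of_injOn (fun t => t + (b + 1)) ?_ (fun _ _ _ _ h => by simpa using h)
      intro t ht
      simp only [Finset.coe_filter, Finset.mem_range, mem_ofPred_eq] at ht ⊢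
      refine ⟨by omega, fun j hj => ?_⟩
      by_cases hji : j = i
      · subst hji; exact hlast _ (by omega) (by omega)
      · rw [Function.iterate_add_apply]
        exact ht.2 j (Finset.mem_erase.2 ⟨hji, hj⟩)
    have h3 : (((Finset.range (n - (b + 1))).filter fun t => ∀ j ∈ I.erase i,
        ¬ Vis (B j) (G^[t] (G^[b + 1] x))).card : ℝ) ≤
        ((Finset.range n).filter fun t => ∀ i ∈ I, ¬ Vis (B i) (G^[t] x)).card := by exact_mod_cast h2
    rw [Nat.cast_sub hIpos] at h1
    rw [← Function.iterate_succ_apply' G] at hstep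
    push_cast at h1
    change -C ≤ (G^[b + 1] x).im - _ at hstep
    nlinarith [mul_le_mul_of_nonneg_left h3 hC]

open Classical in
/-- Consecutive visits to `U` climb by one turn each. -/
theorem exists_visits {G : ℂ → ℂ} (hG : Comm G) {U : Set ℂ} (hU : PosSet G U) (x : ℂ) (n : ℕ)
    (hV : 1 ≤ ((Finset.range n).filter fun t => Vis U (G^[t] x)).card) :
    ∃ a b : ℕ, ∃ m m' : ℤ, a ≤ b ∧ b < n ∧ G^[a] x - m * (2 * π * Complex.I) ∈ U ∧
      G^[b] x - m' * (2 * π * Complex.I) ∈ U ∧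
      (((Finset.range n).filter fun t => Vis U (G^[t] x)).card : ℤ) - 1 ≤ m' - m := by
  induction n with
  | zero => simp at hV
  | succ n ih =>
    rw [Finset.range_add_one, Finset.filter_insert] at hV ⊢
    split_ifs at hV ⊢ with h
    · rw [Finset.card_insert_of_notMem (by simp)]
      obtain ⟨m'', hm''⟩ := h
      rcases Nat.eq_zero_or_pos ((Finset.range n).filter fun t => Vis U (G^[t] x)).card with h0 | h0
      · exact ⟨n, n, m'', m'', le_rfl, by omega, hm'', hm'', by rw [h0]; simp⟩
      · obtain ⟨a, b, m, m', hab, hbn, hm, hm', hc⟩ := ih h0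
        refine ⟨a, n, m, m'', by omega, by omega, hm, hm'', ?_⟩
        have := hU.pos _ (ret_of_visits hG (k := n - b) (by omega) hm' (y := G^[n] x)
          (by rw [← Function.iterate_add_apply, Nat.sub_add_cancel hbn.le]) hm'')
        push_cast
        omega
    · obtain ⟨a, b, m, m', hab, hbn, hm, hm', hc⟩ := ih hV
      exact ⟨a, b, m, m', hab, by omega, hm, hm', hc⟩

open Classical in
theorem im_iterate_ge' {G : ℂ → ℂ} (hG : Comm G) {C : ℝ} (hC : 0 ≤ C)
    (hGH : ∀ z, z.re < 0 → (G z).re < 0)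
    (hb : ∀ z, z.re < 0 → -C ≤ (G z).im - z.im) {ι : Type} (B : ι → Set ℂ)
    (hB : ∀ i, PosSet G (B i)) {U : Set ℂ} (hU : PosSet G U) (n : ℕ)
    (I : Finset ι) (x : ℂ) (hx : x.re < 0) :
      -(2 * C * I.card + 3 * π)
        - C * ((Finset.range n).filter fun t => ∀ i ∈ I, ¬ Vis (B i) (G^[t] x)).card
        + 2 * π * ((Finset.range n).filter fun t => Vis U (G^[t] x)).card
        ≤ (G^[n] x).im - x.im := by
  have hGHk : ∀ n z, z.re < 0 → (G^[n] z).re < 0 := by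
    intro n
    induction n with
    | zero => intro z hz; simpa
    | succ n ih => intro z hz; rw [Function.iterate_succ_apply']; exact hGH _ (ih z hz)
  have key := im_iterate_ge hG hC hGH hb B hB
  have hpi := Real.pi_pos
  rcases Nat.eq_zero_or_pos ((Finset.range n).filter fun t => Vis U (G^[t] x)).card with h0 | h0
  · have := key n I x hx
    have : 0 ≤ C * I.card := by positivity
    rw [h0]; push_cast; linarith
  obtain ⟨a, b, m, m', hab, hbn, hm, hm', hc⟩ := exists_visits hG hU x n h0
  have h1 := key a I x hx
  have h2 := im_sub_ge hU.short hm hm'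
  have h3 := key (n - b) I (G^[b] x) (hGHk b x hx)
  rw [← Function.iterate_add_apply, Nat.sub_add_cancel hbn.le] at h3
  have hcard : ((Finset.range a).filter fun t => ∀ i ∈ I, ¬ Vis (B i) (G^[t] x)).card +
      ((Finset.range (n - b)).filter fun t => ∀ i ∈ I, ¬ Vis (B i) (G^[t] (G^[b] x))).card ≤
      ((Finset.range n).filter fun t => ∀ i ∈ I, ¬ Vis (B i) (G^[t] x)).card := by
    rw [← Finset.card_map (addRightEmbedding b) (s := (Finset.range (n - b)).filter _),
      ← Finset.card_union_of_disjoint]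
    · refine Finset.card_le_card fun t ht => ?_
      rw [Finset.mem_union, Finset.mem_map] at ht
      rw [Finset.mem_filter, Finset.mem_range]
      rcases ht with ht | ⟨s, hs, rfl⟩
      · rw [Finset.mem_filter, Finset.mem_range] at ht
        exact ⟨by omega, ht.2⟩
      · rw [Finset.mem_filter, Finset.mem_range, ← Function.iterate_add_apply] at hs
        exact ⟨by simp; omega, hs.2⟩
    · rw [Finset.disjoint_left]
      intro t ht ht'
      obtain ⟨s, hs, rfl⟩ := Finset.mem_map.1 ht'
      rw [Finset.mem_filter, Finset.mem_range] at ht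
      simp at ht
      omega
  have h4 : (((Finset.range a).filter fun t => ∀ i ∈ I, ¬ Vis (B i) (G^[t] x)).card : ℝ) +
      ((Finset.range (n - b)).filter fun t => ∀ i ∈ I, ¬ Vis (B i) (G^[t] (G^[b] x))).card ≤
      ((Finset.range n).filter fun t => ∀ i ∈ I, ¬ Vis (B i) (G^[t] x)).card := by
    exact_mod_cast hcard
  have h5 : (((Finset.range n).filter fun t => Vis U (G^[t] x)).card : ℝ) - 1 ≤ m' - m := by
    exact_mod_cast hc
  have h6 := mul_le_mul_of_nonneg_left h4 hC
  have h7 := mul_le_mul_of_nonneg_left h5 (show 0 ≤ 2 * π by positivity)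
  linarith

/-- Birkhoff sums bounded below force a nonnegative integral. -/
theorem integral_nonneg_of_birkhoff {α : Type*} [MeasurableSpace α] {μ : Measure α}
    [IsFiniteMeasure μ] {g : α → α} (hg : MeasurePreserving g μ μ) {φ : α → ℝ}
    (hφ : Integrable φ μ) (K : ℝ)
    (h : ∀ n : ℕ, ∀ᵐ z ∂μ, -K ≤ ∑ t ∈ Finset.range n, φ (g^[t] z)) : 0 ≤ ∫ z, φ z ∂μ := by
  by_contra hneg
  push Not at hneg
  have hInt : ∀ t : ℕ, Integrable (fun z => φ (g^[t] z)) μ := fun t =>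
    (hg.iterate t).integrable_comp_of_integrable hφ
  have heq : ∀ t : ℕ, ∫ z, φ (g^[t] z) ∂μ = ∫ z, φ z ∂μ := by
    intro t
    have := (hg.iterate t)
    conv_rhs => rw [← this.map_eq]
    rw [integral_map this.measurable.aemeasurable]
    rw [this.map_eq]; exact hφ.aestronglyMeasurable
  have hn : ∀ n : ℕ, -K * μ.real univ ≤ n * ∫ z, φ z ∂μ := by
    intro n
    have h1 := integral_mono_ae (integrable_const (-K)) (integrable_finsetSum (Finset.range n)
      fun t _ => hInt t) (h n)
    rw [integral_finsetSum _ fun t _ => hInt t] at h1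
    simp only [heq, Finset.sum_const, Finset.card_range, nsmul_eq_mul, integral_const, smul_eq_mul] at h1
    linarith
  obtain ⟨n, hn'⟩ := exists_nat_gt ((-K * μ.real univ) / ∫ z, φ z ∂μ)
  have := hn n
  rw [div_lt_iff_of_neg hneg] at hn'
  linarith

theorem volume_Disk : volume.real Disk = π := by
  rw [Measure.real, Disk, Complex.volume_closedBall]
  simp

instance : IsFiniteMeasure (volume.restrict Disk) :=
  ⟨by rw [Measure.restrict_apply_univ, Disk]; exact measure_closedBall_lt_top⟩

theorem ae_Disk : ∀ᵐ z ∂(volume.restrict Disk), ‖z‖ < 1 ∧ z ≠ 0 := by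
  have h1 : ∀ᵐ z ∂(volume : Measure ℂ), z ∉ sphere (0 : ℂ) 1 := by
    exact measure_eq_zero_iff_ae_notMem.1 (Measure.addHaar_sphere volume (0 : ℂ) 1)
  have h2 : ∀ᵐ z ∂(volume : Measure ℂ), z ≠ 0 := by
    rw [ae_iff]; simp
  filter_upwards [ae_restrict_of_ae h1, ae_restrict_of_ae h2, ae_restrict_mem isClosed_closedBall.measurableSet]
    with z a b c
  refine ⟨lt_of_le_of_ne (by simpa [Disk] using c) (by simpa using a), b⟩

/-- `G` lifts the disk homeomorphism `g` through the exponential map. -/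
structure LiftOf (G g : ℂ ≃ₜ ℂ) : Prop where
  op : OP G
  comm : Comm G
  exp_eq : ∀ ζ, Complex.exp (G ζ) = g (Complex.exp ζ)
  disk : ∀ z, ‖g z‖ < 1 ↔ ‖z‖ < 1
  circ : ∀ z, ‖g z‖ = 1 ↔ ‖z‖ = 1
  bdd : ∃ C : ℝ, ∀ ζ : ℂ, ζ.re < 0 → |(G ζ).im - ζ.im| ≤ C
  mp : MeasurePreserving g (volume.restrict Disk) (volume.restrict Disk)

theorem LiftOf.re_neg {G g : ℂ ≃ₜ ℂ} (h : LiftOf G g) (z : ℂ) : (G z).re < 0 ↔ z.re < 0 := by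
  have := h.disk (Complex.exp z)
  rwa [← h.exp_eq, Complex.norm_exp, Complex.norm_exp, Real.exp_lt_one_iff, Real.exp_lt_one_iff] at this

theorem LiftOf.re_zero {G g : ℂ ≃ₜ ℂ} (h : LiftOf G g) (z : ℂ) : (G z).re = 0 ↔ z.re = 0 := by
  have := h.circ (Complex.exp z)
  rwa [← h.exp_eq, Complex.norm_exp, Complex.norm_exp, Real.exp_eq_one_iff, Real.exp_eq_one_iff] at this

theorem LiftOf.zero {G g : ℂ ≃ₜ ℂ} (h : LiftOf G g) : g 0 = 0 := by
  by_contra hne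
  have h1 : g.symm 0 ≠ 0 := fun h0 => hne (by rw [g.symm_apply_eq] at h0; exact h0.symm)
  have := h.exp_eq (Complex.log (g.symm 0))
  rw [Complex.exp_log h1, g.apply_symm_apply] at this
  exact Complex.exp_ne_zero _ this

theorem LiftOf.trans {F f G g : ℂ ≃ₜ ℂ} (h : LiftOf F f) (h' : LiftOf G g) :
    LiftOf (F.trans G) (f.trans g) where
  op := h'.op.comp h.op F.continuous
  comm := fun ζ => by
    show G (F _) = G (F _) + _
    rw [h.comm, h'.comm]
  exp_eq := fun ζ => by
    show Complex.exp (G (F _)) = g (f _)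
    rw [h'.exp_eq, h.exp_eq]
  disk := fun z => (h'.disk _).trans (h.disk _)
  circ := fun z => (h'.circ _).trans (h.circ _)
  bdd := by
    obtain ⟨C, hC⟩ := h.bdd
    obtain ⟨C', hC'⟩ := h'.bdd
    refine ⟨C + C', fun ζ hζ => ?_⟩
    have a := hC ζ hζ
    have b := hC' (F ζ) ((h.re_neg ζ).2 hζ)
    show |(G (F ζ)).im - _| ≤ _
    rw [abs_le] at *
    constructor <;> linarith [a.1, a.2, b.1, b.2]
  mp := h'.mp.comp h.mp

theorem LiftOf.symm {G g : ℂ ≃ₜ ℂ} (h : LiftOf G g) : LiftOf G.symm g.symm where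
  op := h.op.symm
  comm := fun ζ => by
    rw [G.symm_apply_eq, h.comm, G.apply_symm_apply]
  exp_eq := fun ζ => by
    rw [g.eq_symm_apply, ← h.exp_eq, G.apply_symm_apply]
  disk := fun z => by rw [← h.disk, g.apply_symm_apply]
  circ := fun z => by rw [← h.circ, g.apply_symm_apply]
  bdd := by
    obtain ⟨C, hC⟩ := h.bdd
    refine ⟨C, fun ζ hζ => ?_⟩
    have := hC (G.symm ζ) (by rwa [← h.re_neg, G.apply_symm_apply])
    rwa [G.apply_symm_apply, abs_sub_comm] at this
  mp := MeasurePreserving.symm g.toMeasurableEquiv h.mp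

/-- Composition with a deck transformation. -/
def shiftLift (G : ℂ ≃ₜ ℂ) (k : ℤ) : ℂ ≃ₜ ℂ := G.trans (Homeomorph.addRight (k * (2 * π * Complex.I)))

theorem shiftLift_apply (G : ℂ ≃ₜ ℂ) (k : ℤ) (ζ : ℂ) :
    shiftLift G k ζ = G ζ + k * (2 * π * Complex.I) := rfl

theorem shiftLift_im (G : ℂ ≃ₜ ℂ) (k : ℤ) (ζ : ℂ) :
    (shiftLift G k ζ).im = (G ζ).im + 2 * π * k := by
  rw [shiftLift_apply]; simp; ring

theorem LiftOf.shift {G g : ℂ ≃ₜ ℂ} (h : LiftOf G g) (k : ℤ) : LiftOf (shiftLift G k) g where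
  op := by
    have : OP (Homeomorph.addRight (k * (2 * π * Complex.I)) : ℂ ≃ₜ ℂ) :=
      OP.of_approx _ (k := 0) (by norm_num) fun z w => by simp
    exact this.comp h.op G.continuous
  comm := fun ζ => by rw [shiftLift_apply, shiftLift_apply, h.comm]; ring
  exp_eq := fun ζ => by
    rw [shiftLift_apply, ← h.exp_eq]
    exact Complex.exp_eq_exp_iff_exists_int.2 ⟨k, rfl⟩
  disk := h.disk
  circ := h.circ
  bdd := by
    obtain ⟨C, hC⟩ := h.bdd
    refine ⟨C + |2 * π * k|, fun ζ hζ => ?_⟩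
    rw [shiftLift_im]
    have := abs_add_le ((G ζ).im - ζ.im) (2 * π * k)
    rw [show (G ζ).im + 2 * π * k - ζ.im = (G ζ).im - ζ.im + 2 * π * k by ring]
    linarith [hC ζ hζ]
  mp := h.mp

/-- Iterates as homeomorphisms. -/
def hpow (F : ℂ ≃ₜ ℂ) : ℕ → (ℂ ≃ₜ ℂ)
  | 0 => Homeomorph.refl ℂ
  | n + 1 => F.trans (hpow F n)

theorem hpow_apply (F : ℂ ≃ₜ ℂ) (n : ℕ) (z : ℂ) : hpow F n z = F^[n] z := by
  induction n generalizing z with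
  | zero => rfl
  | succ n ih => exact ih (F z)

theorem LiftOf.pow {F f : ℂ ≃ₜ ℂ} (h : LiftOf F f) {n : ℕ} (hn : 1 ≤ n) :
    LiftOf (hpow F n) (hpow f n) := by
  induction n, hn using Nat.le_induction with
  | base => exact h
  | succ n hn ih => exact h.trans ih

/-- The angular displacement. -/
def turn (G : ℂ → ℂ) (z : ℂ) : ℝ := (G (Complex.log z)).im - (Complex.log z).im

theorem turn_exp {G : ℂ → ℂ} (hG : Comm G) (ζ : ℂ) : turn G (Complex.exp ζ) = (G ζ).im - ζ.im := by
  obtain ⟨m, hm⟩ := Complex.exp_eq_exp_iff_exists_int.1 (Complex.exp_log (Complex.exp_ne_zero ζ))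
  rw [turn, hm, hG.int]
  simp

theorem LiftOf.exp_iterate {G g : ℂ ≃ₜ ℂ} (h : LiftOf G g) (n : ℕ) (ζ : ℂ) :
    Complex.exp (G^[n] ζ) = g^[n] (Complex.exp ζ) := by
  induction n generalizing ζ with
  | zero => rfl
  | succ n ih => rw [Function.iterate_succ_apply, ih, h.exp_eq, Function.iterate_succ_apply]

theorem LiftOf.measurable_turn {G g : ℂ ≃ₜ ℂ} (h : LiftOf G g) : Measurable (turn G) := by
  have h1 : Measurable fun z => G (Complex.log z) := G.continuous.measurable.comp Complex.measurable_log
  exact (Complex.measurable_im.comp h1).sub (Complex.measurable_im.comp Complex.measurable_log)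

theorem re_log_neg {z : ℂ} (h : ‖z‖ < 1) (h0 : z ≠ 0) : (Complex.log z).re < 0 := by
  rw [Complex.log_re]; exact Real.log_neg (norm_pos_iff.2 h0) h

theorem LiftOf.integrable_turn {G g : ℂ ≃ₜ ℂ} (h : LiftOf G g) :
    Integrable (turn G) (volume.restrict Disk) := by
  obtain ⟨C, hC⟩ := h.bdd
  refine Integrable.of_bound h.measurable_turn.aestronglyMeasurable C ?_
  filter_upwards [ae_Disk] with z hz
  exact hC _ (re_log_neg hz.1 hz.2)

theorem LiftOf.integral_trans {F f G g : ℂ ≃ₜ ℂ} (h : LiftOf F f) (h' : LiftOf G g) :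
    ∫ z in Disk, turn (F.trans G) z = (∫ z in Disk, turn F z) + ∫ z in Disk, turn G z := by
  have e1 : ∫ z in Disk, turn G z = ∫ z in Disk, turn G (f z) := by
    conv_lhs => rw [← h.mp.map_eq]
    rw [integral_map h.mp.measurable.aemeasurable h'.measurable_turn.aestronglyMeasurable]
  have i2 : Integrable (fun z => turn G (f z)) (volume.restrict Disk) :=
    h.mp.integrable_comp_of_integrable h'.integrable_turn
  rw [e1, ← integral_add h.integrable_turn i2]
  refine integral_congr_ae ?_
  filter_upwards [ae_Disk] with z hz
  rw [← Complex.exp_log hz.2, ← h.exp_eq, turn_exp h'.comm, turn_exp h.comm, turn_exp (h.trans h').comm]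
  show (G (F _)).im - _ = _
  ring

theorem LiftOf.integral_shift {G g : ℂ ≃ₜ ℂ} (h : LiftOf G g) (k : ℤ) :
    ∫ z in Disk, turn (shiftLift G k) z = (∫ z in Disk, turn G z) + 2 * π * k * π := by
  have : ∀ z, turn (shiftLift G k) z = turn G z + 2 * π * k := by
    intro z
    rw [turn, turn, shiftLift_im]; ring
  simp_rw [this]
  rw [integral_add h.integrable_turn (integrable_const _), setIntegral_const, volume_Disk, smul_eq_mul]
  ring

theorem LiftOf.integral_symm {G g : ℂ ≃ₜ ℂ} (h : LiftOf G g) :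
    ∫ z in Disk, turn G.symm z = - ∫ z in Disk, turn G z := by
  have := h.integral_trans h.symm
  rw [G.self_trans_symm] at this
  have h0 : ∫ z in Disk, turn (Homeomorph.refl ℂ) z = 0 := by simp [turn]
  linarith

theorem LiftOf.integral_pow {G g : ℂ ≃ₜ ℂ} (h : LiftOf G g) {n : ℕ} (hn : 1 ≤ n) :
    ∫ z in Disk, turn (hpow G n) z = n * ∫ z in Disk, turn G z := by
  induction n, hn using Nat.le_induction with
  | base => simp; rfl
  | succ n hn ih =>
    have := h.integral_trans (h.pow hn)
    rw [ih] at this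
    refine this.trans ?_
    push_cast; ring

theorem LiftOf.exists_ret {G g : ℂ ≃ₜ ℂ} (h : LiftOf G g) {U : Set ℂ} (hU : IsOpen U)
    (hUn : U.Nonempty) (hUH : ∀ z ∈ U, z.re < 0) : ∃ m, Ret G U m := by
  have ho : IsOpen (Complex.exp '' U) := Complex.isOpenMap_exp U hU
  have hsub : Complex.exp '' U ⊆ Disk := by
    rintro _ ⟨z, hz, rfl⟩
    simp only [Disk, mem_closedBall_zero_iff, Complex.norm_exp]
    exact Real.exp_le_one_iff.2 (hUH z hz).le
  have hpos : volume.restrict Disk (Complex.exp '' U) ≠ 0 := by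
    rw [Measure.restrict_apply ho.measurableSet, inter_eq_left.2 hsub]
    exact (ho.measure_pos volume (hUn.image _)).ne'
  obtain ⟨x, ⟨z, hz, rfl⟩, m, hm, hx⟩ :=
    h.mp.exists_mem_iterate_mem ho.measurableSet.nullMeasurableSet hpos
  rw [← h.exp_iterate] at hx
  obtain ⟨j, hj⟩ := vis_iff_exp_mem.2 hx
  exact ⟨j, m, by omega, z, hz, hj⟩

open Classical in
/-- A lift without fixed points that moves the boundary line upwards has mean angular displacement
at least the area of any free disk. -/
theorem LiftOf.integral_turn_ge {G g : ℂ ≃ₜ ℂ} (h : LiftOf G g) (hfix : ∀ z, G z ≠ z)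
    (haxis : ∀ z, z.re = 0 → z.im < (G z).im) {U : Set ℂ} (hU : Good G U)
    (hUH : ∀ z ∈ U, z.re < 0) (hUs : ∀ u ∈ U, ∀ v ∈ U, |u.im - v.im| ≤ π) :
    2 * π * volume.real (Complex.exp '' U) ≤ ∫ z in Disk, turn G z := by
  obtain ⟨C, hC⟩ := h.bdd
  have hC0 : 0 ≤ C := (abs_nonneg _).trans (hC (-1) (by simp))
  have hpos : ∀ W, Good G W → (∀ z ∈ W, z.re < 0) → (∀ u ∈ W, ∀ v ∈ W, |u.im - v.im| ≤ π) →
      PosSet G W := fun W hW hWH hs => ⟨fun m hm =>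
    returns_pos h.op hfix h.comm (fun V h1 h2 h3 => h.exists_ret h1 h2 h3)
      (fun z hz => (h.re_neg z).2 hz) (fun z hz => ⟨(h.re_zero z).2 hz, haxis z hz⟩) hW hWH hm, hs⟩
  have hUo : IsOpen (Complex.exp '' U) := Complex.isOpenMap_exp U hU.isOpen
  have hexpsub : ∀ W : Set ℂ, (∀ z ∈ W, z.re < 0) → Complex.exp '' W ⊆ Disk := by
    rintro W hW _ ⟨z, hz, rfl⟩
    simp only [Disk, mem_closedBall_zero_iff, Complex.norm_exp]
    exact Real.exp_le_one_iff.2 (hW z hz).le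
  -- small good balls
  have hball : ∀ x : {z : ℂ // z.re < 0}, ∃ ε > 0, PosSet G (ball x.1 ε) := by
    rintro ⟨x, hx⟩
    obtain ⟨ε, hε, hg⟩ := exists_good_ball G.continuous hfix x
    obtain ⟨δ, hδ, hd⟩ := Metric.isOpen_iff.1 (isOpen_lt Complex.continuous_re continuous_const) x hx
    refine ⟨min (min ε δ) 1, by positivity, hpos _ (hg _ ((min_le_left _ _).trans (min_le_left _ _)))
      (fun z hz => hd (ball_subset_ball ((min_le_left _ _).trans (min_le_right _ _)) hz)) ?_⟩
    intro u hu v hv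
    have a := (Complex.abs_im_le_norm (u - v))
    have b := mem_ball.1 (ball_subset_ball (min_le_right _ _) hu)
    have c := mem_ball.1 (ball_subset_ball (min_le_right _ _) hv)
    have d := dist_triangle_right u v x
    rw [← dist_eq_norm, Complex.sub_im] at a
    linarith [Real.pi_gt_three]
  choose ε hε hεp using hball
  refine le_of_forall_pos_le_add fun η hη => ?_
  -- a large compact set
  have hO : IsOpen (ball (0 : ℂ) 1 \ {0}) := isOpen_ball.sdiff isClosed_singleton
  have hvol : volume (ball (0 : ℂ) 1 \ {0}) = volume (Disk : Set ℂ) := by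
    rw [measure_sdiff_null (by simp), Disk, Complex.volume_ball, Complex.volume_closedBall]
  set η' : ℝ := η / (C + 1) with hη'
  have hη0 : 0 < η' := by positivity
  obtain ⟨K, hKs, hK, hKv⟩ := hO.measurableSet.exists_isCompact_lt_add (μ := volume) (ε := ENNReal.ofReal η')
    (by rw [hvol, Disk]; exact measure_closedBall_lt_top.ne) (by simpa using hη0)
  rw [hvol] at hKv
  obtain ⟨I, hI⟩ := hK.elim_finite_subcover (fun x : {z : ℂ // z.re < 0} => Complex.exp '' ball x.1 (ε x))
    (fun x => Complex.isOpenMap_exp _ isOpen_ball) (by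
      intro z hz
      have := hKs hz
      have hz0 : z ≠ 0 := this.2
      exact mem_iUnion.2 ⟨⟨Complex.log z, re_log_neg (by simpa using this.1) hz0⟩, _,
        mem_ball_self (hε _), Complex.exp_log hz0⟩)
  set R : Set ℂ := Disk \ ⋃ i ∈ I, Complex.exp '' ball i.1 (ε i) with hR
  have hRm : MeasurableSet R := isClosed_closedBall.measurableSet.diff
    (isOpen_biUnion fun i _ => Complex.isOpenMap_exp _ isOpen_ball).measurableSet
  have hDfin : volume Disk ≠ ⊤ := by rw [Disk]; exact measure_closedBall_lt_top.ne
  have hRv : volume.real R ≤ η' := by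
    have h1 : R ⊆ Disk \ K := fun z hz => ⟨hz.1, fun hzK => hz.2 (hI hzK)⟩
    have h2 : volume (Disk \ K) ≤ ENNReal.ofReal η' := by
      have hKD : K ⊆ Disk := fun z hz => ball_subset_closedBall (hKs hz).1
      rw [measure_sdiff hKD hK.measurableSet.nullMeasurableSet hK.measure_lt_top.ne]
      exact tsub_le_iff_left.2 hKv.le
    exact ENNReal.toReal_le_of_le_ofReal hη0.le ((measure_mono h1).trans h2)
  set φ : ℂ → ℝ := fun z => turn G z + C * R.indicator 1 z - 2 * π * (Complex.exp '' U).indicator 1 z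
    with hφ
  have i1 : Integrable (R.indicator (1 : ℂ → ℝ)) (volume.restrict Disk) :=
    (integrable_const (1 : ℝ)).indicator hRm
  have i2 : Integrable ((Complex.exp '' U).indicator (1 : ℂ → ℝ)) (volume.restrict Disk) :=
    (integrable_const (1 : ℝ)).indicator hUo.measurableSet
  have hφi : Integrable φ (volume.restrict Disk) :=
    (h.integrable_turn.add (i1.const_mul C)).sub (i2.const_mul (2 * π))
  have key := integral_nonneg_of_birkhoff h.mp hφi (2 * C * I.card + 3 * π) ?_
  · have e : ∫ z in Disk, φ z = (∫ z in Disk, turn G z) + C * volume.real R -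
        2 * π * volume.real (Complex.exp '' U) := by
      have j1 : ∫ z in Disk, R.indicator (1 : ℂ → ℝ) z = volume.real R := by
        rw [integral_indicator_one hRm, measureReal_restrict_apply hRm, inter_eq_left.2 sdiff_subset]
      have j2 : ∫ z in Disk, (Complex.exp '' U).indicator (1 : ℂ → ℝ) z =
          volume.real (Complex.exp '' U) := by
        rw [integral_indicator_one hUo.measurableSet, measureReal_restrict_apply hUo.measurableSet,
          inter_eq_left.2 (hexpsub U hUH)]
      have i3 : Integrable (fun z => turn G z + C * R.indicator (1 : ℂ → ℝ) z) (volume.restrict Disk) :=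
        h.integrable_turn.add (i1.const_mul C)
      rw [hφ]
      simp only []
      rw [integral_sub i3 (i2.const_mul (2 * π)),
        integral_add h.integrable_turn (i1.const_mul C), integral_const_mul, integral_const_mul, j1, j2]
    rw [e] at key
    have : C * volume.real R ≤ η := by
      calc C * volume.real R ≤ (C + 1) * η' := by
            have := measureReal_nonneg (μ := (volume : Measure ℂ)) (s := R)
            nlinarith
        _ = η := by rw [hη']; field_simp
    linarith
  · intro n
    filter_upwards [ae_Disk] with z hz
    set x := Complex.log z with hx
    have hxz : Complex.exp x = z := Complex.exp_log hz.2
    have hxre : x.re < 0 := re_log_neg hz.1 hz.2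
    have hb := im_iterate_ge' h.comm hC0 (fun z hz => (h.re_neg z).2 hz)
      (fun z hz => (abs_le.1 (hC z hz)).1) (fun i : {z : ℂ // z.re < 0} => ball i.1 (ε i)) hεp
      (hpos U hU hUH hUs) n I x hxre
    have hGHk : ∀ n, (G^[n] x).re < 0 := by
      intro n
      induction n with
      | zero => simpa
      | succ n ih => rw [Function.iterate_succ_apply']; exact (h.re_neg _).2 ih
    have s1 : ∑ t ∈ Finset.range n, turn G (g^[t] z) = (G^[n] x).im - x.im := by
      have : ∀ t, turn G (g^[t] z) = (G^[t + 1] x).im - (G^[t] x).im := by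
        intro t
        rw [← hxz, ← h.exp_iterate, turn_exp h.comm, Function.iterate_succ_apply']
      simp_rw [this]
      exact Finset.sum_range_sub (fun t => (G^[t] x).im) n
    have s2 : ∑ t ∈ Finset.range n, R.indicator (1 : ℂ → ℝ) (g^[t] z) =
        ((Finset.range n).filter fun t => ∀ i ∈ I, ¬ Vis (ball i.1 (ε i)) (G^[t] x)).card := by
      rw [Finset.card_filter]
      push_cast
      refine Finset.sum_congr rfl fun t _ => ?_
      rw [← hxz, ← h.exp_iterate, indicator_apply]
      refine if_congr ?_ rfl rfl
      simp only [vis_iff_exp_mem, hR, Set.mem_sdiff, mem_iUnion, not_exists]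
      refine ⟨fun h => h.2, fun h => ⟨?_, h⟩⟩
      simp only [Disk, mem_closedBall_zero_iff, Complex.norm_exp]
      exact Real.exp_le_one_iff.2 (hGHk t).le
    have s3 : ∑ t ∈ Finset.range n, (Complex.exp '' U).indicator (1 : ℂ → ℝ) (g^[t] z) =
        ((Finset.range n).filter fun t => Vis U (G^[t] x)).card := by
      rw [Finset.card_filter]
      push_cast
      refine Finset.sum_congr rfl fun t _ => ?_
      rw [← hxz, ← h.exp_iterate, indicator_apply]
      refine if_congr ?_ rfl rfl
      rw [vis_iff_exp_mem]
    simp only [hφ, Finset.sum_sub_distrib, Finset.sum_add_distrib, ← Finset.mul_sum]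
    rw [s1, s2, s3]
    linarith

theorem Good.empty (G : ℂ → ℂ) : Good G ∅ :=
  ⟨isOpen_empty, isPreconnected_empty, by simp, by simp⟩

/-- A branch of the preimage of a free disk under the exponential map. -/
theorem LiftOf.exists_good_branch {G g : ℂ ≃ₜ ℂ} (h : LiftOf G g) {z₀ : ℂ} {r : ℝ} (hr : 0 < r)
    (hsub : ball z₀ r ⊆ ball 0 1) (hfree : ∀ z ∈ ball z₀ r, g z ∉ ball z₀ r) :
    ∃ U : Set ℂ, Good G U ∧ (∀ z ∈ U, z.re < 0) ∧ (∀ u ∈ U, ∀ v ∈ U, |u.im - v.im| ≤ π) ∧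
      ball z₀ r ⊆ Complex.exp '' U := by
  have h0 : (0 : ℂ) ∉ ball z₀ r := fun h0 => hfree 0 h0 (by rwa [h.zero])
  have hz0 : z₀ ≠ 0 := by rintro rfl; exact h0 (mem_ball_self hr)
  have hrz : r ≤ ‖z₀‖ := by simpa using h0
  have hre : ∀ w ∈ ball z₀ r, 0 < (w / z₀).re := by
    intro w hw
    have : ‖w / z₀ - 1‖ < 1 := by
      rw [div_sub_one hz0, norm_div, div_lt_one (norm_pos_iff.2 hz0)]
      exact (mem_ball_iff_norm.1 hw).trans_le hrz
    have h2 := (Complex.abs_re_le_norm (w / z₀ - 1)).trans_lt this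
    rw [Complex.sub_re, Complex.one_re, abs_lt] at h2
    linarith [h2.1]
  set U : Set ℂ := {ζ | Complex.exp ζ ∈ ball z₀ r ∧ |(ζ - Complex.log z₀).im| < π / 2} with hU
  set σ : ℂ → ℂ := fun w => Complex.log z₀ + Complex.log (w / z₀) with hσ
  have hσexp : ∀ w ∈ ball z₀ r, Complex.exp (σ w) = w := by
    intro w hw
    have hw0 : w / z₀ ≠ 0 := fun h => by have := hre w hw; rw [h] at this; simp at this
    rw [hσ, Complex.exp_add, Complex.exp_log hz0, Complex.exp_log hw0, mul_div_cancel₀ _ hz0]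
  have hσU : ∀ w ∈ ball z₀ r, σ w ∈ U := by
    intro w hw
    refine ⟨by rwa [hσexp w hw], ?_⟩
    rw [hσ, add_sub_cancel_left, Complex.log_im]
    exact Complex.abs_arg_lt_pi_div_two_iff.2 (Or.inl (hre w hw))
  have hUσ : U = σ '' ball z₀ r := by
    ext ζ
    constructor
    · rintro ⟨h1, h2⟩
      refine ⟨_, h1, ?_⟩
      have h3 := abs_lt.1 h2
      have hpi := Real.pi_pos
      have e : Complex.exp ζ / z₀ = Complex.exp (ζ - Complex.log z₀) := by
        rw [Complex.exp_sub, Complex.exp_log hz0]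
      simp only [hσ]
      rw [e, Complex.log_exp (by linarith [h3.1]) (by linarith [h3.2])]
      ring
    · rintro ⟨w, hw, rfl⟩; exact hσU w hw
  have hshort : ∀ u ∈ U, ∀ v ∈ U, |u.im - v.im| ≤ π := by
    intro u hu v hv
    have a := abs_lt.1 hu.2
    have b := abs_lt.1 hv.2
    rw [Complex.sub_im] at a b
    rw [abs_le]; constructor <;> linarith [a.1, a.2, b.1, b.2]
  refine ⟨U, ⟨?_, ?_, ?_, ?_⟩, ?_, hshort, fun w hw => ⟨_, hσU w hw, hσexp w hw⟩⟩
  · have a : IsOpen {ζ : ℂ | Complex.exp ζ ∈ ball z₀ r} := isOpen_ball.preimage Complex.continuous_exp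
    have b : IsOpen {ζ : ℂ | |(ζ - Complex.log z₀).im| < π / 2} :=
      isOpen_lt (by fun_prop) continuous_const
    exact a.inter b
  · rw [hUσ]
    refine (convex_ball z₀ r).isPreconnected.image _ ?_
    refine continuousOn_const.add (ContinuousOn.clog (by fun_prop) fun w hw => Or.inl (hre w hw))
  · intro z hz hz'
    have := hz'.1
    rw [h.exp_eq] at this
    exact hfree _ hz.1 this
  · intro m hm z hz hz'
    have := hshort _ hz' _ hz
    simp only [Complex.add_im, Complex.mul_im, Complex.intCast_re, Complex.intCast_im,
          Complex.mul_re, Complex.re_ofNat, Complex.im_ofNat, Complex.ofReal_re, Complex.ofReal_im,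
          Complex.I_re, Complex.I_im] at this
    ring_nf at this
    rw [abs_mul, abs_mul, abs_of_pos Real.pi_pos, abs_two] at this
    have e : (1 : ℝ) ≤ |(m : ℝ)| := by
      have : 1 ≤ |m| := Int.one_le_abs hm
      exact_mod_cast this
    nlinarith [Real.pi_pos]
  · intro z hz
    have := hsub hz.1
    rwa [mem_ball_zero_iff, Complex.norm_exp, Real.exp_lt_one_iff] at this

theorem LiftOf.integral_turn_nonneg {G g : ℂ ≃ₜ ℂ} (h : LiftOf G g) (hfix : ∀ z, G z ≠ z)
    (haxis : ∀ z, z.re = 0 → z.im < (G z).im) : 0 ≤ ∫ z in Disk, turn G z := by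
  simpa using h.integral_turn_ge hfix haxis (Good.empty G) (by simp) (by simp)

/-- A free round disk of a lift with small positive rotation is small. -/
theorem LiftOf.sq_radius_le {G g : ℂ ≃ₜ ℂ} (h : LiftOf G g) (hfix : ∀ z, G z ≠ z)
    (hup : ∀ z, z.re = 0 → z.im < (G z).im) {N : ℕ} (hN : 1 ≤ N)
    (hfixN : ∀ z, shiftLift (hpow G N) (-1) z ≠ z)
    (hdown : ∀ z, z.re = 0 → (shiftLift (hpow G N) (-1) z).im < z.im) {z₀ : ℂ} {r : ℝ} (hr : 0 < r)
    (hsub : ball z₀ r ⊆ ball 0 1) (hfree : ∀ z ∈ ball z₀ r, g z ∉ ball z₀ r) :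
    r ^ 2 * N ≤ 1 := by
  obtain ⟨U, hU, hUH, hUs, hbU⟩ := h.exists_good_branch hr hsub hfree
  have h1 := h.integral_turn_ge hfix hup hU hUH hUs
  have hs := (h.pow hN).shift (-1)
  have h2 := hs.symm.integral_turn_nonneg (fun z hz => hfixN z (by
      have := congrArg (shiftLift (hpow G N) (-1)) hz
      rwa [Homeomorph.apply_symm_apply, eq_comm] at this)) (fun z hz => by
      have := hdown ((shiftLift (hpow G N) (-1)).symm z) (by rwa [← hs.re_zero, Homeomorph.apply_symm_apply])
      rwa [Homeomorph.apply_symm_apply] at this)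
  rw [hs.integral_symm, (h.pow hN).integral_shift, h.integral_pow hN] at h2
  have h3 : π * r ^ 2 ≤ volume.real (Complex.exp '' U) := by
    have hfin : volume (Complex.exp '' U) ≠ ⊤ := by
      refine ((measure_mono ?_).trans_lt (measure_closedBall_lt_top (x := (0 : ℂ)) (r := 1))).ne
      rintro _ ⟨z, hz, rfl⟩
      rw [mem_closedBall_zero_iff, Complex.norm_exp]
      exact Real.exp_le_one_iff.2 (hUH z hz).le
    have := measureReal_mono hbU hfin
    refine le_trans (le_of_eq ?_) this
    rw [Measure.real, Complex.volume_ball]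
    simp [hr.le]
    ring
  have hN' : (1 : ℝ) ≤ N := by exact_mod_cast hN
  push_cast at h2
  have h4 : N * (2 * π * (π * r ^ 2)) ≤ 2 * π * π := by
    have := mul_le_mul_of_nonneg_left (h1) (show (0 : ℝ) ≤ N by positivity)
    have h5 := mul_le_mul_of_nonneg_left h3 (show 0 ≤ N * (2 * π) by positivity)
    linarith
  have hpp : 0 < 2 * π * π := by positivity
  nlinarith

theorem le_iterate_mul {l : ℝ → ℝ} {n : ℕ} {p : ℤ}
    (h : ∀ θ, θ + p ≤ l^[n] θ) (k : ℕ) (θ : ℝ) : θ + p * k ≤ l^[n * k] θ := by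
  induction k generalizing θ with
  | zero => simp
  | succ k ih =>
    rw [Nat.mul_succ, Function.iterate_add_apply]
    refine le_trans ?_ (ih _)
    have := h θ
    push_cast; linarith

/-- Displacements of iterates have the sign of the rotation number. -/
theorem disp_sign {l : ℝ → ℝ} (hc : Continuous l) {α : ℝ}
    (hα : ∀ θ : ℝ, Tendsto (fun n : ℕ => (l^[n] θ - θ) / n) atTop (𝓝 α)) {n : ℕ} (hn : 1 ≤ n) {p : ℤ}
    (hne : ∀ θ, l^[n] θ ≠ θ + p) :
    (0 < n * α - p → ∀ θ, θ + p < l^[n] θ) ∧ (n * α - p < 0 → ∀ θ, l^[n] θ < θ + p) := by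
  have hcn := hc.iterate n
  have hn0 : (0 : ℝ) < n := by exact_mod_cast hn
  have hlim : Tendsto (fun k : ℕ => (l^[n * k] 0 - 0) / (n * k : ℕ)) atTop (𝓝 α) :=
    (hα 0).comp (tendsto_id.const_mul_atTop' (by omega))
  have hsign : (∀ θ, θ + p < l^[n] θ) ∨ ∀ θ, l^[n] θ < θ + p := by
    by_contra hcon
    push Not at hcon
    obtain ⟨⟨a, ha⟩, b, hb⟩ := hcon
    obtain ⟨c, hc⟩ := mem_range_of_exists_le_of_exists_ge (f := fun θ => l^[n] θ - (θ + p))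
      (c := 0) (by fun_prop) ⟨a, by linarith⟩ ⟨b, by linarith⟩
    exact hne c (by simp only at hc; linarith)
  have hquot : ∀ k : ℕ, 0 < k → ((p : ℝ) * k) / (n * k : ℕ) = p / n := by
    intro k hk
    have : (k : ℝ) ≠ 0 := by exact_mod_cast hk.ne'
    push_cast
    field_simp
  constructor
  · intro hpos
    refine hsign.resolve_right fun h => ?_
    have : α ≤ p / n := by
      refine le_of_tendsto hlim ?_
      filter_upwards [eventually_gt_atTop 0] with k hk
      rw [← hquot k hk]
      have h2 : l^[n * k] 0 ≤ 0 + p * k := by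
        clear hlim
        induction k with
        | zero => omega
        | succ k ih =>
          rcases Nat.eq_zero_or_pos k with rfl | hk'
          · simpa using (h 0).le
          · rw [show n * (k + 1) = n + n * k by ring, Function.iterate_add_apply]
            have := (h (l^[n * k] 0)).le
            have := ih hk'
            push_cast; linarith
      gcongr
      linarith
    rw [le_div_iff₀ hn0] at this
    linarith
  · intro hneg
    refine hsign.resolve_left fun h => ?_
    have : p / n ≤ α := by
      refine ge_of_tendsto hlim ?_
      filter_upwards [eventually_gt_atTop 0] with k hk
      rw [← hquot k hk]
      have h2 := le_iterate_mul (fun θ => (h θ).le) k 0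
      gcongr
      linarith
    rw [div_le_iff₀ hn0] at this
    linarith

/-- The data of a lifted irrational pseudo-rotation. -/
structure PseudoRot (F f : ℂ ≃ₜ ℂ) (l : ℝ → ℝ) (α : ℝ) : Prop where
  isLift : LiftOf F f
  aper : ∀ n : ℕ, 1 ≤ n → ∀ z, z ≠ 0 → f^[n] z ≠ z
  cont : Continuous l
  axis : ∀ θ : ℝ, F (2 * π * Complex.I * θ) = 2 * π * Complex.I * l θ
  rot : ∀ θ : ℝ, Tendsto (fun n : ℕ => (l^[n] θ - θ) / n) atTop (𝓝 α)

theorem PseudoRot.iterate_ne {F f : ℂ ≃ₜ ℂ} {l : ℝ → ℝ} {α : ℝ} (h : PseudoRot F f l α) {n : ℕ}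
    (hn : 1 ≤ n) (p : ℤ) (z : ℂ) : F^[n] z ≠ z + p * (2 * π * Complex.I) := by
  intro heq
  refine h.aper n hn (Complex.exp z) (Complex.exp_ne_zero _) ?_
  rw [← h.isLift.exp_iterate, heq]
  exact Complex.exp_eq_exp_iff_exists_int.2 ⟨p, rfl⟩

theorem PseudoRot.axis_iterate {F f : ℂ ≃ₜ ℂ} {l : ℝ → ℝ} {α : ℝ} (h : PseudoRot F f l α) (n : ℕ)
    (θ : ℝ) : F^[n] (2 * π * Complex.I * θ) = 2 * π * Complex.I * (l^[n] θ : ℝ) := by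
  induction n generalizing θ with
  | zero => rfl
  | succ n ih => rw [Function.iterate_succ_apply, h.axis, ih, Function.iterate_succ_apply]

theorem PseudoRot.axis_sign {F f : ℂ ≃ₜ ℂ} {l : ℝ → ℝ} {α : ℝ} (h : PseudoRot F f l α) {n : ℕ}
    (hn : 1 ≤ n) (p : ℤ) (z : ℂ) (hz : z.re = 0) :
    (0 < n * α - p → z.im + 2 * π * p < (F^[n] z).im) ∧
      (n * α - p < 0 → (F^[n] z).im < z.im + 2 * π * p) := by
  set θ : ℝ := z.im / (2 * π) with hθ
  have hpi := Real.pi_pos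
  have hzθ : z = 2 * π * Complex.I * θ := by
    apply Complex.ext
    · simp [hz]
    · have : (2 * π * Complex.I * θ).im = 2 * π * θ := by simp
      rw [this, hθ]; field_simp
  have him : ∀ x : ℝ, (2 * π * Complex.I * x).im = 2 * π * x := fun x => by simp
  have key := disp_sign h.cont h.rot hn (p := p) fun x hx => h.iterate_ne hn p (2 * π * Complex.I * x) (by
    rw [h.axis_iterate, hx]; push_cast; ring)
  rw [hzθ, h.axis_iterate, him, him]
  refine ⟨fun hpos => ?_, fun hneg => ?_⟩
  · have := key.1 hpos θ; nlinarith
  · have := key.2 hneg θ; nlinarith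

/-- Free round disks for `f^q` are small when `q α` is close to an integer. -/
theorem PseudoRot.sq_radius_le {F f : ℂ ≃ₜ ℂ} {l : ℝ → ℝ} {α : ℝ} (h : PseudoRot F f l α)
    (hirr : Irrational α) {q : ℕ} (hq : 1 ≤ q) (p : ℤ) {N : ℕ} (hN : 1 ≤ N) (hNβ : N * |q * α - p| < 1)
    {z₀ : ℂ} {r : ℝ} (hr : 0 < r) (hsub : ball z₀ r ⊆ ball 0 1)
    (hfree : ∀ z ∈ ball z₀ r, f^[q] z ∉ ball z₀ r) : r ^ 2 * N ≤ 1 := by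
  have hpi := Real.pi_pos
  set G := shiftLift (hpow F q) (-p) with hG
  have hGl : LiftOf G (hpow f q) := (h.isLift.pow hq).shift _
  have hGa : ∀ z, G z = F^[q] z - p * (2 * π * Complex.I) := fun z => by
    rw [hG, shiftLift_apply, hpow_apply]; push_cast; ring
  have hGit : ∀ k z, G^[k] z = F^[q * k] z - (p * k : ℤ) * (2 * π * Complex.I) := by
    intro k z
    induction k with
    | zero => simp
    | succ k ih =>
      rw [Function.iterate_succ_apply', ih, hGa, Nat.mul_succ, add_comm, Function.iterate_add_apply]
      have := (h.isLift.comm.iterate q).int (F^[q * k] z) (-(p * k : ℤ))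
      rw [sub_eq_add_neg (F^[q * k] z), ← neg_mul, ← Int.cast_neg, this]
      push_cast; ring
  have him : ∀ (z : ℂ) (m : ℤ), (z - m * (2 * π * Complex.I)).im = z.im - 2 * π * m := fun z m => by
    simp; ring
  have hqN : 1 ≤ q * N := Nat.mul_pos hq hN
  have hne : (q : ℝ) * α - p ≠ 0 := by
    intro h0
    refine (hirr.natCast_mul (show q ≠ 0 by omega)).ne_int p ?_
    linarith
  rcases lt_or_gt_of_ne hne with hβ | hβ
  · rw [abs_of_neg hβ] at hNβ
    have hfr : ∀ z ∈ ball z₀ r, (hpow f q).symm z ∉ ball z₀ r := by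
      intro z hz hz'
      refine hfree _ hz' ?_
      rwa [← hpow_apply, Homeomorph.apply_symm_apply]
    have hit : ∀ z, G^[N] (hpow G.symm N z) = z := fun z => by
      rw [hpow_apply]
      exact (Function.LeftInverse.iterate G.apply_symm_apply N) z
    refine hGl.symm.sq_radius_le (fun z hz => ?_) (fun z hz => ?_) hN (fun z hz => ?_) (fun z hz => ?_)
      hr hsub hfr
    · rw [G.symm_apply_eq, hGa] at hz
      exact h.iterate_ne hq p z (by linear_combination -hz)
    · have h1 := (h.axis_sign hq p (G.symm z) ((hGl.symm.re_zero z).2 hz)).2 hβ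
      have h2 := hGa (G.symm z)
      rw [G.apply_symm_apply] at h2
      have h3 := congrArg Complex.im h2
      rw [him] at h3
      linarith
    · rw [shiftLift_apply] at hz
      have h2 := hit z
      rw [hGit] at h2
      refine h.iterate_ne hqN (p * N - 1) (hpow G.symm N z) ?_
      push_cast at hz h2 ⊢
      linear_combination h2 - hz
    · rw [shiftLift_im]
      have h2 := hit z
      have h3 := congrArg Complex.im h2
      rw [hGit, him] at h3
      have h1 := (h.axis_sign hqN (p * N - 1) (hpow G.symm N z)
        (((hGl.symm.pow hN).re_zero z).2 hz)).1 (by push_cast; nlinarith)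
      push_cast at *
      nlinarith
  · rw [abs_of_pos hβ] at hNβ
    refine hGl.sq_radius_le (fun z hz => ?_) (fun z hz => ?_) hN (fun z hz => ?_) (fun z hz => ?_)
      hr hsub (by simpa only [hpow_apply] using hfree)
    · rw [hGa] at hz
      exact h.iterate_ne hq p z (by linear_combination hz)
    · rw [hGa, him]
      linarith [(h.axis_sign hq p z hz).1 hβ]
    · rw [shiftLift_apply, hpow_apply, hGit] at hz
      refine h.iterate_ne hqN (p * N + 1) z ?_
      push_cast at *
      linear_combination hz
    · rw [shiftLift_im, hpow_apply, hGit, him]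
      have h1 := (h.axis_sign hqN (p * N + 1) z hz).2 (by push_cast; nlinarith)
      push_cast at *
      nlinarith

theorem mem_Disk {z : ℂ} : z ∈ Disk ↔ ‖z‖ ≤ 1 := by simp [Disk]

theorem isCompact_Disk : IsCompact Disk := isCompact_closedBall _ _

theorem convex_Disk : Convex ℝ Disk := convex_closedBall _ _

/-- Radial extension to the plane of a self-map of the disk preserving the circle. -/
def radExt (f : ℂ → ℂ) (z : ℂ) : ℂ := ((max 1 ‖z‖ : ℝ) : ℂ) * f (z / ((max 1 ‖z‖ : ℝ) : ℂ))

theorem div_max_mem (z : ℂ) : z / ((max 1 ‖z‖ : ℝ) : ℂ) ∈ Disk := by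
  have : 0 < max 1 ‖z‖ := lt_max_of_lt_left one_pos
  rw [mem_Disk, norm_div, Complex.norm_real, Real.norm_of_nonneg this.le, div_le_one this]
  exact le_max_right _ _

theorem continuous_radExt {f : ℂ → ℂ} (hf : ContinuousOn f Disk) : Continuous (radExt f) := by
  have h0 : ∀ z : ℂ, ((max 1 ‖z‖ : ℝ) : ℂ) ≠ 0 := fun z =>
    Complex.ofReal_ne_zero.2 (lt_max_of_lt_left one_pos).ne'
  have hc : Continuous fun z : ℂ => ((max 1 ‖z‖ : ℝ) : ℂ) :=
    Complex.continuous_ofReal.comp (continuous_const.max continuous_norm)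
  exact hc.mul (hf.comp_continuous (continuous_id.div hc h0) div_max_mem)

theorem radExt_of_le {f : ℂ → ℂ} {z : ℂ} (hz : ‖z‖ ≤ 1) : radExt f z = f z := by
  simp [radExt, max_eq_left hz]

theorem radExt_of_ge {f : ℂ → ℂ} {z : ℂ} (hz : 1 ≤ ‖z‖) :
    radExt f z = (‖z‖ : ℂ) * f (z / (‖z‖ : ℂ)) := by
  simp [radExt, max_eq_right hz]

theorem norm_radExt_of_ge {f : ℂ → ℂ} (hf : ∀ z, ‖z‖ = 1 → ‖f z‖ = 1) {z : ℂ} (hz : 1 ≤ ‖z‖) :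
    ‖radExt f z‖ = ‖z‖ := by
  rw [radExt_of_ge hz, norm_mul, hf _ (by
    rw [norm_div, Complex.norm_real, norm_norm, div_self (by linarith)])]
  simp

theorem radExt_leftInverse {f g : ℂ → ℂ} (hf : ∀ z, ‖z‖ = 1 → ‖f z‖ = 1) (hm : MapsTo f Disk Disk)
    (hgf : ∀ z ∈ Disk, g (f z) = z) (z : ℂ) : radExt g (radExt f z) = z := by
  rcases le_total ‖z‖ 1 with h | h
  · rw [radExt_of_le h, radExt_of_le (mem_Disk.1 (hm (mem_Disk.2 h))), hgf z (mem_Disk.2 h)]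
  · have hn := norm_radExt_of_ge hf h
    have hz0 : (‖z‖ : ℂ) ≠ 0 := Complex.ofReal_ne_zero.2 (by linarith)
    rw [radExt_of_ge (f := g) (by rwa [hn]), hn, radExt_of_ge h, mul_div_cancel_left₀ _ hz0, hgf,
      mul_div_cancel₀ _ hz0]
    rw [mem_Disk, norm_div, Complex.norm_real, norm_norm, div_self (by linarith)]

/-- The extension of a disk diffeomorphism to a homeomorphism of the plane. -/
def planeHomeo (f : SympDiff) (h1 : ∀ z, ‖z‖ = 1 → ‖f.toFun z‖ = 1)
    (h2 : ∀ z, ‖z‖ = 1 → ‖f.invFun z‖ = 1) : ℂ ≃ₜ ℂ where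
  toFun := radExt f.toFun
  invFun := radExt f.invFun
  left_inv := radExt_leftInverse h1 f.mapsTo f.left_inv
  right_inv := radExt_leftInverse h2 f.inv_mapsTo f.right_inv
  continuous_toFun := continuous_radExt f.contDiffOn.continuousOn
  continuous_invFun := continuous_radExt f.inv_contDiffOn.continuousOn

theorem exists_exp_of_norm_one {z : ℂ} (hz : ‖z‖ = 1) :
    ∃ θ : ℝ, z = Complex.exp (2 * π * Complex.I * θ) := by
  refine ⟨Complex.arg z / (2 * π), ?_⟩
  have h := Complex.norm_mul_exp_arg_mul_I z
  rw [hz, Complex.ofReal_one, one_mul] at h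
  conv_lhs => rw [← h]
  congr 1
  push_cast
  have := Complex.ofReal_ne_zero.2 Real.pi_ne_zero
  field_simp

theorem norm_exp_two_pi (θ : ℝ) : ‖Complex.exp (2 * π * Complex.I * θ)‖ = 1 := by
  rw [Complex.norm_exp]; simp

theorem lift_add_nat {l : ℝ → ℝ} (h : ∀ θ, l (θ + 1) = l θ + 1) (n : ℕ) (θ : ℝ) :
    l (θ + n) = l θ + n := by
  induction n with
  | zero => simp
  | succ n ih => push_cast; rw [← add_assoc, h, ih]; ring

theorem lift_surjective {l : ℝ → ℝ} (hc : Continuous l) (h : ∀ θ, l (θ + 1) = l θ + 1) :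
    Function.Surjective l := by
  intro c
  refine mem_range_of_exists_le_of_exists_ge hc ?_ ?_
  · obtain ⟨n, hn⟩ := exists_nat_ge (l 0 - c)
    refine ⟨0 - n, ?_⟩
    have := lift_add_nat h n (0 - n)
    rw [sub_add_cancel] at this
    linarith
  · obtain ⟨n, hn⟩ := exists_nat_ge (c - l 0)
    refine ⟨0 + n, ?_⟩
    have := lift_add_nat h n 0
    linarith

theorem circ_of_lift {f : ℂ → ℂ} {l : ℝ → ℝ}
    (hp : ∀ θ : ℝ, f (Complex.exp (2 * π * Complex.I * θ)) = Complex.exp (2 * π * Complex.I * l θ))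
    (z : ℂ) (hz : ‖z‖ = 1) : ‖f z‖ = 1 := by
  obtain ⟨θ, rfl⟩ := exists_exp_of_norm_one hz
  rw [hp, norm_exp_two_pi]

theorem inv_circ_of_lift (f : SympDiff) {l : ℝ → ℝ} (hc : Continuous l)
    (h : ∀ θ, l (θ + 1) = l θ + 1)
    (hp : ∀ θ : ℝ, f.toFun (Complex.exp (2 * π * Complex.I * θ)) = Complex.exp (2 * π * Complex.I * l θ))
    (z : ℂ) (hz : ‖z‖ = 1) : ‖f.invFun z‖ = 1 := by
  obtain ⟨θ, rfl⟩ := exists_exp_of_norm_one hz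
  obtain ⟨t, rfl⟩ := lift_surjective hc h θ
  rw [← hp, f.left_inv _ (mem_Disk.2 (norm_exp_two_pi t).le), norm_exp_two_pi]

theorem volume_image_eq (f : SympDiff) {s : Set ℂ} (hs : MeasurableSet s) (hsD : s ⊆ Disk) :
    volume (f.toFun '' s) = volume s := by
  have hd : ∀ x ∈ s, HasFDerivWithinAt f.toFun (fderivWithin ℝ f.toFun Disk x) s x := fun x hx =>
    ((f.contDiffOn.differentiableOn (by norm_num)) x (hsD hx)).hasFDerivWithinAt.mono hsD
  have hinj : InjOn f.toFun s := fun x hx y hy h => by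
    rw [← f.left_inv x (hsD hx), h, f.left_inv y (hsD hy)]
  rw [← lintegral_abs_det_fderiv_eq_addHaar_image volume hs hd hinj]
  have : ∀ x ∈ s, ENNReal.ofReal |(fderivWithin ℝ f.toFun Disk x).det| = 1 := fun x hx => by
    have := f.jacobian x (hsD hx)
    rw [ContinuousLinearMap.det]
    change ENNReal.ofReal |LinearMap.det (fderivWithin ℝ f.toFun Disk x).toLinearMap| = 1
    rw [this]; simp
  rw [setLIntegral_congr_fun hs this]
  simp

theorem measurePreserving_planeHomeo (f : SympDiff) (h1 : ∀ z, ‖z‖ = 1 → ‖f.toFun z‖ = 1)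
    (h2 : ∀ z, ‖z‖ = 1 → ‖f.invFun z‖ = 1) :
    MeasurePreserving (planeHomeo f h1 h2) (volume.restrict Disk) (volume.restrict Disk) := by
  have hDm : MeasurableSet Disk := isClosed_closedBall.measurableSet
  refine ⟨(planeHomeo f h1 h2).continuous.measurable, ?_⟩
  ext s hs
  have hm := (planeHomeo f h1 h2).continuous.measurable hs
  rw [Measure.map_apply (planeHomeo f h1 h2).continuous.measurable hs, Measure.restrict_apply hm,
    Measure.restrict_apply hs, ← volume_image_eq f (hm.inter hDm) inter_subset_right]
  congr 1
  ext w
  constructor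
  · rintro ⟨z, ⟨hz, hzD⟩, rfl⟩
    refine ⟨?_, f.mapsTo hzD⟩
    have : radExt f.toFun z ∈ s := hz
    rwa [radExt_of_le (mem_Disk.1 hzD)] at this
  · rintro ⟨hw, hwD⟩
    refine ⟨f.invFun w, ⟨?_, f.inv_mapsTo hwD⟩, f.right_inv w hwD⟩
    show radExt f.toFun (f.invFun w) ∈ s
    rwa [radExt_of_le (mem_Disk.1 (f.inv_mapsTo hwD)), f.right_inv w hwD]

theorem radExt_norm_lt (f : SympDiff) (h1 : ∀ z, ‖z‖ = 1 → ‖f.toFun z‖ = 1)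
    (h2 : ∀ z, ‖z‖ = 1 → ‖f.invFun z‖ = 1) (z : ℂ) : ‖radExt f.toFun z‖ < 1 ↔ ‖z‖ < 1 := by
  constructor
  · intro h
    by_contra hcon
    rw [norm_radExt_of_ge h1 (not_lt.1 hcon)] at h
    exact hcon h
  · intro h
    rw [radExt_of_le h.le]
    refine lt_of_le_of_ne (mem_Disk.1 (f.mapsTo (mem_Disk.2 h.le))) fun heq => ?_
    have := h2 _ heq
    rw [f.left_inv z (mem_Disk.2 h.le)] at this
    linarith

theorem radExt_norm_eq (f : SympDiff) (h1 : ∀ z, ‖z‖ = 1 → ‖f.toFun z‖ = 1)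
    (h2 : ∀ z, ‖z‖ = 1 → ‖f.invFun z‖ = 1) (z : ℂ) : ‖radExt f.toFun z‖ = 1 ↔ ‖z‖ = 1 := by
  constructor
  · intro h
    rcases lt_or_ge ‖z‖ 1 with h' | h'
    · have := (radExt_norm_lt f h1 h2 z).2 h'; linarith
    · rwa [norm_radExt_of_ge h1 h'] at h
  · intro h
    rw [norm_radExt_of_ge h1 h.ge, h]

/-- The radial comparison: `f` is nearly linear at `0`, uniformly in direction. -/
theorem exists_ratio_re_pos (f : SympDiff) (hfix : f.toFun 0 = 0) :
    ∃ δ : ℝ, 0 < δ ∧ δ ≤ 1 ∧ ∀ z : ℂ, z ≠ 0 → ‖z‖ ≤ δ → ∀ s : ℝ, 0 < s → s ≤ 1 →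
      0 < (f.toFun (s * z) / f.toFun z).re := by
  obtain ⟨K, hK⟩ := f.inv_contDiffOn.exists_lipschitzOnWith one_ne_zero convex_Disk isCompact_Disk
  have h0 : (0 : ℂ) ∈ Disk := by simp [Disk]
  have hi0 : f.invFun 0 = 0 := by conv_lhs => rw [← hfix, f.left_inv 0 h0]
  have hlow : ∀ z ∈ Disk, ‖z‖ ≤ (K + 1) * ‖f.toFun z‖ := by
    intro z hz
    have := hK.dist_le_mul _ (f.mapsTo hz) _ h0
    rw [f.left_inv z hz, hi0, dist_zero_right, dist_zero_right] at this
    nlinarith [norm_nonneg (f.toFun z)]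
  set m : ℝ := 1 / (K + 1) with hm
  have hm0 : 0 < m := by positivity
  have hd := ((f.contDiffOn.differentiableOn (by norm_num)) 0 h0).hasFDerivWithinAt
  have hd' := (hd.hasFDerivAt (closedBall_mem_nhds 0 one_pos)).isLittleO.def (c := m / 4) (by positivity)
  obtain ⟨δ, hδ, hball⟩ := Metric.eventually_nhds_iff.1 hd'
  set L := fderivWithin ℝ f.toFun Disk 0 with hL
  have happ : ∀ z : ℂ, ‖z‖ < δ → ‖f.toFun z - L z‖ ≤ m / 4 * ‖z‖ := by
    intro z hz
    have := hball (y := z) (by simpa using hz)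
    simpa [hfix] using this
  refine ⟨min (δ / 2) 1, by positivity, min_le_right _ _, fun z hz0 hz s hs hs1 => ?_⟩
  have hzn : 0 < ‖z‖ := norm_pos_iff.2 hz0
  have hzδ : ‖z‖ < δ := by have := hz.trans (min_le_left _ _); linarith
  have hsn : ‖(s : ℂ) * z‖ = s * ‖z‖ := by
    rw [norm_mul, Complex.norm_real, Real.norm_of_nonneg hs.le]
  have a1 := happ z hzδ
  have a2 := happ (s * z) (by rw [hsn]; nlinarith)
  rw [hsn] at a2
  have hLs : L (s * z) = s * L z := by
    have := L.map_smul s z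
    simpa [Complex.real_smul] using this
  have hzD : z ∈ Disk := mem_Disk.2 (hz.trans (min_le_right _ _))
  have a3 : m * ‖z‖ ≤ ‖f.toFun z‖ := by
    have := hlow z hzD
    rw [hm, div_mul_eq_mul_div, one_mul, div_le_iff₀ (by positivity)]; linarith
  have hf0 : 0 < ‖f.toFun z‖ := lt_of_lt_of_le (by positivity) a3
  have hfne : f.toFun z ≠ 0 := norm_pos_iff.1 hf0
  have a4 : ‖f.toFun (s * z) - s * f.toFun z‖ ≤ s * (m / 2 * ‖z‖) := by
    have e : f.toFun (s * z) - s * f.toFun z =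
        (f.toFun (s * z) - L (s * z)) - s * (f.toFun z - L z) := by rw [hLs]; ring
    rw [e]
    refine (norm_sub_le _ _).trans ?_
    rw [norm_mul, Complex.norm_real, Real.norm_of_nonneg hs.le]
    nlinarith
  have a5 : ‖f.toFun (s * z) / f.toFun z - s‖ < s := by
    rw [show f.toFun (s * z) / f.toFun z - s = (f.toFun (s * z) - s * f.toFun z) / f.toFun z by
      field_simp, norm_div, div_lt_iff₀ hf0]
    refine a4.trans_lt ?_
    refine mul_lt_mul_of_pos_left ?_ hs
    nlinarith [mul_pos hm0 hzn]
  have a6 := (Complex.abs_re_le_norm _).trans_lt a5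
  rw [Complex.sub_re, Complex.ofReal_re, abs_lt] at a6
  linarith [a6.1]

theorem exists_lift_homeo (E : ℂ ≃ₜ ℂ) (hE0 : E 0 = 0) {l : ℝ → ℝ} (hc : Continuous l)
    (hper : ∀ θ, l (θ + 1) = l θ + 1)
    (hproj : ∀ θ : ℝ, E (Complex.exp (2 * π * Complex.I * θ)) = Complex.exp (2 * π * Complex.I * l θ)) :
    ∃ F : ℂ ≃ₜ ℂ, Comm F ∧ (∀ ζ, Complex.exp (F ζ) = E (Complex.exp ζ)) ∧
      ∀ θ : ℝ, F (2 * π * Complex.I * θ) = 2 * π * Complex.I * l θ := by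
  have hne : ∀ z : ℂ, z ≠ 0 → E z ≠ 0 := fun z hz h => hz (E.injective (h.trans hE0.symm))
  have hE0' : E.symm 0 = 0 := by rw [E.symm_apply_eq]; exact hE0.symm
  have hne' : ∀ z : ℂ, z ≠ 0 → E.symm z ≠ 0 := fun z hz h => hz (E.symm.injective (h.trans hE0'.symm))
  obtain ⟨F₀, hF₀, hF₀e⟩ := exists_continuous_log (E.continuous.comp Complex.continuous_exp)
    (fun ζ => hne _ (Complex.exp_ne_zero ζ))
  obtain ⟨k, hk⟩ := exists_int_of_exp_eq' (X := ℝ) (g₁ := fun θ => F₀ (2 * π * Complex.I * θ))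
    (g₂ := fun θ => 2 * π * Complex.I * l θ) (by fun_prop) (by fun_prop)
    (fun θ => by rw [hF₀e, Function.comp_apply, hproj])
  have hInt : ∀ (n : ℤ) (z : ℂ), Complex.exp (z + n * (2 * π * Complex.I)) = Complex.exp z :=
    fun n z => Complex.exp_eq_exp_iff_exists_int.2 ⟨n, rfl⟩
  set F₁ : ℂ → ℂ := fun ζ => F₀ ζ + (-k : ℤ) * (2 * π * Complex.I) with hF₁
  have hF₁c : Continuous F₁ := by fun_prop
  have hF₁e : ∀ ζ, Complex.exp (F₁ ζ) = E (Complex.exp ζ) := fun ζ => by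
    rw [hF₁]; dsimp only; rw [hInt, hF₀e]; rfl
  have hax : ∀ θ : ℝ, F₁ (2 * π * Complex.I * θ) = 2 * π * Complex.I * l θ := fun θ => by
    rw [hF₁]; dsimp only; rw [hk θ]; push_cast; ring
  have hcomm : Comm F₁ := by
    obtain ⟨m, hm⟩ := exists_int_of_exp_eq' (X := ℂ) (g₁ := fun ζ => F₁ (ζ + 2 * π * Complex.I))
      (g₂ := F₁) (by fun_prop) hF₁c (fun ζ => by
        rw [hF₁e, hF₁e, Complex.exp_add, Complex.exp_two_pi_mul_I, mul_one])
    have h1 := hm 0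
    have h2 := hax 0
    have h3 := hax 1
    have h4 := hper 0
    simp only [Complex.ofReal_zero, mul_zero, Complex.ofReal_one, mul_one, zero_add] at h1 h2 h3 h4
    rw [h3, h2, h4] at h1
    push_cast at h1
    have h5 : (2 * π * Complex.I : ℂ) * 1 = (2 * π * Complex.I) * m := by linear_combination h1
    have h6 := mul_left_cancel₀ two_pi_I_ne_zero' h5
    intro ζ
    rw [hm ζ, ← h6, one_mul]
  obtain ⟨G₀, hG₀, hG₀e⟩ := exists_continuous_log (E.symm.continuous.comp Complex.continuous_exp)
    (fun ζ => hne' _ (Complex.exp_ne_zero ζ))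
  obtain ⟨m, hm⟩ := exists_int_of_exp_eq' (X := ℂ) (g₁ := fun ζ => F₁ (G₀ ζ))
    (g₂ := fun ζ => ζ) (by fun_prop) continuous_id (fun ζ => by
      rw [hF₁e, hG₀e, Function.comp_apply, E.apply_symm_apply])
  set G : ℂ → ℂ := fun ζ => G₀ ζ + (-m : ℤ) * (2 * π * Complex.I) with hG
  have hGc : Continuous G := by fun_prop
  have hGe : ∀ ζ, Complex.exp (G ζ) = E.symm (Complex.exp ζ) := fun ζ => by
    rw [hG]; dsimp only; rw [hInt, hG₀e]; rfl
  have hFG : ∀ ζ, F₁ (G ζ) = ζ := fun ζ => by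
    rw [hG]; dsimp only; rw [hcomm.int, hm]; push_cast; ring
  have hGF : ∀ ζ, G (F₁ ζ) = ζ := fun ζ => by
    obtain ⟨n, hn⟩ := Complex.exp_eq_exp_iff_exists_int.1
      (show Complex.exp (G (F₁ ζ)) = Complex.exp ζ by rw [hGe, hF₁e, E.symm_apply_apply])
    have h1 := hFG (F₁ ζ)
    rw [hn, hcomm.int] at h1
    rw [hn, add_eq_left.1 h1, add_zero]
  exact ⟨⟨⟨F₁, G, hGF, hFG⟩, hF₁c, hGc⟩, hcomm, hF₁e, hax⟩

theorem lift_radial {F E : ℂ ≃ₜ ℂ} (hexp : ∀ ζ, Complex.exp (F ζ) = E (Complex.exp ζ))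
    (hrad : ∀ z, 1 ≤ ‖z‖ → E z = (‖z‖ : ℂ) * E (z / (‖z‖ : ℂ))) (ζ : ℂ) (hζ : 0 ≤ ζ.re) :
    F ζ = ζ.re + F (ζ.im * Complex.I) := by
  have hconn : IsPreconnected {ζ : ℂ | 0 ≤ ζ.re} := (convex_halfSpace_re_ge 0).isPreconnected
  have hF := F.continuous
  obtain ⟨k, hk⟩ := exists_int_of_exp_eq hconn (g₁ := F)
    (g₂ := fun ζ => (ζ.re : ℂ) + F (ζ.im * Complex.I)) hF.continuousOn
    (Continuous.continuousOn (by fun_prop)) (fun z hz => by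
      have hz : 0 ≤ z.re := hz
      rw [hexp, hrad _ (by rw [Complex.norm_exp]; exact Real.one_le_exp hz), Complex.exp_add, hexp,
        Complex.norm_exp]
      have e : Complex.exp z = Complex.exp z.re * Complex.exp (z.im * Complex.I) := by
        rw [← Complex.exp_add, Complex.re_add_im]
      rw [Complex.ofReal_exp]
      congr 2
      rw [e, mul_div_cancel_left₀ _ (Complex.exp_ne_zero _)])
  have h0 := hk 0 (by simp)
  simp only [Complex.zero_re, Complex.zero_im, Complex.ofReal_zero, zero_mul, zero_add] at h0
  have h1 := hk ζ hζ
  rw [left_eq_add.1 h0, add_zero] at h1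
  exact h1

theorem OP_of_radial {F E : ℂ ≃ₜ ℂ} {l : ℝ → ℝ} (hmono : StrictMono l)
    (hexp : ∀ ζ, Complex.exp (F ζ) = E (Complex.exp ζ))
    (hax : ∀ θ : ℝ, F (2 * π * Complex.I * θ) = 2 * π * Complex.I * l θ)
    (hrad : ∀ z, 1 ≤ ‖z‖ → E z = (‖z‖ : ℂ) * E (z / (‖z‖ : ℂ)))
    (hdisk : ∀ z, ‖E z‖ < 1 ↔ ‖z‖ < 1) : OP F := by
  have key : ∀ ζ : ℂ, 0 ≤ ζ.re → F ζ = ζ.re + 2 * π * Complex.I * l (ζ.im / (2 * π)) := by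
    intro ζ hζ
    rw [lift_radial hexp hrad ζ hζ, ← hax]
    congr 2
    push_cast
    have := Complex.ofReal_ne_zero.2 Real.pi_ne_zero
    field_simp
  refine OP.of_slit F 1 fun w hw => ?_
  have hF1 := key 1 (by simp)
  simp only [Complex.one_re, Complex.one_im, Complex.ofReal_one, zero_div] at hF1
  rcases le_or_gt 0 (1 + w.re) with h | h
  · have hF2 := key (1 + w) (by simpa using h)
    rw [hF2, hF1]
    simp only [Complex.add_re, Complex.one_re, Complex.add_im, Complex.one_im, zero_add]
    left
    rw [Complex.div_re, ← add_div]
    refine div_pos ?_ (Complex.normSq_pos.2 hw)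
    simp only [Complex.sub_re, Complex.add_re, Complex.mul_re, Complex.ofReal_re, Complex.ofReal_im,
      Complex.I_re, Complex.I_im, Complex.sub_im, Complex.add_im, Complex.mul_im, Complex.re_ofNat,
      Complex.im_ofNat, Complex.one_re, Complex.one_im]
    ring_nf
    rcases lt_trichotomy w.im 0 with h1 | h1 | h1
    · have : l (w.im / (2 * π)) < l 0 := hmono (div_neg_of_neg_of_pos h1 (by positivity))
      ring_nf at this
      nlinarith [mul_pos (mul_pos (neg_pos.2 h1) Real.pi_pos) (sub_pos.2 this), sq_nonneg w.re]
    · have : 0 < w.re ^ 2 := by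
        have : w.re ≠ 0 := fun h0 => hw (Complex.ext h0 h1)
        positivity
      simp [h1, this]
    · have : l 0 < l (w.im / (2 * π)) := hmono (by positivity)
      ring_nf at this
      nlinarith [mul_pos (mul_pos h1 Real.pi_pos) (sub_pos.2 this), sq_nonneg w.re]
  · have hre : (F (1 + w)).re < 0 := by
      have := (hdisk (Complex.exp (1 + w))).2 (by
        rw [Complex.norm_exp, Real.exp_lt_one_iff]; simpa using h)
      rwa [← hexp, Complex.norm_exp, Real.exp_lt_one_iff] at this
    rw [Complex.mem_slitPlane_iff_not_le_zero]
    intro hle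
    set D := F (1 + w) - F 1 with hD
    have hDre : D.re < 0 := by
      rw [hD, hF1]; simp; linarith
    obtain ⟨h1, h2⟩ := Complex.le_def.1 hle
    have e : D = (D / w) * w := by field_simp
    have e2 : D.re = (D / w).re * w.re := by
      conv_lhs => rw [e, Complex.mul_re, h2]
      simp
    rw [Complex.zero_re] at h1
    nlinarith [mul_nonneg (neg_nonneg.2 h1) (show 0 ≤ -w.re by linarith)]

/-- Points on a path whose exponential stays in the right half-plane keep bounded imaginary part. -/
theorem abs_im_lt_of_re_exp_pos {d : ℝ → ℂ} {a b : ℝ} (hab : a ≤ b) (hc : ContinuousOn d (Icc a b))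
    (hpos : ∀ x ∈ Icc a b, 0 < (Complex.exp (d x)).re) (hb : d b = 0) : |(d a).im| < π := by
  obtain ⟨k, hk⟩ := exists_int_of_exp_eq (isPreconnected_Icc (a := a) (b := b)) hc
    (g₂ := fun x => Complex.log (Complex.exp (d x)))
    (ContinuousOn.clog (Complex.continuous_exp.comp_continuousOn hc) fun x hx => Or.inl (hpos x hx))
    (fun x hx => (Complex.exp_log (Complex.exp_ne_zero _)).symm)
  have h0 := hk b (right_mem_Icc.2 hab)
  rw [hb, Complex.exp_zero, Complex.log_one, zero_add] at h0
  have h1 := hk a (left_mem_Icc.2 hab)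
  rw [← h0, add_zero] at h1
  rw [h1, Complex.log_im]
  have := Complex.abs_arg_lt_pi_div_two_iff.2 (Or.inl (hpos a (left_mem_Icc.2 hab)))
  linarith [Real.pi_pos]

theorem lift_bdd {F E : ℂ ≃ₜ ℂ} (hcomm : Comm F)
    (hexp : ∀ ζ, Complex.exp (F ζ) = E (Complex.exp ζ)) {δ : ℝ} (hδ : 0 < δ) (hδ1 : δ ≤ 1)
    (hr : ∀ z : ℂ, z ≠ 0 → ‖z‖ ≤ δ → ∀ s : ℝ, 0 < s → s ≤ 1 → 0 < (E (s * z) / E z).re) :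
    ∃ C : ℝ, ∀ ζ : ℂ, ζ.re < 0 → |(F ζ).im - ζ.im| ≤ C := by
  have hF := F.continuous
  have hcpt : IsCompact (Icc (Real.log δ) 0 ×ℂ Icc 0 (2 * π)) :=
    isCompact_Icc.reProdIm isCompact_Icc
  obtain ⟨C, hC⟩ := hcpt.exists_bound_of_continuousOn (f := fun ζ => (F ζ).im - ζ.im)
    (Continuous.continuousOn (by fun_prop))
  have hstrip : ∀ ζ : ℂ, Real.log δ ≤ ζ.re → ζ.re ≤ 0 → |(F ζ).im - ζ.im| ≤ C := by
    intro ζ h1 h2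
    set n : ℤ := ⌊ζ.im / (2 * π)⌋ with hn
    have hp := Real.two_pi_pos
    have a1 := Int.floor_le (ζ.im / (2 * π))
    have a2 := Int.lt_floor_add_one (ζ.im / (2 * π))
    rw [← hn, le_div_iff₀ hp] at a1
    rw [← hn, div_lt_iff₀ hp] at a2
    have := hC (ζ + (-n : ℤ) * (2 * π * Complex.I)) (by
      rw [Complex.mem_reProdIm]
      simp only [Complex.add_re, Complex.mul_re, Complex.add_im, Complex.mul_im, Complex.intCast_re,
        Complex.intCast_im, Complex.ofReal_re, Complex.ofReal_im, Complex.I_re, Complex.I_im,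
        Complex.re_ofNat, Complex.im_ofNat, mem_Icc]
      push_cast
      refine ⟨⟨by linarith, by linarith⟩, by linarith, by linarith⟩)
    rw [hcomm.int, Real.norm_eq_abs, Complex.add_im, Complex.add_im, add_sub_add_right_eq_sub] at this
    exact this
  refine ⟨C + π, fun ζ hζ => ?_⟩
  rcases le_total (Real.log δ) ζ.re with h | h
  · linarith [hstrip ζ h hζ.le, Real.pi_pos]
  · set P : ℝ → ℂ := fun x => x + ζ.im * Complex.I with hP
    have hPc : Continuous P := by fun_prop
    have e0 : P ζ.re = ζ := Complex.re_add_im ζ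
    have hb := abs_im_lt_of_re_exp_pos (d := fun x => F (P x) - F (P (Real.log δ))) h
      (Continuous.continuousOn (by fun_prop)) (fun x hx => by
        rw [Complex.exp_sub, hexp, hexp]
        have e1 : Complex.exp (P x) = (Real.exp (x - Real.log δ) : ℝ) * Complex.exp (P (Real.log δ)) := by
          rw [Complex.ofReal_exp, ← Complex.exp_add]
          congr 1
          simp only [hP]; push_cast; ring
        rw [e1]
        refine hr _ (Complex.exp_ne_zero _) ?_ _ (Real.exp_pos _) ?_
        · rw [Complex.norm_exp]
          simp [hP, Real.exp_log hδ]
        · rw [Real.exp_le_one_iff]; linarith [hx.2]) (sub_self _)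
    rw [e0, Complex.sub_im] at hb
    have h2 := hstrip (P (Real.log δ)) (by simp [hP])
      (by simpa [hP] using Real.log_nonpos hδ.le hδ1)
    have e3 : (P (Real.log δ)).im = ζ.im := by simp [hP]
    rw [e3] at h2
    rw [abs_lt] at hb
    rw [abs_le] at h2 ⊢
    constructor <;> linarith [h2.1, h2.2, hb.1, hb.2]

theorem planeHomeo_apply (f : SympDiff) (h1 : ∀ z, ‖z‖ = 1 → ‖f.toFun z‖ = 1)
    (h2 : ∀ z, ‖z‖ = 1 → ‖f.invFun z‖ = 1) {z : ℂ} (hz : z ∈ Disk) :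
    planeHomeo f h1 h2 z = f.toFun z := radExt_of_le (mem_Disk.1 hz)

theorem planeHomeo_iterate (f : SympDiff) (h1 : ∀ z, ‖z‖ = 1 → ‖f.toFun z‖ = 1)
    (h2 : ∀ z, ‖z‖ = 1 → ‖f.invFun z‖ = 1) (n : ℕ) {z : ℂ} (hz : z ∈ Disk) :
    (planeHomeo f h1 h2)^[n] z = f.toFun^[n] z := by
  induction n generalizing z with
  | zero => rfl
  | succ n ih =>
    rw [Function.iterate_succ_apply, Function.iterate_succ_apply, planeHomeo_apply f h1 h2 hz,
      ih (f.mapsTo hz)]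

theorem radExt_iterate_of_ge {f : ℂ → ℂ} (hf : ∀ z, ‖z‖ = 1 → ‖f z‖ = 1) (n : ℕ) {z : ℂ}
    (hz : 1 ≤ ‖z‖) : (radExt f)^[n] z = (‖z‖ : ℂ) * f^[n] (z / (‖z‖ : ℂ)) := by
  have hz0 : (‖z‖ : ℂ) ≠ 0 := Complex.ofReal_ne_zero.2 (by linarith)
  induction n generalizing z with
  | zero => simp only [Function.iterate_zero, id]; field_simp
  | succ n ih =>
    have hn := norm_radExt_of_ge hf hz
    rw [Function.iterate_succ_apply, Function.iterate_succ_apply, ih (by rwa [hn]) (by rwa [hn]), hn,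
      radExt_of_ge hz, mul_div_cancel_left₀ _ hz0]

theorem exists_pseudoRot (f : SympDiff) (hfix : f.toFun 0 = 0)
    (hpseudo : ∀ z ∈ Disk, z ≠ 0 → ∀ n : ℕ, 1 ≤ n → f.toFun^[n] z ≠ z)
    {l : ℝ → ℝ} (hc : Continuous l) (hmono : StrictMono l) (hper : ∀ θ : ℝ, l (θ + 1) = l θ + 1)
    (hproj : ∀ θ : ℝ, f.toFun (Complex.exp (2 * π * Complex.I * θ)) =
        Complex.exp (2 * π * Complex.I * l θ))
    {α : ℝ} (hα : ∀ θ : ℝ, Tendsto (fun n : ℕ => (l^[n] θ - θ) / n) atTop (𝓝 α)) :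
    ∃ F E : ℂ ≃ₜ ℂ, PseudoRot F E l α ∧ (∀ n, ∀ z ∈ Disk, E^[n] z = f.toFun^[n] z) := by
  have h1 := circ_of_lift hproj
  have h2 := inv_circ_of_lift f hc hper hproj
  set E := planeHomeo f h1 h2 with hE
  have h0D : (0 : ℂ) ∈ Disk := by simp [Disk]
  have hE0 : E 0 = 0 := by rw [hE, planeHomeo_apply f h1 h2 h0D, hfix]
  have hcD : ∀ z : ℂ, ‖z‖ = 1 → z ∈ Disk := fun z hz => mem_Disk.2 hz.le
  obtain ⟨F, hF1, hF2, hF3⟩ := exists_lift_homeo E hE0 hc hper (fun θ => by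
    rw [hE, planeHomeo_apply f h1 h2 (hcD _ (norm_exp_two_pi θ)), hproj])
  have hrad : ∀ z, 1 ≤ ‖z‖ → E z = (‖z‖ : ℂ) * E (z / (‖z‖ : ℂ)) := fun z hz => by
    rw [hE, planeHomeo_apply f h1 h2 (hcD (z / (‖z‖ : ℂ)) (by
      rw [norm_div, Complex.norm_real, norm_norm, div_self (by linarith)]))]
    exact radExt_of_ge hz
  obtain ⟨δ, hδ, hδ1, hr⟩ := exists_ratio_re_pos f hfix
  refine ⟨F, E, ⟨⟨OP_of_radial hmono hF2 hF3 hrad (radExt_norm_lt f h1 h2), hF1, hF2,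
    radExt_norm_lt f h1 h2, radExt_norm_eq f h1 h2, lift_bdd hF1 hF2 hδ hδ1 ?_,
    measurePreserving_planeHomeo f h1 h2⟩, ?_, hc, hF3, hα⟩,
    fun n z hz => planeHomeo_iterate f h1 h2 n hz⟩
  · intro z hz hzδ s hs hs1
    rw [hE, planeHomeo_apply f h1 h2 (mem_Disk.2 (hzδ.trans hδ1)), planeHomeo_apply f h1 h2]
    · exact hr z hz hzδ s hs hs1
    · rw [mem_Disk, norm_mul, Complex.norm_real, Real.norm_of_nonneg hs.le]
      nlinarith [norm_nonneg z]
  · intro n hn z hz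
    rcases le_total ‖z‖ 1 with h | h
    · rw [hE, planeHomeo_iterate f h1 h2 n (mem_Disk.2 h)]
      exact hpseudo z (mem_Disk.2 h) hz n hn
    · have hz0 : (‖z‖ : ℂ) ≠ 0 := Complex.ofReal_ne_zero.2 (by linarith)
      have : E^[n] z = (‖z‖ : ℂ) * f.toFun^[n] (z / (‖z‖ : ℂ)) := radExt_iterate_of_ge h1 n h
      rw [this]
      intro heq
      refine hpseudo (z / (‖z‖ : ℂ)) (hcD _ (by
        rw [norm_div, Complex.norm_real, norm_norm, div_self (by linarith)])) (div_ne_zero hz hz0)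
        n hn ?_
      rw [eq_div_iff hz0, mul_comm, heq]

theorem uniqueDiffOn_Disk : UniqueDiffOn ℝ Disk :=
  uniqueDiffOn_convex convex_Disk ⟨0, ball_subset_interior_closedBall (mem_ball_self one_pos)⟩

/-- The derivative cocycle of the iterates of `f`. -/
def cD (f : SympDiff) : ℕ → ℂ → (ℂ →L[ℝ] ℂ)
  | 0, _ => ContinuousLinearMap.id ℝ ℂ
  | n + 1, z => (fderivWithin ℝ f.toFun Disk (f.toFun^[n] z)).comp (cD f n z)

theorem iterate_mem (f : SympDiff) (n : ℕ) {z : ℂ} (hz : z ∈ Disk) : f.toFun^[n] z ∈ Disk :=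
  f.mapsTo.iterate n hz

theorem hasFDerivWithinAt_iterate (f : SympDiff) (n : ℕ) {z : ℂ} (hz : z ∈ Disk) :
    HasFDerivWithinAt f.toFun^[n] (cD f n z) Disk z := by
  induction n with
  | zero => exact hasFDerivWithinAt_id z Disk
  | succ n ih =>
    rw [Function.iterate_succ']
    exact ((f.contDiffOn.differentiableOn (by norm_num)) _ (iterate_mem f n hz)).hasFDerivWithinAt.comp
      z ih (f.mapsTo.iterate n)

theorem cD_add (f : SympDiff) (m n : ℕ) (z : ℂ) :
    cD f (m + n) z = (cD f m (f.toFun^[n] z)).comp (cD f n z) := by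
  induction m with
  | zero => rw [Nat.zero_add]; rfl
  | succ m ih =>
    rw [show m + 1 + n = (m + n) + 1 by ring, cD, ih, cD, Function.iterate_add_apply]; rfl

theorem det_cD (f : SympDiff) (n : ℕ) {z : ℂ} (hz : z ∈ Disk) :
    LinearMap.det (cD f n z).toLinearMap = 1 := by
  induction n with
  | zero => exact LinearMap.det_id
  | succ n ih =>
    rw [cD, ContinuousLinearMap.toLinearMap_comp, LinearMap.det_comp, ih,
      f.jacobian _ (iterate_mem f n hz), one_mul]

theorem continuousOn_iterate (f : SympDiff) (n : ℕ) : ContinuousOn f.toFun^[n] Disk := fun _ hz =>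
  (hasFDerivWithinAt_iterate f n hz).continuousWithinAt

theorem continuousOn_cD (f : SympDiff) (n : ℕ) : ContinuousOn (cD f n) Disk := by
  induction n with
  | zero => exact continuousOn_const
  | succ n ih =>
    exact ((f.contDiffOn.continuousOn_fderivWithin uniqueDiffOn_Disk le_rfl).comp
      (continuousOn_iterate f n) (f.mapsTo.iterate n)).clm_comp ih

/-- The bilinear map underlying the Liouville form. -/
def lformB : ℂ →L[ℝ] ℂ →L[ℝ] ℝ :=
  LinearMap.toContinuousLinearMap
    { toFun := fun z => (2 * π)⁻¹ • (z.re • Complex.imCLM - z.im • Complex.reCLM)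
      map_add' := fun a b => by ext w; simp; ring
      map_smul' := fun c a => by ext w; simp; ring }

theorem lformB_apply (z w : ℂ) : lformB z w = lform z w := by
  simp [lformB, lform]; ring

theorem abs_lform_le (z w : ℂ) : |lform z w| ≤ ‖z‖ * ‖w‖ / 6 := by
  have h : z.re * w.im - z.im * w.re = (starRingEnd ℂ z * w).im := by simp; ring
  have h2 := Complex.abs_im_le_norm (starRingEnd ℂ z * w)
  rw [norm_mul, Complex.norm_conj] at h2
  rw [lform, h, abs_div, abs_of_pos Real.two_pi_pos]
  have := Real.pi_gt_three
  gcongr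
  linarith

/-- The action of the `q`-th iterate. -/
def actSum (f : SympDiff) (A : ℂ → ℝ) (q : ℕ) (z : ℂ) : ℝ := ∑ j ∈ Finset.range q, A (f.toFun^[j] z)

theorem hasFDerivWithinAt_actSum {f : SympDiff} {A : ℂ → ℝ} (hA : IsAction f A) (q : ℕ) {z : ℂ}
    (hz : z ∈ Disk) : HasFDerivWithinAt (actSum f A q)
      ((lformB (f.toFun^[q] z)).comp (cD f q z) - lformB z) Disk z := by
  induction q with
  | zero =>
    have : actSum f A 0 = fun _ => 0 := by funext z; simp [actSum]
    rw [this]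
    refine (hasFDerivWithinAt_const (0 : ℝ) z Disk).congr_fderiv ?_
    ext w; simp [cD]
  | succ q ih =>
    have e : actSum f A (q + 1) = fun z => actSum f A q z + A (f.toFun^[q] z) := by
      funext z; simp [actSum, Finset.sum_range_succ]
    rw [e]
    have h1 := ((hA.1.differentiableOn (by norm_num)) _ (iterate_mem f q hz)).hasFDerivWithinAt.comp
      z (hasFDerivWithinAt_iterate f q hz) (f.mapsTo.iterate q)
    convert! ih.add h1 using 1
    ext w
    have := hA.2 _ (iterate_mem f q hz) (cD f q z w)
    simp only [add_apply, sub_apply,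
      ContinuousLinearMap.comp_apply, lformB_apply, this, cD]
    rw [Function.iterate_succ_apply']
    ring

theorem actSum_sub_le {f : SympDiff} {A : ℂ → ℝ} (hA : IsAction f A) {q : ℕ} {K ε : ℝ}
    (hK1 : 1 ≤ K) (hK : ∀ z ∈ Disk, ‖cD f q z‖ ≤ K) (hε : ∀ z ∈ Disk, ‖f.toFun^[q] z - z‖ ≤ ε)
    {x y : ℂ} (hx : x ∈ Disk) (hy : y ∈ Disk) : |actSum f A q x - actSum f A q y| ≤ 3 * ε * K := by
  have hε0 : 0 ≤ ε := (norm_nonneg _).trans (hε x hx)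
  set u : ℂ → ℂ := fun z => f.toFun^[q] z - z with hu
  have hd : ∀ z ∈ Disk, HasFDerivWithinAt (fun z => actSum f A q z - lformB z (u z))
      (((lformB (f.toFun^[q] z)).comp (cD f q z) - lformB z) -
        ((lformB z).comp (cD f q z - ContinuousLinearMap.id ℝ ℂ) + lformB.flip (u z))) Disk z := by
    intro z hz
    have h1 : HasFDerivWithinAt u (cD f q z - ContinuousLinearMap.id ℝ ℂ) Disk z :=
      (hasFDerivWithinAt_iterate f q hz).sub (hasFDerivWithinAt_id z Disk)
    have h2 := lformB.hasFDerivWithinAt (s := Disk) (x := z)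
    refine (hasFDerivWithinAt_actSum hA q hz).sub ?_
    convert! h2.clm_apply h1 using 1
  have hb : ∀ z ∈ Disk, ‖((lformB (f.toFun^[q] z)).comp (cD f q z) - lformB z) -
        ((lformB z).comp (cD f q z - ContinuousLinearMap.id ℝ ℂ) + lformB.flip (u z))‖ ≤ ε * K := by
    intro z hz
    refine ContinuousLinearMap.opNorm_le_bound _ (by positivity) fun w => ?_
    have e : (((lformB (f.toFun^[q] z)).comp (cD f q z) - lformB z) -
        ((lformB z).comp (cD f q z - ContinuousLinearMap.id ℝ ℂ) + lformB.flip (u z))) w =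
        lform (u z) (cD f q z w) + lform (u z) w := by
      simp only [add_apply, sub_apply,
        ContinuousLinearMap.comp_apply, lformB_apply, ContinuousLinearMap.flip_apply,
        ContinuousLinearMap.id_apply, hu, lform, Complex.sub_re, Complex.sub_im]
      ring
    rw [e, Real.norm_eq_abs]
    have h1 := abs_lform_le (u z) (cD f q z w)
    have h2 := abs_lform_le (u z) w
    have h3 := (cD f q z).le_opNorm w
    have h4 := hK z hz
    have h5 : ‖u z‖ ≤ ε := hε z hz
    have h6 : ‖cD f q z w‖ ≤ K * ‖w‖ := h3.trans (by gcongr)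
    have h7 : ‖u z‖ * ‖cD f q z w‖ ≤ ε * (K * ‖w‖) := by gcongr
    have h8 : ‖u z‖ * ‖w‖ ≤ ε * (K * ‖w‖) := by
      have : ‖w‖ ≤ K * ‖w‖ := le_mul_of_one_le_left (norm_nonneg _) hK1
      gcongr
    have h9 : 0 ≤ ε * (K * ‖w‖) := by positivity
    refine (abs_add_le _ _).trans ?_
    linarith
  have hm := convex_Disk.norm_image_sub_le_of_norm_hasFDerivWithin_le hd hb hy hx
  rw [Real.norm_eq_abs] at hm
  simp only [lformB_apply] at hm
  have hxy : ‖x - y‖ ≤ 2 := by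
    have := norm_sub_le x y
    linarith [mem_Disk.1 hx, mem_Disk.1 hy]
  have g1 : ∀ z ∈ Disk, |lform z (u z)| ≤ ε / 6 := fun z hz => by
    refine (abs_lform_le _ _).trans ?_
    have h5 : ‖u z‖ ≤ ε := hε z hz
    have := mem_Disk.1 hz
    have : ‖z‖ * ‖u z‖ ≤ 1 * ε := by gcongr
    linarith
  have g2 := g1 x hx
  have g3 := g1 y hy
  have g4 : ε * K * ‖x - y‖ ≤ ε * K * 2 := by gcongr
  have g5 : ε ≤ ε * K := le_mul_of_one_le_right hε0 hK1
  rw [abs_le] at hm g2 g3 ⊢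
  constructor <;> linarith [hm.1, hm.2, g2.1, g2.2, g3.1, g3.2]

theorem PseudoRot.integral_iterate {F E : ℂ ≃ₜ ℂ} {l : ℝ → ℝ} {α : ℝ} (h : PseudoRot F E l α)
    {f : SympDiff} (hE : ∀ n, ∀ z ∈ Disk, E^[n] z = f.toFun^[n] z) (A : ℂ → ℝ) (j : ℕ) :
    ∫ z in Disk, A (f.toFun^[j] z) = ∫ z in Disk, A z := by
  have hm : MeasurePreserving (hpow E j) (volume.restrict Disk) (volume.restrict Disk) := by
    have : (hpow E j : ℂ → ℂ) = E^[j] := by funext z; exact hpow_apply E j z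
    rw [this]; exact h.isLift.mp.iterate j
  rw [← hm.integral_comp (hpow E j).measurableEmbedding A]
  refine setIntegral_congr_fun isClosed_closedBall.measurableSet fun z hz => ?_
  rw [hpow_apply, hE j z hz]

theorem restrict_Disk_eq {f : SympDiff} {μ : Measure ℂ} (hμ : IsInvariantCircleMeasure f μ) :
    μ.restrict Disk = μ := by
  refine Measure.restrict_eq_self_of_ae_mem ?_
  have : ∀ᵐ z ∂μ, z ∈ Circ := mem_ae_iff.2 hμ.2.1
  filter_upwards [this] with z hz
  exact sphere_subset_closedBall hz

theorem integral_circle_iterate {f : SympDiff} {E : ℂ ≃ₜ ℂ}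
    (hE : ∀ n, ∀ z ∈ Disk, E^[n] z = f.toFun^[n] z) {μ : Measure ℂ}
    (hμ : IsInvariantCircleMeasure f μ) (A : ℂ → ℝ) (j : ℕ) :
    ∫ z, A (f.toFun^[j] z) ∂μ = ∫ z, A z ∂μ := by
  have hae : ∀ᵐ z ∂μ, z ∈ Disk := by
    have := ae_restrict_mem (μ := μ) (s := Disk) isClosed_closedBall.measurableSet
    rwa [restrict_Disk_eq hμ] at this
  have hmp : MeasurePreserving E μ μ := by
    refine ⟨E.continuous.measurable, ?_⟩
    conv_rhs => rw [← hμ.2.2]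
    refine Measure.map_congr ?_
    filter_upwards [hae] with z hz
    exact hE 1 z hz
  have hm : MeasurePreserving (hpow E j) μ μ := by
    have : (hpow E j : ℂ → ℂ) = E^[j] := by funext z; exact hpow_apply E j z
    rw [this]; exact hmp.iterate j
  rw [← hm.integral_comp (hpow E j).measurableEmbedding A]
  refine integral_congr_ae ?_
  filter_upwards [hae] with z hz
  rw [hpow_apply, hE j z hz]

theorem displacement_le {F E : ℂ ≃ₜ ℂ} {l : ℝ → ℝ} {α : ℝ} (h : PseudoRot F E l α)
    (hirr : Irrational α) {f : SympDiff} (hE : ∀ n, ∀ z ∈ Disk, E^[n] z = f.toFun^[n] z) {q : ℕ}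
    (hq : 1 ≤ q) (p : ℤ) {N : ℕ} (hN : 1 ≤ N) (hNβ : N * |q * α - p| < 1) {K : ℝ} (hK1 : 1 ≤ K)
    (hK : ∀ z ∈ Disk, ‖cD f q z‖ ≤ K) {r : ℝ} (hr : 0 < r) (hrN : 1 < r ^ 2 * N) {x : ℂ}
    (hx : x ∈ Disk) : ‖f.toFun^[q] x - x‖ ≤ 4 * K * r := by
  have hlip : ∀ a ∈ Disk, ∀ b ∈ Disk, ‖f.toFun^[q] a - f.toFun^[q] b‖ ≤ K * ‖a - b‖ :=
    fun a ha b hb => convex_Disk.norm_image_sub_le_of_norm_hasFDerivWithin_le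
      (fun z hz => hasFDerivWithinAt_iterate f q hz) hK hb ha
  have hx1 := mem_Disk.1 hx
  rcases le_or_gt 1 r with h1 | h1
  · have := norm_sub_le (f.toFun^[q] x) x
    have h2 := mem_Disk.1 (iterate_mem f q hx)
    nlinarith
  · set z₀ : ℂ := ((1 - r : ℝ) : ℂ) * x with hz₀
    have hn : ‖z₀‖ ≤ 1 - r := by
      rw [hz₀, norm_mul, Complex.norm_real, Real.norm_of_nonneg (by linarith)]
      nlinarith
    have hsub : ball z₀ r ⊆ ball 0 1 := by
      refine ball_subset_ball' ?_
      rw [dist_zero_right]; linarith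
    have hz₀x : ‖z₀ - x‖ ≤ r := by
      have : z₀ - x = ((-r : ℝ) : ℂ) * x := by rw [hz₀]; push_cast; ring
      rw [this, norm_mul, Complex.norm_real, Real.norm_eq_abs, abs_neg, abs_of_pos hr]
      nlinarith
    by_contra hcon
    push Not at hcon
    have := h.sq_radius_le hirr hq p hN hNβ hr hsub (fun z hz hz' => ?_)
    · linarith
    have hzD : z ∈ Disk := ball_subset_closedBall (hsub hz)
    rw [hE q z hzD, mem_ball, dist_eq_norm] at hz'
    rw [mem_ball, dist_eq_norm] at hz
    have hzx : ‖x - z‖ ≤ 2 * r := by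
      have : x - z = -(z₀ - x) - (z - z₀) := by ring
      rw [this]
      refine (norm_sub_le _ _).trans ?_
      rw [norm_neg]; linarith
    have h3 := hlip x hx z hzD
    have h4 : f.toFun^[q] x - x = (f.toFun^[q] x - f.toFun^[q] z) + (f.toFun^[q] z - z₀) + (z₀ - x) := by
      ring
    have h5 : ‖f.toFun^[q] x - x‖ ≤ K * (2 * r) + r + r := by
      rw [h4]
      refine (norm_add₃_le).trans ?_
      have : K * ‖x - z‖ ≤ K * (2 * r) := by gcongr
      linarith
    nlinarith

/-- The Calabi invariant is controlled by the growth of the derivative at good return times. -/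
theorem mul_abs_integral_le {F E : ℂ ≃ₜ ℂ} {l : ℝ → ℝ} {α : ℝ} (h : PseudoRot F E l α)
    (hirr : Irrational α) {f : SympDiff} (hE : ∀ n, ∀ z ∈ Disk, E^[n] z = f.toFun^[n] z)
    {A : ℂ → ℝ} (hA : IsNormalizedAction f A) {q : ℕ}
    (hq : 1 ≤ q) (p : ℤ) {N : ℕ} (hN : 1 ≤ N) (hNβ : N * |q * α - p| < 1) {K : ℝ} (hK1 : 1 ≤ K)
    (hK : ∀ z ∈ Disk, ‖cD f q z‖ ≤ K) :
    q * |∫ z in Disk, A z| ≤ π * (24 * K ^ 2 / √N) := by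
  obtain ⟨hA1, μ, hμ, hμ0⟩ := hA
  have hN0 : (0 : ℝ) < N := by exact_mod_cast hN
  have hs := Real.sqrt_pos.2 hN0
  set r := 2 / √N with hr
  have hrN : 1 < r ^ 2 * N := by
    rw [hr, div_pow, Real.sq_sqrt hN0.le]
    field_simp; norm_num
  have hε : ∀ z ∈ Disk, ‖f.toFun^[q] z - z‖ ≤ 4 * K * r := fun z hz =>
    displacement_le h hirr hE hq p hN hNβ hK1 hK (by positivity) hrN hz
  have hosc := fun x hx y hy => actSum_sub_le hA1 hK1 hK hε (x := x) (y := y) hx hy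
  have hAc : ∀ j, ContinuousOn (fun z => A (f.toFun^[j] z)) Disk := fun j =>
    hA1.1.continuousOn.comp (continuousOn_iterate f j) (f.mapsTo.iterate j)
  have : IsProbabilityMeasure μ := hμ.1
  have hint1 : ∀ j, Integrable (fun z => A (f.toFun^[j] z)) μ := fun j => by
    have := (hAc j).integrableOn_compact (μ := μ) isCompact_Disk
    rwa [IntegrableOn, restrict_Disk_eq hμ] at this
  have hint2 : ∀ j, Integrable (fun z => A (f.toFun^[j] z)) (volume.restrict Disk) := fun j =>
    (hAc j).integrableOn_compact isCompact_Disk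
  have hi1 : ∫ z, actSum f A q z ∂μ = 0 := by
    simp only [actSum]
    rw [integral_finsetSum _ fun j _ => hint1 j]
    simp [integral_circle_iterate hE hμ, hμ0]
  have hi2 : ∫ z in Disk, actSum f A q z = q * ∫ z in Disk, A z := by
    simp only [actSum]
    rw [integral_finsetSum _ fun j _ => hint2 j]
    simp [h.integral_iterate hE]
  have hI : Integrable (fun z => actSum f A q z) μ := integrable_finsetSum _ fun j _ => hint1 j
  have hae : ∀ᵐ z ∂μ, z ∈ Disk := by
    have := ae_restrict_mem (μ := μ) (s := Disk) isClosed_closedBall.measurableSet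
    rwa [restrict_Disk_eq hμ] at this
  have hsup : ∀ x ∈ Disk, ‖actSum f A q x‖ ≤ 3 * (4 * K * r) * K := by
    intro x hx
    have e : actSum f A q x = ∫ y, (actSum f A q x - actSum f A q y) ∂μ := by
      rw [integral_sub (integrable_const _) hI, hi1]; simp
    rw [e]
    refine (norm_integral_le_of_norm_le_const (C := 3 * (4 * K * r) * K) ?_).trans ?_
    · filter_upwards [hae] with y hy
      exact hosc x hx y hy
    · simp
  have hfin := norm_setIntegral_le_of_norm_le_const (μ := volume) (s := Disk)
    (isCompact_Disk.measure_lt_top) hsup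
  rw [hi2, volume_Disk, norm_mul, Real.norm_eq_abs, Real.norm_eq_abs, Nat.abs_cast] at hfin
  refine hfin.trans (le_of_eq ?_)
  rw [hr]; ring

/-- The standard area form. -/
def om (u v : ℂ) : ℝ := u.re * v.im - u.im * v.re

theorem abs_om_le (u v : ℂ) : |om u v| ≤ ‖u‖ * ‖v‖ := by
  have h : om u v = (starRingEnd ℂ u * v).im := by simp [om]; ring
  have h2 := Complex.abs_im_le_norm (starRingEnd ℂ u * v)
  rwa [norm_mul, Complex.norm_conj, ← h] at h2

theorem om_add_left (u v w : ℂ) : om (u + v) w = om u w + om v w := by simp [om]; ring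
theorem om_add_right (u v w : ℂ) : om u (v + w) = om u v + om u w := by simp [om]; ring
theorem om_sub_left (u v w : ℂ) : om (u - v) w = om u w - om v w := by simp [om]; ring
theorem om_sub_right (u v w : ℂ) : om u (v - w) = om u v - om u w := by simp [om]; ring
theorem om_smul_left (c : ℝ) (u v : ℂ) : om (c * u) v = c * om u v := by simp [om]; ring
theorem om_smul_right (c : ℝ) (u v : ℂ) : om u (c * v) = c * om u v := by simp [om]; ring
theorem om_self (u : ℂ) : om u u = 0 := by simp [om]; ring

theorem om_decomp (u s v : ℂ) : (om u s : ℂ) * v = om v s * u + om u v * s := by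
  apply Complex.ext <;> simp [om] <;> ring

theorem om_map (T : ℂ →L[ℝ] ℂ) (u v : ℂ) : om (T u) (T v) = LinearMap.det T.toLinearMap * om u v := by
  have hd : LinearMap.det T.toLinearMap = om (T 1) (T Complex.I) := by
    rw [← LinearMap.det_toMatrix Complex.basisOneI, Matrix.det_fin_two]
    simp [LinearMap.toMatrix_apply, om, Complex.coe_basisOneI]
    ring
  have hT : ∀ z : ℂ, T z = z.re * T 1 + z.im * T Complex.I := fun z => by
    conv_lhs => rw [show z = z.re • (1 : ℂ) + z.im • Complex.I by simp [Complex.re_add_im]]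
    rw [map_add, map_smul, map_smul]; simp
  rw [hd, hT u, hT v]
  simp [om]; ring

/-- Distance of `i` to the endpoints of `[0, k]`. -/
def mid (k i : ℕ) : ℝ := min (i : ℝ) (k - i)

theorem mid_nonneg {k i : ℕ} (h : i ≤ k) : 0 ≤ mid k i :=
  le_min (Nat.cast_nonneg _) (by have : (i : ℝ) ≤ k := by exact_mod_cast h
                                 linarith)

theorem mid_le_add {k i j : ℕ} (h : i ≤ j) : mid k j ≤ mid k i + (j - i) := by
  have : (i : ℝ) ≤ j := by exact_mod_cast h
  unfold mid
  rcases le_total (i : ℝ) (k - i) with h1 | h1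
  · rw [min_eq_left h1]; exact (min_le_left _ _).trans (by linarith)
  · rw [min_eq_right h1]; exact (min_le_right _ _).trans (by linarith)

theorem mid_le_add' {k i j : ℕ} (h : i ≤ j) : mid k i ≤ mid k j + (j - i) := by
  have : (i : ℝ) ≤ j := by exact_mod_cast h
  unfold mid
  rcases le_total (j : ℝ) (k - j) with h1 | h1
  · rw [min_eq_left h1]; exact (min_le_left _ _).trans (by linarith)
  · rw [min_eq_right h1]; exact (min_le_right _ _).trans (by linarith)

/-- A finite hyperbolic orbit of linear maps, with nonuniform estimates. -/
structure HypSeq (b : ℝ) (k : ℕ) (T : ℕ → ℂ →L[ℝ] ℂ) (u s : ℕ → ℂ) (Δ : ℝ) : Prop where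
  hb : 1000 ≤ b
  hk : 1 ≤ k
  det : ∀ i < k, LinearMap.det (T i).toLinearMap = 1
  hu : ∀ i < k, u (i + 1) = T i (u i)
  hs : ∀ i < k, s (i + 1) = T i (s i)
  hΔ : om (u 0) (s 0) = Δ
  hΔ0 : Δ ≠ 0
  hu0 : ∀ i ≤ k, u i ≠ 0
  hs0 : ∀ i ≤ k, s i ≠ 0
  sr : ∀ i j, j ≤ i → i ≤ k → ‖s i‖ ≤ ‖s j‖ * b ^ (mid k j - 19 * ((i : ℝ) - j))
  ur : ∀ i j, i ≤ j → j ≤ k → ‖u i‖ ≤ ‖u j‖ * b ^ (mid k j - 19 * ((j : ℝ) - i))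
  angle : ∀ j ≤ k, ‖u j‖ * ‖s j‖ ≤ 4 * b ^ (1 + mid k j) * |Δ|
  cross : ‖u k‖ * ‖s 0‖ ≤ 8 * b * |om (u k) (s 0)|

theorem HypSeq.om_eq {b : ℝ} {k : ℕ} {T : ℕ → ℂ →L[ℝ] ℂ} {u s : ℕ → ℂ} {Δ : ℝ}
    (h : HypSeq b k T u s Δ) {i : ℕ} (hi : i ≤ k) : om (u i) (s i) = Δ := by
  induction i with
  | zero => exact h.hΔ
  | succ i ih => rw [h.hu i hi, h.hs i hi, om_map, h.det i hi, one_mul, ih (by omega)]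

theorem rpow_neg_le_half {b : ℝ} (hb : 1000 ≤ b) (n : ℕ) : b ^ (-(15 * (n : ℝ))) ≤ (1 / 2) ^ n := by
  have hb0 : 0 < b := by linarith
  have : b ^ (-(15 : ℝ)) ≤ 1 / 2 := by
    calc b ^ (-(15 : ℝ)) ≤ b ^ (-(1 : ℝ)) :=
          Real.rpow_le_rpow_of_exponent_le (by linarith) (by norm_num)
      _ ≤ 1 / 2 := by
          rw [Real.rpow_neg_one]
          rw [one_div]; exact inv_anti₀ (by norm_num) (by linarith)
  rw [← neg_mul, Real.rpow_mul hb0.le, Real.rpow_natCast]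
  exact pow_le_pow_left₀ (by positivity) this n

variable {b : ℝ} {k : ℕ} {T : ℕ → ℂ →L[ℝ] ℂ} {u s : ℕ → ℂ} {Δ : ℝ}

theorem HypSeq.unstable_term (h : HypSeq b k T u s Δ) {ε : ℝ} {e : ℂ} {i j : ℕ}
    (hij : j ≤ i) (hi : i < k) (he : ‖e‖ ≤ ε * b ^ (-(4 * mid k i))) :
    ‖u j‖ * (‖e‖ * ‖s (i + 1)‖ / |Δ|) ≤ ε * b ^ (-(2 * mid k j)) * ((1 / 2) * (1 / 2) ^ (i - j)) := by
  have hb := h.hb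
  have hb0 : 0 < b := by linarith
  have hb1 : 1 ≤ b := by linarith
  have hΔ : 0 < |Δ| := abs_pos.2 h.hΔ0
  have hε : 0 ≤ ε := by
    have := (norm_nonneg e).trans he
    exact nonneg_of_mul_nonneg_left this (by positivity)
  have h1 := h.sr (i + 1) j (by omega) (by omega)
  have h2 := h.angle j (by omega)
  have h3 := rpow_neg_le_half hb (i - j)
  rw [Nat.cast_sub hij] at h3
  have h4 := mid_le_add' (k := k) hij
  have hm := mid_nonneg (k := k) (i := j) (by omega)
  set n : ℝ := (i : ℝ) - j with hn
  set m := mid k j with hmdef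
  push_cast at h1
  calc ‖u j‖ * (‖e‖ * ‖s (i + 1)‖ / |Δ|)
      ≤ ‖u j‖ * ((ε * b ^ (-(4 * mid k i))) * (‖s j‖ * b ^ (m - 19 * ((i : ℝ) + 1 - j))) / |Δ|) := by
        gcongr
    _ = (‖u j‖ * ‖s j‖) / |Δ| * (ε * (b ^ (-(4 * mid k i)) * b ^ (m - 19 * ((i : ℝ) + 1 - j)))) := by
        ring
    _ ≤ 4 * b ^ (1 + m) * (ε * (b ^ (-(4 * mid k i)) * b ^ (m - 19 * ((i : ℝ) + 1 - j)))) := by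
        gcongr
        rw [div_le_iff₀ hΔ]; exact h2
    _ = 4 * ε * b ^ ((1 + m) + (-(4 * mid k i) + (m - 19 * ((i : ℝ) + 1 - j)))) := by
        rw [Real.rpow_add hb0 (1 + m), Real.rpow_add hb0 (-(4 * mid k i))]; ring
    _ ≤ 4 * ε * b ^ (-(2 * m) + (-1 + -(15 * n))) := by
        refine mul_le_mul_of_nonneg_left
          (Real.rpow_le_rpow_of_exponent_le hb1 ?_) (by positivity)
        rw [hn] at *; linarith
    _ = 4 * ε * b ^ (-(2 * m)) * (b⁻¹ * b ^ (-(15 * n))) := by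
        rw [Real.rpow_add hb0, Real.rpow_add hb0, Real.rpow_neg_one]; ring
    _ ≤ 4 * ε * b ^ (-(2 * m)) * ((1 / 8) * (1 / 2) ^ (i - j)) := by
        gcongr
        rw [one_div]; exact inv_anti₀ (by norm_num) (by linarith)
    _ = _ := by ring

theorem HypSeq.stable_term (h : HypSeq b k T u s Δ) {ε : ℝ} {e : ℂ} {i j : ℕ}
    (hij : i < j) (hj : j ≤ k) (he : ‖e‖ ≤ ε * b ^ (-(4 * mid k i))) :
    ‖s j‖ * (‖e‖ * ‖u (i + 1)‖ / |Δ|) ≤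
      ε * b ^ (-(2 * mid k j)) * (4 * b ^ (5 : ℝ) * (1 / 2) ^ (j - 1 - i)) := by
  have hb := h.hb
  have hb0 : 0 < b := by linarith
  have hb1 : 1 ≤ b := by linarith
  have hΔ : 0 < |Δ| := abs_pos.2 h.hΔ0
  have hε : 0 ≤ ε := by
    have := (norm_nonneg e).trans he
    exact nonneg_of_mul_nonneg_left this (by positivity)
  have h1 := h.ur (i + 1) j (by omega) (by omega)
  have h2 := h.angle j (by omega)
  have h3 := rpow_neg_le_half hb (j - 1 - i)
  rw [Nat.cast_sub (by omega), Nat.cast_sub (by omega)] at h3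
  have h4 := mid_le_add (k := k) hij.le
  set m := mid k j with hmdef
  push_cast at h1 h3
  calc ‖s j‖ * (‖e‖ * ‖u (i + 1)‖ / |Δ|)
      ≤ ‖s j‖ * ((ε * b ^ (-(4 * mid k i))) * (‖u j‖ * b ^ (m - 19 * ((j : ℝ) - (i + 1)))) / |Δ|) := by
        gcongr
    _ = (‖u j‖ * ‖s j‖) / |Δ| * (ε * (b ^ (-(4 * mid k i)) * b ^ (m - 19 * ((j : ℝ) - (i + 1))))) := by
        ring
    _ ≤ 4 * b ^ (1 + m) * (ε * (b ^ (-(4 * mid k i)) * b ^ (m - 19 * ((j : ℝ) - (i + 1))))) := by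
        gcongr
        rw [div_le_iff₀ hΔ]; exact h2
    _ = 4 * ε * b ^ ((1 + m) + (-(4 * mid k i) + (m - 19 * ((j : ℝ) - (i + 1))))) := by
        rw [Real.rpow_add hb0 (1 + m), Real.rpow_add hb0 (-(4 * mid k i))]; ring
    _ ≤ 4 * ε * b ^ (-(2 * m) + (5 + -(15 * ((j : ℝ) - 1 - i)))) := by
        refine mul_le_mul_of_nonneg_left
          (Real.rpow_le_rpow_of_exponent_le hb1 ?_) (by positivity)
        linarith
    _ = 4 * ε * b ^ (-(2 * m)) * (b ^ (5 : ℝ) * b ^ (-(15 * ((j : ℝ) - 1 - i)))) := by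
        rw [Real.rpow_add hb0, Real.rpow_add hb0]; ring
    _ ≤ 4 * ε * b ^ (-(2 * m)) * (b ^ (5 : ℝ) * (1 / 2) ^ (j - 1 - i)) := by
        gcongr
    _ = _ := by ring

/-- A priori estimate for the periodic inhomogeneous linear problem along a hyperbolic orbit. -/
theorem HypSeq.apriori (h : HypSeq b k T u s Δ) {ε : ℝ} {v e : ℕ → ℂ}
    (hv : ∀ i < k, v (i + 1) = T i (v i) + e i)
    (he : ∀ i < k, ‖e i‖ ≤ ε * b ^ (-(4 * mid k i))) (hξ : ‖v 0 - v k‖ ≤ ε) {j : ℕ} (hj : j ≤ k) :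
    ‖v j‖ ≤ b ^ (20 : ℝ) * ε * b ^ (-(2 * mid k j)) := by
  have hb := h.hb
  have hb0 : 0 < b := by linarith
  have hb1 : 1 ≤ b := by linarith
  have hΔ : 0 < |Δ| := abs_pos.2 h.hΔ0
  have hε : 0 ≤ ε := (norm_nonneg _).trans hξ
  set a : ℕ → ℝ := fun i => om (v i) (s i) / Δ with ha
  set c : ℕ → ℝ := fun i => om (u i) (v i) / Δ with hc
  have hdec : ∀ i ≤ k, v i = a i * u i + c i * s i := fun i hi => by
    have := om_decomp (u i) (s i) (v i)
    rw [h.om_eq hi] at this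
    have hd : (Δ : ℂ) ≠ 0 := Complex.ofReal_ne_zero.2 h.hΔ0
    simp only [ha, hc]; push_cast
    field_simp
    linear_combination this
  have ha1 : ∀ i < k, |a (i + 1) - a i| ≤ ‖e i‖ * ‖s (i + 1)‖ / |Δ| := fun i hi => by
    have : a (i + 1) - a i = om (e i) (s (i + 1)) / Δ := by
      simp only [ha]
      rw [hv i hi, om_add_left, h.hs i hi, om_map, h.det i hi]; ring
    rw [this, abs_div]
    gcongr; exact abs_om_le _ _
  have hc1 : ∀ i < k, |c (i + 1) - c i| ≤ ‖e i‖ * ‖u (i + 1)‖ / |Δ| := fun i hi => by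
    have : c (i + 1) - c i = om (u (i + 1)) (e i) / Δ := by
      simp only [hc]
      rw [hv i hi, om_add_right, h.hu i hi, om_map, h.det i hi]; ring
    rw [this, abs_div, mul_comm ‖e i‖]
    gcongr; exact abs_om_le _ _
  have hX : ∀ j ≤ k, ‖u j‖ * |a k - a j| ≤ ε * b ^ (-(2 * mid k j)) := by
    intro j hj
    have e1 : a k - a j = ∑ i ∈ Finset.Ico j k, (a (i + 1) - a i) := by
      rw [Finset.sum_Ico_sub _ hj]
    rw [e1]
    calc ‖u j‖ * |∑ i ∈ Finset.Ico j k, (a (i + 1) - a i)|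
        ≤ ‖u j‖ * ∑ i ∈ Finset.Ico j k, ‖e i‖ * ‖s (i + 1)‖ / |Δ| := by
          gcongr
          refine (Finset.abs_sum_le_sum_abs _ _).trans (Finset.sum_le_sum fun i hi => ?_)
          exact ha1 i (Finset.mem_Ico.1 hi).2
      _ = ∑ i ∈ Finset.Ico j k, ‖u j‖ * (‖e i‖ * ‖s (i + 1)‖ / |Δ|) := Finset.mul_sum _ _ _
      _ ≤ ∑ i ∈ Finset.Ico j k, ε * b ^ (-(2 * mid k j)) * ((1 / 2) * (1 / 2) ^ (i - j)) := by
          refine Finset.sum_le_sum fun i hi => ?_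
          obtain ⟨h1, h2⟩ := Finset.mem_Ico.1 hi
          exact h.unstable_term h1 h2 (he i h2)
      _ = ε * b ^ (-(2 * mid k j)) * ((1 / 2) * ∑ i ∈ Finset.range (k - j), (1 / 2 : ℝ) ^ i) := by
          rw [← Finset.mul_sum, ← Finset.mul_sum, Finset.sum_Ico_eq_sum_range]
          simp
      _ ≤ ε * b ^ (-(2 * mid k j)) * ((1 / 2) * 2) := by
          gcongr; exact sum_geometric_two_le _
      _ = _ := by ring
  have hY : ∀ j ≤ k, ‖s j‖ * |c j - c 0| ≤ ε * b ^ (-(2 * mid k j)) * (8 * b ^ (5 : ℝ)) := by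
    intro j hj
    have e1 : c j - c 0 = ∑ i ∈ Finset.range j, (c (i + 1) - c i) := by
      rw [Finset.sum_range_sub]
    rw [e1]
    calc ‖s j‖ * |∑ i ∈ Finset.range j, (c (i + 1) - c i)|
        ≤ ‖s j‖ * ∑ i ∈ Finset.range j, ‖e i‖ * ‖u (i + 1)‖ / |Δ| := by
          gcongr
          refine (Finset.abs_sum_le_sum_abs _ _).trans (Finset.sum_le_sum fun i hi => ?_)
          exact hc1 i (lt_of_lt_of_le (Finset.mem_range.1 hi) hj)
      _ = ∑ i ∈ Finset.range j, ‖s j‖ * (‖e i‖ * ‖u (i + 1)‖ / |Δ|) := Finset.mul_sum _ _ _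
      _ ≤ ∑ i ∈ Finset.range j, ε * b ^ (-(2 * mid k j)) * (4 * b ^ (5 : ℝ) * (1 / 2) ^ (j - 1 - i)) := by
          refine Finset.sum_le_sum fun i hi => ?_
          have h1 := Finset.mem_range.1 hi
          exact h.stable_term h1 hj (he i (lt_of_lt_of_le h1 hj))
      _ = ε * b ^ (-(2 * mid k j)) * (4 * b ^ (5 : ℝ) * ∑ i ∈ Finset.range j, (1 / 2 : ℝ) ^ i) := by
          rw [← Finset.mul_sum, ← Finset.mul_sum, Finset.sum_range_reflect (fun i => (1 / 2 : ℝ) ^ i)]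
      _ ≤ ε * b ^ (-(2 * mid k j)) * (4 * b ^ (5 : ℝ) * 2) := by
          gcongr; exact sum_geometric_two_le _
      _ = _ := by ring
  have hk0 : mid k k = 0 := by simp [mid]
  have h00 : mid k 0 = 0 := by simp [mid]
  have hX0 := hX 0 (Nat.zero_le _)
  have hYk := hY k le_rfl
  rw [h00, mul_zero, neg_zero, Real.rpow_zero, mul_one] at hX0
  rw [hk0, mul_zero, neg_zero, Real.rpow_zero, mul_one] at hYk
  have hU0 : 0 < ‖u k‖ := norm_pos_iff.2 (h.hu0 k le_rfl)
  have hS0 : 0 < ‖s 0‖ := norm_pos_iff.2 (h.hs0 0 (Nat.zero_le _))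
  set z : ℂ := a k * u k - c 0 * s 0 with hz
  have hω : 0 < |om (u k) (s 0)| := by
    by_contra hcon
    have h1 := h.cross
    rw [le_antisymm (not_lt.1 hcon) (abs_nonneg _), mul_zero] at h1
    exact absurd h1 (not_le.2 (mul_pos hU0 hS0))
  have hak : |a k| * ‖u k‖ ≤ 8 * b * ‖z‖ := by
    have e1 : om z (s 0) = a k * om (u k) (s 0) := by
      rw [hz, om_sub_left, om_smul_left, om_smul_left, om_self]; ring
    have e2 := abs_om_le z (s 0)
    rw [e1, abs_mul] at e2
    have e3 := h.cross
    have e4 : |a k| * ‖u k‖ * ‖s 0‖ ≤ 8 * b * ‖z‖ * ‖s 0‖ :=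
      calc |a k| * ‖u k‖ * ‖s 0‖ = |a k| * (‖u k‖ * ‖s 0‖) := by ring
        _ ≤ |a k| * (8 * b * |om (u k) (s 0)|) := by gcongr
        _ = 8 * b * (|a k| * |om (u k) (s 0)|) := by ring
        _ ≤ 8 * b * (‖z‖ * ‖s 0‖) := by gcongr
        _ = _ := by ring
    exact le_of_mul_le_mul_right e4 hS0
  have hc0 : |c 0| * ‖s 0‖ ≤ 8 * b * ‖z‖ := by
    have e1 : om (u k) z = - (c 0 * om (u k) (s 0)) := by
      rw [hz, om_sub_right, om_smul_right, om_smul_right, om_self]; ring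
    have e2 := abs_om_le (u k) z
    rw [e1, abs_neg, abs_mul] at e2
    have e3 := h.cross
    have e4 : |c 0| * ‖s 0‖ * ‖u k‖ ≤ 8 * b * ‖z‖ * ‖u k‖ :=
      calc |c 0| * ‖s 0‖ * ‖u k‖ = |c 0| * (‖u k‖ * ‖s 0‖) := by ring
        _ ≤ |c 0| * (8 * b * |om (u k) (s 0)|) := by gcongr
        _ = 8 * b * (|c 0| * |om (u k) (s 0)|) := by ring
        _ ≤ 8 * b * (‖u k‖ * ‖z‖) := by gcongr
        _ = _ := by ring
    exact le_of_mul_le_mul_right e4 hU0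
  have hkR : (1 : ℝ) ≤ k := by exact_mod_cast h.hk
  have hUj : ∀ j ≤ k, |a k| * ‖u j‖ ≤ 8 * b * ‖z‖ * b ^ (-(19 * ((k : ℝ) - j))) := fun j hj => by
    have := h.ur j k hj le_rfl
    rw [hk0, zero_sub] at this
    calc |a k| * ‖u j‖ ≤ |a k| * (‖u k‖ * b ^ (-(19 * ((k : ℝ) - j)))) := by gcongr
      _ = |a k| * ‖u k‖ * b ^ (-(19 * ((k : ℝ) - j))) := by ring
      _ ≤ _ := by gcongr
  have hSj : ∀ j ≤ k, |c 0| * ‖s j‖ ≤ 8 * b * ‖z‖ * b ^ (-(19 * (j : ℝ))) := fun j hj => by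
    have := h.sr j 0 (Nat.zero_le _) hj
    rw [h00, zero_sub, Nat.cast_zero, sub_zero] at this
    calc |c 0| * ‖s j‖ ≤ |c 0| * (‖s 0‖ * b ^ (-(19 * (j : ℝ)))) := by gcongr
      _ = |c 0| * ‖s 0‖ * b ^ (-(19 * (j : ℝ))) := by ring
      _ ≤ _ := by gcongr
  have hsmall : 8 * b * b ^ (-(19 * (k : ℝ))) ≤ 1 / 4 := by
    calc 8 * b * b ^ (-(19 * (k : ℝ))) ≤ 8 * b * b ^ (-(2 : ℝ)) :=
          mul_le_mul_of_nonneg_left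
            (Real.rpow_le_rpow_of_exponent_le hb1 (by linarith)) (by positivity)
      _ = 8 * b⁻¹ := by
          rw [Real.rpow_neg hb0.le, Real.rpow_two]; field_simp
      _ ≤ 8 * (1000 : ℝ)⁻¹ := by gcongr
      _ ≤ _ := by norm_num
  have hzb : ‖z‖ ≤ 20 * b ^ (5 : ℝ) * ε := by
    have hv0 := hdec 0 (Nat.zero_le _)
    have hvk := hdec k le_rfl
    have e1 : z = a k * u 0 - (a k - a 0 : ℝ) * u 0 - c 0 * s k - (c k - c 0 : ℝ) * s k -
        (v 0 - v k) := by
      rw [hz, hv0, hvk]; push_cast; ring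
    have n1 : ‖z‖ ≤ |a k| * ‖u 0‖ + ‖u 0‖ * |a k - a 0| + |c 0| * ‖s k‖ + ‖s k‖ * |c k - c 0| + ε := by
      rw [e1]
      refine (norm_sub_le _ _).trans (add_le_add ?_ hξ)
      refine (norm_sub_le _ _).trans (add_le_add ?_ ?_)
      · refine (norm_sub_le _ _).trans (add_le_add ?_ ?_)
        · refine (norm_sub_le _ _).trans (add_le_add ?_ ?_)
          · rw [norm_mul, Complex.norm_real, Real.norm_eq_abs]
          · rw [norm_mul, Complex.norm_real, Real.norm_eq_abs, mul_comm]
        · rw [norm_mul, Complex.norm_real, Real.norm_eq_abs]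
      · rw [norm_mul, Complex.norm_real, Real.norm_eq_abs, mul_comm]
    have n2 := hUj 0 (Nat.zero_le _)
    have n3 := hSj k le_rfl
    rw [Nat.cast_zero, sub_zero] at n2
    have n4 : 8 * b * ‖z‖ * b ^ (-(19 * (k : ℝ))) ≤ 1 / 4 * ‖z‖ := by
      calc _ = 8 * b * b ^ (-(19 * (k : ℝ))) * ‖z‖ := by ring
        _ ≤ _ := by gcongr
    have n5 : ε ≤ b ^ (5 : ℝ) * ε := le_mul_of_one_le_left hε (Real.one_le_rpow hb1 (by norm_num))
    linarith
  have hw : ∀ x : ℝ, mid k j ≤ x → b ^ (-(19 * x)) ≤ b ^ (-(2 * mid k j)) := fun x hx =>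
    Real.rpow_le_rpow_of_exponent_le hb1 (by have := mid_nonneg hj; linarith)
  set w := b ^ (-(2 * mid k j)) with hwd
  have hw0 : 0 ≤ w := by positivity
  have f1 : |a k| * ‖u j‖ ≤ 8 * b * ‖z‖ * w := (hUj j hj).trans (by
    gcongr; exact hw _ (min_le_right _ _))
  have f2 : |c 0| * ‖s j‖ ≤ 8 * b * ‖z‖ * w := (hSj j hj).trans (by
    gcongr; exact hw _ (min_le_left _ _))
  have f3 : v j = a k * u j - (a k - a j : ℝ) * u j + c 0 * s j + (c j - c 0 : ℝ) * s j := by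
    conv_lhs => rw [hdec j hj]
    push_cast; ring
  have f4 : ‖v j‖ ≤ |a k| * ‖u j‖ + ‖u j‖ * |a k - a j| + |c 0| * ‖s j‖ + ‖s j‖ * |c j - c 0| := by
    rw [f3]
    refine (norm_add_le _ _).trans (add_le_add ?_ ?_)
    · refine (norm_add_le _ _).trans (add_le_add ?_ ?_)
      · refine (norm_sub_le _ _).trans (add_le_add ?_ ?_)
        · rw [norm_mul, Complex.norm_real, Real.norm_eq_abs]
        · rw [norm_mul, Complex.norm_real, Real.norm_eq_abs, mul_comm]
      · rw [norm_mul, Complex.norm_real, Real.norm_eq_abs]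
    · rw [norm_mul, Complex.norm_real, Real.norm_eq_abs, mul_comm]
  have g1 := hX j hj
  have g2 := hY j hj
  have g3 : 8 * b * ‖z‖ * w ≤ 8 * b * (20 * b ^ (5 : ℝ) * ε) * w := by gcongr
  have hpow : b ^ (20 : ℝ) = b ^ (5 : ℝ) * b * b * b ^ (13 : ℝ) := by
    rw [show (20 : ℝ) = 5 + 1 + 1 + 13 by norm_num, Real.rpow_add hb0, Real.rpow_add hb0,
      Real.rpow_add hb0, Real.rpow_one]
  have h13 : 1 ≤ b ^ (13 : ℝ) := Real.one_le_rpow hb1 (by norm_num)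
  have h5 : 1 ≤ b ^ (5 : ℝ) := Real.one_le_rpow hb1 (by norm_num)
  set B := b ^ (5 : ℝ) with hB
  have hεw : 0 ≤ ε * w := by positivity
  have hbig : 1 + 8 * B + 320 * (b * B) ≤ b ^ (20 : ℝ) := by
    rw [hpow]
    have i1 : B * b * b ≤ B * b * b * b ^ (13 : ℝ) := le_mul_of_one_le_right (by positivity) h13
    have i2 : 1000 * (B * b) ≤ B * b * b := by nlinarith [mul_pos (lt_of_lt_of_le one_pos h5) hb0]
    have i3 : B ≤ B * b := le_mul_of_one_le_right (by positivity) hb1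
    nlinarith
  calc ‖v j‖ ≤ (1 + 8 * B + 320 * (b * B)) * (ε * w) := by linarith
    _ ≤ b ^ (20 : ℝ) * (ε * w) := by gcongr
    _ = _ := by ring

/-- Nearest point projection to the unit disk. -/
def proj (y : ℂ) : ℂ := ((max 1 ‖y‖)⁻¹ : ℝ) * y

theorem proj_mem (y : ℂ) : proj y ∈ Disk := by
  have h : 0 < max 1 ‖y‖ := lt_of_lt_of_le one_pos (le_max_left _ _)
  rw [mem_Disk, proj, norm_mul, Complex.norm_real, Real.norm_eq_abs, abs_of_pos (inv_pos.2 h),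
    inv_mul_le_one₀ h]
  exact le_max_right _ _

theorem proj_of_mem {y : ℂ} (hy : y ∈ Disk) : proj y = y := by
  rw [proj, max_eq_left (mem_Disk.1 hy)]; simp

theorem proj_inner_le (y : ℂ) {z : ℂ} (hz : z ∈ Disk) : inner ℝ (y - proj y) (z - proj y) ≤ (0 : ℝ) := by
  by_cases hy : y ∈ Disk
  · rw [proj_of_mem hy]; simp
  · rw [mem_Disk, not_le] at hy
    have hz := mem_Disk.1 hz
    have hp : proj y = (‖y‖⁻¹ : ℝ) • y := by
      rw [proj, max_eq_right hy.le]; simp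
    have e1 : y - proj y = (1 - ‖y‖⁻¹) • y := by rw [hp, sub_smul, one_smul]
    rw [e1, real_inner_smul_left, inner_sub_right, hp, real_inner_smul_right,
      real_inner_self_eq_norm_sq]
    have h1 : 0 ≤ 1 - ‖y‖⁻¹ := sub_nonneg.2 (inv_le_one_of_one_le₀ hy.le)
    have h2 : ‖y‖⁻¹ * ‖y‖ ^ 2 = ‖y‖ := by field_simp
    have h3 : inner ℝ y z ≤ ‖y‖ * ‖z‖ := real_inner_le_norm _ _
    rw [h2]
    refine mul_nonpos_of_nonneg_of_nonpos h1 ?_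
    nlinarith

theorem norm_sub_proj_le (y : ℂ) {z : ℂ} (hz : z ∈ Disk) : ‖y - proj y‖ ≤ ‖y - z‖ := by
  have h := proj_inner_le y hz
  have h1 : y - z = (y - proj y) - (z - proj y) := by ring
  have h2 := norm_sub_sq_real (y - proj y) (z - proj y)
  rw [← h1] at h2
  refine le_of_sq_le_sq ?_ (norm_nonneg _) |> fun h => h
  nlinarith [sq_nonneg ‖z - proj y‖]

theorem norm_proj_sub_le (y y' : ℂ) : ‖proj y - proj y'‖ ≤ ‖y - y'‖ := by
  have h := proj_inner_le y (proj_mem y')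
  have h' := proj_inner_le y' (proj_mem y)
  have e : inner ℝ (y - proj y) (proj y' - proj y) + inner ℝ (y' - proj y') (proj y - proj y') =
      ‖proj y - proj y'‖ ^ 2 - inner ℝ (y - y') (proj y - proj y') := by
    rw [← real_inner_self_eq_norm_sq]
    simp only [inner_sub_left, inner_sub_right]
    ring
  have h1 : inner ℝ (y - y') (proj y - proj y') ≤ ‖y - y'‖ * ‖proj y - proj y'‖ :=
    real_inner_le_norm _ _
  rcases (norm_nonneg (proj y - proj y')).eq_or_lt with h0 | h0
  · rw [← h0]; exact norm_nonneg _
  · nlinarith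

theorem norm_proj_sub_le' (y : ℂ) {x : ℂ} (hx : x ∈ Disk) : ‖proj y - x‖ ≤ ‖y - x‖ := by
  have := norm_proj_sub_le y x
  rwa [proj_of_mem hx] at this

/-- First order extension of a map of the disk to the plane. -/
def extD (g : ℂ → ℂ) (g' : ℂ → ℂ →L[ℝ] ℂ) (y : ℂ) : ℂ := g (proj y) + g' (proj y) (y - proj y)

theorem extD_of_mem (g : ℂ → ℂ) (g' : ℂ → ℂ →L[ℝ] ℂ) {y : ℂ} (hy : y ∈ Disk) : extD g g' y = g y := by
  simp [extD, proj_of_mem hy]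

variable {g : ℂ → ℂ} {g' : ℂ → ℂ →L[ℝ] ℂ} {Q : ℝ}

theorem norm_sub_sub_le_of_lip (hg : ∀ z ∈ Disk, HasFDerivWithinAt g (g' z) Disk z)
    (hQ : ∀ z ∈ Disk, ∀ w ∈ Disk, ‖g' z - g' w‖ ≤ Q * ‖z - w‖) (hQ0 : 0 ≤ Q)
    {x p p' : ℂ} (hx : x ∈ Disk) (hp : p ∈ Disk) (hp' : p' ∈ Disk) {m : ℝ}
    (h1 : ‖p - x‖ ≤ m) (h2 : ‖p' - x‖ ≤ m) :
    ‖g p - g p' - g' x (p - p')‖ ≤ Q * m * ‖p - p'‖ := by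
  have hc : Convex ℝ (Disk ∩ closedBall x m) := convex_Disk.inter (convex_closedBall _ _)
  refine hc.norm_image_sub_le_of_norm_hasFDerivWithin_le' (f' := g')
    (fun z hz => (hg z hz.1).mono inter_subset_left) (fun z hz => ?_)
    ⟨hp', by rwa [mem_closedBall, dist_eq_norm]⟩ ⟨hp, by rwa [mem_closedBall, dist_eq_norm]⟩
  refine (hQ z hz.1 x hx).trans ?_
  gcongr
  have := hz.2
  rwa [mem_closedBall, dist_eq_norm] at this

theorem extD_approx (hg : ∀ z ∈ Disk, HasFDerivWithinAt g (g' z) Disk z)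
    (hQ : ∀ z ∈ Disk, ∀ w ∈ Disk, ‖g' z - g' w‖ ≤ Q * ‖z - w‖) (hQ0 : 0 ≤ Q)
    {x y y' : ℂ} (hx : x ∈ Disk) {m : ℝ} (h1 : ‖y - x‖ ≤ m) (h2 : ‖y' - x‖ ≤ m) :
    ‖extD g g' y - extD g g' y' - g' x (y - y')‖ ≤ 4 * Q * m * ‖y - y'‖ := by
  have hp := proj_mem y
  have hp' := proj_mem y'
  have hm : 0 ≤ m := (norm_nonneg _).trans h1
  have k1 := (norm_proj_sub_le' y hx).trans h1
  have k2 := (norm_proj_sub_le' y' hx).trans h2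
  have k3 := norm_proj_sub_le y y'
  have k4 := (norm_sub_proj_le y' hx).trans h2
  have a1 := norm_sub_sub_le_of_lip hg hQ hQ0 hx hp hp' k1 k2
  have e : extD g g' y - extD g g' y' - g' x (y - y') =
      (g (proj y) - g (proj y') - g' x (proj y - proj y')) +
      (g' (proj y) - g' x) ((y - y') - (proj y - proj y')) +
      (g' (proj y) - g' (proj y')) (y' - proj y') := by
    simp only [extD, map_sub, sub_apply]; ring
  rw [e]
  have b1 : ‖(g' (proj y) - g' x) ((y - y') - (proj y - proj y'))‖ ≤ (Q * m) * (2 * ‖y - y'‖) := by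
    refine (ContinuousLinearMap.le_opNorm _ _).trans ?_
    refine mul_le_mul ((hQ _ hp _ hx).trans (by gcongr)) ?_ (norm_nonneg _) (by positivity)
    exact (norm_sub_le _ _).trans (by linarith)
  have b2 : ‖(g' (proj y) - g' (proj y')) (y' - proj y')‖ ≤ (Q * ‖y - y'‖) * m := by
    refine (ContinuousLinearMap.le_opNorm _ _).trans ?_
    exact mul_le_mul ((hQ _ hp _ hp').trans (by gcongr)) k4 (norm_nonneg _) (by positivity)
  have b0 : ‖g (proj y) - g (proj y') - g' x (proj y - proj y')‖ ≤ Q * m * ‖y - y'‖ :=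
    a1.trans (by gcongr)
  calc _ ≤ Q * m * ‖y - y'‖ + (Q * m) * (2 * ‖y - y'‖) + (Q * ‖y - y'‖) * m :=
        (norm_add_le _ _).trans (add_le_add ((norm_add_le _ _).trans (add_le_add b0 b1)) b2)
    _ = _ := by ring

/-- Closing lemma along a nonuniformly hyperbolic finite orbit. -/
theorem exists_periodic_of_hypSeq (hg : ∀ z ∈ Disk, HasFDerivWithinAt g (g' z) Disk z)
    (hQ : ∀ z ∈ Disk, ∀ w ∈ Disk, ‖g' z - g' w‖ ≤ Q * ‖z - w‖) (hQ0 : 0 ≤ Q)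
    {b : ℝ} {k : ℕ} {x u s : ℕ → ℂ} {Δ : ℝ} (hx : ∀ i, x i ∈ Disk) (hxg : ∀ i, x (i + 1) = g (x i))
    (h : HypSeq b k (fun i => g' (x i)) u s Δ) {r : ℝ} (hr : 0 < r)
    (hr1 : 8 * Q * r * b ^ (20 : ℝ) ≤ 1) (hclose : ‖x 0 - x k‖ * (2 * b ^ (20 : ℝ)) ≤ r) :
    ∃ y : ℂ, ‖y - x 0‖ ≤ r ∧ (extD g g')^[k] y = y := by
  have hb := h.hb
  have hb0 : 0 < b := by linarith
  have hb1 : 1 ≤ b := by linarith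
  set W : ℕ → ℝ := fun i => b ^ (-(2 * mid k i)) with hW
  have hW0 : ∀ i, 0 < W i := fun i => Real.rpow_pos_of_pos hb0 _
  have hW1 : ∀ i ≤ k, W i ≤ 1 := fun i hi =>
    Real.rpow_le_one_of_one_le_of_nonpos hb1 (by have := mid_nonneg hi; linarith)
  have hWsq : ∀ i, W i ^ 2 = b ^ (-(4 * mid k i)) := fun i => by
    rw [hW, ← Real.rpow_natCast, ← Real.rpow_mul hb0.le]; congr 1; push_cast; ring
  have hWk : W k = 1 := by simp [hW, mid]
  have hWz : W 0 = 1 := by simp [hW, mid]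
  let ix : ℕ → Fin (k + 1) := fun i => Fin.ofNat (k + 1) i
  have hix : ∀ i (hi : i ≤ k), ix i = ⟨i, by omega⟩ := fun i hi => by
    apply Fin.ext; simp [ix, Fin.ofNat, Nat.mod_eq_of_lt (by omega : i < k + 1)]
  let ξ : (Fin (k + 1) → ℂ) → ℕ → ℂ := fun ζ i => (W i : ℂ) * ζ (ix i)
  let Φ : (Fin (k + 1) → ℂ) → (Fin (k + 1) → ℂ) := fun ζ i => if (i : ℕ) < k then
      ((W i ^ 2)⁻¹ : ℝ) * (x (i + 1) + ξ ζ (i + 1) - extD g g' (x i + ξ ζ i))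
    else x 0 + ξ ζ 0 - x k - ξ ζ k
  let Lf : (Fin (k + 1) → ℂ) →ₗ[ℝ] (Fin (k + 1) → ℂ) :=
    { toFun := fun ζ i => if (i : ℕ) < k then
        ((W i ^ 2)⁻¹ : ℝ) * (ξ ζ (i + 1) - g' (x i) (ξ ζ i)) else ξ ζ 0 - ξ ζ k
      map_add' := fun ζ ζ' => by
        funext i
        have e : ∀ j, ξ (ζ + ζ') j = ξ ζ j + ξ ζ' j := fun j => by simp [ξ, mul_add]
        simp only [Pi.add_apply, e, map_add]
        split_ifs <;> ring
      map_smul' := fun c ζ => by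
        funext i
        have e : ∀ j, ξ (c • ζ) j = c • ξ ζ j := fun j => by simp [ξ]; ring
        simp only [Pi.smul_apply, e, map_smul, RingHom.id_apply]
        split_ifs <;> simp only [Complex.real_smul] <;> ring }
  have hLf : ∀ ζ i, Lf ζ i = if (i : ℕ) < k then
        ((W i ^ 2)⁻¹ : ℝ) * (ξ ζ (i + 1) - g' (x i) (ξ ζ i)) else ξ ζ 0 - ξ ζ k := fun _ _ => rfl
  have hξn : ∀ ζ i, ‖ξ ζ i‖ ≤ W i * ‖ζ‖ := fun ζ i => by
    simp only [ξ]; rw [norm_mul, Complex.norm_real, Real.norm_eq_abs, abs_of_pos (hW0 i)]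
    exact mul_le_mul_of_nonneg_left (norm_le_pi_norm ζ _) (hW0 i).le
  have hbound : ∀ ζ, ‖ζ‖ ≤ b ^ (20 : ℝ) * ‖Lf ζ‖ := fun ζ => by
    refine (pi_norm_le_iff_of_nonneg (by positivity)).2 fun j => ?_
    have hj : (j : ℕ) ≤ k := by omega
    have ap := h.apriori (ε := ‖Lf ζ‖) (v := ξ ζ) (e := fun i => ξ ζ (i + 1) - g' (x i) (ξ ζ i))
      (fun i _ => by ring) (fun i hi => ?_) ?_ hj
    · have : ‖ξ ζ j‖ = W j * ‖ζ j‖ := by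
        simp only [ξ]; rw [norm_mul, Complex.norm_real, Real.norm_eq_abs, abs_of_pos (hW0 _), hix _ hj]
      rw [this, mul_comm (W j)] at ap
      exact le_of_mul_le_mul_right ap (hW0 j)
    · have := norm_le_pi_norm (Lf ζ) ⟨i, by omega⟩
      rw [hLf, if_pos hi, norm_mul, Complex.norm_real, Real.norm_eq_abs,
        abs_of_pos (inv_pos.2 (pow_pos (hW0 _) 2)), inv_mul_le_iff₀ (pow_pos (hW0 _) 2)] at this
      rw [← hWsq, mul_comm]; exact this
    · have := norm_le_pi_norm (Lf ζ) ⟨k, by omega⟩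
      rwa [hLf, if_neg (by simp)] at this
  have hinj : Function.Injective Lf := by
    rw [← LinearMap.ker_eq_bot, LinearMap.ker_eq_bot']
    intro ζ hζ
    have := hbound ζ
    rw [hζ, norm_zero, mul_zero] at this
    exact norm_le_zero_iff.1 this
  let Le : (Fin (k + 1) → ℂ) ≃ₗ[ℝ] (Fin (k + 1) → ℂ) := LinearEquiv.ofInjectiveEndo Lf hinj
  have hLe : ∀ ζ, Lf (Le.symm ζ) = ζ := fun ζ => LinearEquiv.apply_symm_apply Le ζ
  let Lc : (Fin (k + 1) → ℂ) →L[ℝ] (Fin (k + 1) → ℂ) := LinearMap.toContinuousLinearMap Lf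
  let R : Lc.NonlinearRightInverse :=
    { toFun := fun ζ => Le.symm ζ
      nnnorm := ⟨b ^ (20 : ℝ), by positivity⟩
      bound' := fun ζ => by
        have := hbound (Le.symm ζ)
        rwa [hLe] at this
      right_inv' := fun ζ => hLe ζ }
  have happ : ApproximatesLinearOn Φ Lc (closedBall 0 r) ⟨4 * Q * r, by positivity⟩ := by
    intro ζ hζ ζ' hζ'
    rw [mem_closedBall, dist_zero_right] at hζ hζ'
    show ‖_‖ ≤ (4 * Q * r) * _
    refine (pi_norm_le_iff_of_nonneg (by positivity)).2 fun i => ?_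
    have eL : Lc (ζ - ζ') i = Lf ζ i - Lf ζ' i := by
      show Lf (ζ - ζ') i = _
      rw [map_sub, Pi.sub_apply]
    rw [Pi.sub_apply, Pi.sub_apply, eL, hLf, hLf]
    simp only [Φ]
    split_ifs with hi
    · have e : ((W i ^ 2)⁻¹ : ℝ) * (x (i + 1) + ξ ζ (i + 1) - extD g g' (x i + ξ ζ i)) -
          ((W i ^ 2)⁻¹ : ℝ) * (x (i + 1) + ξ ζ' (i + 1) - extD g g' (x i + ξ ζ' i)) -
          (((W i ^ 2)⁻¹ : ℝ) * (ξ ζ (i + 1) - g' (x i) (ξ ζ i)) -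
          ((W i ^ 2)⁻¹ : ℝ) * (ξ ζ' (i + 1) - g' (x i) (ξ ζ' i))) =
          -(((W i ^ 2)⁻¹ : ℝ) * (extD g g' (x i + ξ ζ i) - extD g g' (x i + ξ ζ' i) -
            g' (x i) ((x i + ξ ζ i) - (x i + ξ ζ' i)))) := by
        rw [show (x i + ξ ζ i) - (x i + ξ ζ' i) = ξ ζ i - ξ ζ' i by ring, map_sub]; ring
      rw [e, norm_neg, norm_mul, Complex.norm_real, Real.norm_eq_abs,
        abs_of_pos (inv_pos.2 (pow_pos (hW0 _) 2)), inv_mul_le_iff₀ (pow_pos (hW0 _) 2)]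
      have b1 : ‖(x i + ξ ζ i) - x i‖ ≤ W i * r := by
        rw [add_sub_cancel_left]
        exact (hξn ζ i).trans (mul_le_mul_of_nonneg_left hζ (hW0 _).le)
      have b2 : ‖(x i + ξ ζ' i) - x i‖ ≤ W i * r := by
        rw [add_sub_cancel_left]
        exact (hξn ζ' i).trans (mul_le_mul_of_nonneg_left hζ' (hW0 _).le)
      refine (extD_approx hg hQ hQ0 (hx i) b1 b2).trans ?_
      have b3 : ‖(x i + ξ ζ i) - (x i + ξ ζ' i)‖ ≤ W i * ‖ζ - ζ'‖ := by
        rw [show (x i + ξ ζ i) - (x i + ξ ζ' i) = ξ (ζ - ζ') i by simp [ξ]; ring]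
        exact hξn _ _
      calc _ ≤ 4 * Q * (W i * r) * (W i * ‖ζ - ζ'‖) := by
            refine mul_le_mul_of_nonneg_left b3 ?_
            have := hW0 i
            positivity
        _ = _ := by ring
    · rw [show x 0 + ξ ζ 0 - x k - ξ ζ k - (x 0 + ξ ζ' 0 - x k - ξ ζ' k) -
          (ξ ζ 0 - ξ ζ k - (ξ ζ' 0 - ξ ζ' k)) = 0 by ring, norm_zero]
      positivity
  have hE0 : 0 < b ^ (20 : ℝ) := by positivity
  have hsurj := happ.surjOn_closedBall_of_nonlinearRightInverse R hr.le (b := 0) subset_rfl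
  have hmem : (0 : (Fin (k + 1) → ℂ)) ∈ closedBall (Φ 0) (((R.nnnorm : ℝ)⁻¹ - ((⟨4 * Q * r, by positivity⟩ : NNReal) : ℝ)) * r) := by
    rw [mem_closedBall, dist_zero_left]
    show ‖Φ 0‖ ≤ ((b ^ (20 : ℝ))⁻¹ - 4 * Q * r) * r
    have k1 : (2 * b ^ (20 : ℝ))⁻¹ ≤ (b ^ (20 : ℝ))⁻¹ - 4 * Q * r := by
      have : 4 * Q * r ≤ (2 * b ^ (20 : ℝ))⁻¹ := by
        rw [← one_div, le_div_iff₀ (by positivity)]; linarith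
      have e : (b ^ (20 : ℝ))⁻¹ = (2 * b ^ (20 : ℝ))⁻¹ + (2 * b ^ (20 : ℝ))⁻¹ := by
        field_simp; norm_num
      linarith
    have k2 : ‖x 0 - x k‖ ≤ (2 * b ^ (20 : ℝ))⁻¹ * r := by
      rw [mul_comm, ← div_eq_mul_inv, le_div_iff₀ (by positivity)]; exact hclose
    refine le_trans ?_ (mul_le_mul_of_nonneg_right k1 hr.le)
    refine (pi_norm_le_iff_of_nonneg (by positivity)).2 fun i => ?_
    have e0 : ∀ j, ξ 0 j = 0 := fun j => by simp [ξ]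
    simp only [Φ, e0, add_zero, sub_zero]
    split_ifs with hi
    · rw [extD_of_mem _ _ (hx _), hxg, sub_self, mul_zero, norm_zero]; positivity
    · exact k2
  obtain ⟨ζ, hζ, hΦ⟩ := hsurj hmem
  rw [mem_closedBall, dist_zero_right] at hζ
  have horb : ∀ i ≤ k, (extD g g')^[i] (x 0 + ξ ζ 0) = x i + ξ ζ i := by
    intro i
    induction i with
    | zero => intro _; rfl
    | succ i ih =>
      intro hi
      rw [Function.iterate_succ_apply', ih (by omega)]
      have := congrFun hΦ ⟨i, by omega⟩
      simp only [Φ, Pi.zero_apply] at this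
      rw [if_pos (by simpa using hi)] at this
      have hne : ((W i ^ 2)⁻¹ : ℝ) ≠ 0 := (inv_pos.2 (pow_pos (hW0 _) 2)).ne'
      have h2 := (mul_eq_zero.1 this).resolve_left (Complex.ofReal_ne_zero.2 hne)
      exact (sub_eq_zero.1 h2).symm
  refine ⟨x 0 + ξ ζ 0, ?_, ?_⟩
  · rw [add_sub_cancel_left]
    exact (hξn ζ 0).trans (by rw [hWz, one_mul]; exact hζ)
  · rw [horb k le_rfl]
    have := congrFun hΦ ⟨k, by omega⟩
    simp only [Φ, Pi.zero_apply] at this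
    rw [if_neg (by simp)] at this
    linear_combination -this

open Classical in
theorem card_forward_bad_le {D : ℕ → ℝ} (hD : ∀ i, 0 ≤ D i) {c : ℝ} (hc : 0 < c) (M : ℕ) :
    (((Finset.range M).filter fun a => ∃ n : ℕ, a + n ≤ M ∧ n * c < ∑ i ∈ Finset.Ico a (a + n), D i).card : ℝ) * c
      ≤ ∑ i ∈ Finset.range M, D i := by
  set P : ℕ → Prop := fun a => ∃ n : ℕ, a + n ≤ M ∧ n * c < ∑ i ∈ Finset.Ico a (a + n), D i with hP
  have key : ∀ m a, a + m = M → (((Finset.Ico a M).filter P).card : ℝ) * c ≤ ∑ i ∈ Finset.Ico a M, D i := by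
    intro m
    induction m using Nat.strong_induction_on with
    | _ m ih =>
      intro a ha
      rcases Nat.eq_zero_or_pos m with rfl | hm
      · rw [show a = M by omega]; simp
      by_cases hPa : P a
      · obtain ⟨n, h1, h2⟩ := hPa
        have hn : n ≠ 0 := by rintro rfl; simp at h2
        have h3 := ih (m - n) (by omega) (a + n) (by omega)
        rw [← Finset.sum_Ico_consecutive _ (Nat.le_add_right a n) h1]
        have h4 : ((Finset.Ico a M).filter P).card ≤ n + ((Finset.Ico (a + n) M).filter P).card := by
          rw [← Finset.Ico_union_Ico_eq_Ico (Nat.le_add_right a n) h1, Finset.filter_union]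
          refine (Finset.card_union_le _ _).trans (Nat.add_le_add_right ?_ _)
          refine (Finset.card_filter_le _ _).trans (by simp)
        have h5 : (((Finset.Ico a M).filter P).card : ℝ) ≤ n + ((Finset.Ico (a + n) M).filter P).card := by
          exact_mod_cast h4
        nlinarith
      · have h3 := ih (m - 1) (by omega) (a + 1) (by omega)
        have h4 : (Finset.Ico a M).filter P = (Finset.Ico (a + 1) M).filter P := by
          ext j
          simp only [Finset.mem_filter, Finset.mem_Ico]
          constructor
          · rintro ⟨⟨h, h'⟩, hj⟩
            refine ⟨⟨?_, h'⟩, hj⟩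
            rcases h.eq_or_lt with rfl | h
            · exact absurd hj hPa
            · exact h
          · rintro ⟨⟨h, h'⟩, hj⟩
            exact ⟨⟨by omega, h'⟩, hj⟩
        rw [h4]
        refine h3.trans (Finset.sum_le_sum_of_subset_of_nonneg ?_ fun i _ _ => hD i)
        exact Finset.Ico_subset_Ico_left (by omega)
  have := key M 0 (by omega)
  rwa [← Finset.range_eq_Ico] at this

open Classical in
theorem card_backward_bad_le {D : ℕ → ℝ} (hD : ∀ i, 0 ≤ D i) {c : ℝ} (hc : 0 < c) (M : ℕ) :
    (((Finset.range M).filter fun a => ∃ n : ℕ, n ≤ a ∧ n * c < ∑ i ∈ Finset.Ico (a - n) a, D i).card : ℝ) * c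
      ≤ ∑ i ∈ Finset.range M, D i := by
  set P : ℕ → Prop := fun a => ∃ n : ℕ, n ≤ a ∧ n * c < ∑ i ∈ Finset.Ico (a - n) a, D i with hP
  have key : ∀ a, (((Finset.range (a + 1)).filter P).card : ℝ) * c ≤ ∑ i ∈ Finset.range a, D i := by
    intro a
    induction a using Nat.strong_induction_on with
    | _ a ih =>
      by_cases hPa : P a
      · obtain ⟨n, h1, h2⟩ := hPa
        have hn : n ≠ 0 := by rintro rfl; simp at h2
        have h3 := ih (a - n) (by omega)
        have h4 : ((Finset.range (a + 1)).filter P).card ≤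
            ((Finset.range (a - n + 1)).filter P).card + n := by
          rw [Finset.range_eq_Ico, ← Finset.Ico_union_Ico_eq_Ico (Nat.zero_le (a - n + 1)) (by omega :
            a - n + 1 ≤ a + 1), Finset.filter_union, ← Finset.range_eq_Ico]
          refine (Finset.card_union_le _ _).trans (Nat.add_le_add_left ?_ _)
          refine (Finset.card_filter_le _ _).trans (by simp; omega)
        have h5 : (((Finset.range (a + 1)).filter P).card : ℝ) ≤
            ((Finset.range (a - n + 1)).filter P).card + n := by exact_mod_cast h4
        have h6 : ∑ i ∈ Finset.range a, D i = ∑ i ∈ Finset.range (a - n), D i +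
            ∑ i ∈ Finset.Ico (a - n) a, D i := by
          rw [Finset.sum_range_add_sum_Ico _ (by omega)]
        rw [h6]
        nlinarith
      · have h4 : (Finset.range (a + 1)).filter P = (Finset.range a).filter P := by
          rw [Finset.range_add_one, Finset.filter_insert, if_neg hPa]
        rw [h4]
        rcases Nat.eq_zero_or_pos a with rfl | ha
        · simp
        · have h3 := ih (a - 1) (by omega)
          rw [Nat.sub_add_cancel ha] at h3
          refine h3.trans (Finset.sum_le_sum_of_subset_of_nonneg ?_ fun i _ _ => hD i)
          exact Finset.range_mono (by omega)
  refine le_trans ?_ (key M)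
  have : ((Finset.range M).filter P).card ≤ ((Finset.range (M + 1)).filter P).card :=
    Finset.card_le_card (Finset.filter_subset_filter _ (Finset.range_mono (by omega)))
  have : (((Finset.range M).filter P).card : ℝ) ≤ ((Finset.range (M + 1)).filter P).card := by
    exact_mod_cast this
  exact mul_le_mul_of_nonneg_right this hc.le

/-- Number of cells of a grid of mesh `1 / R` meeting the square `[-1, 1] × [-1, 1]`. -/
def cell (R : ℝ) (z : ℂ) : ℤ × ℤ := (⌊z.re * R⌋, ⌊z.im * R⌋)

theorem norm_sub_le_of_cell_eq {R : ℝ} (hR : 0 < R) {z w : ℂ} (h : cell R z = cell R w) :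
    ‖z - w‖ ≤ 2 / R := by
  have h1 := (Prod.ext_iff.1 h).1
  have h2 := (Prod.ext_iff.1 h).2
  have a1 := Int.abs_sub_lt_one_of_floor_eq_floor h1
  have a2 := Int.abs_sub_lt_one_of_floor_eq_floor h2
  rw [← sub_mul, abs_mul, abs_of_pos hR] at a1 a2
  have := Complex.norm_le_abs_re_add_abs_im (z - w)
  rw [Complex.sub_re, Complex.sub_im] at this
  refine this.trans ?_
  rw [le_div_iff₀ hR]
  linarith

theorem cell_mem {R : ℝ} (hR : 0 < R) {z : ℂ} (h : ‖z‖ ≤ 1) :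
    cell R z ∈ (Finset.Icc ⌊-R⌋ ⌊R⌋) ×ˢ (Finset.Icc ⌊-R⌋ ⌊R⌋) := by
  have h1 := abs_le.1 ((Complex.abs_re_le_norm z).trans h)
  have h2 := abs_le.1 ((Complex.abs_im_le_norm z).trans h)
  simp only [cell, Finset.mem_product, Finset.mem_Icc]
  refine ⟨⟨?_, ?_⟩, ?_, ?_⟩ <;> apply Int.floor_le_floor <;> nlinarith

theorem card_cells_le {R : ℝ} (hR : 2 ≤ R) : ((Finset.Icc ⌊-R⌋ ⌊R⌋).card : ℝ) ≤ 3 * R := by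
  rw [Int.card_Icc]
  have h0 : ⌊-R⌋ ≤ ⌊R⌋ := Int.floor_le_floor (by linarith)
  have h1 : (((⌊R⌋ + 1 - ⌊-R⌋).toNat : ℤ) : ℝ) = (⌊R⌋ + 1 - ⌊-R⌋ : ℝ) := by
    rw [Int.toNat_of_nonneg (by omega)]; push_cast; ring
  rw [← Int.cast_natCast, h1]
  have h2 := Int.floor_le R
  have h3 := Int.sub_one_lt_floor (-R)
  have : (⌊-R⌋ : ℝ) ≥ -R - 1 := h3.le
  linarith

/-- Two of sufficiently many pairs of points of the disk are close. -/
theorem exists_close_pair {R : ℝ} (hR : 2 ≤ R) (G : Finset ℕ) (x y : ℕ → ℂ)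
    (hx : ∀ i, ‖x i‖ ≤ 1) (hy : ∀ i, ‖y i‖ ≤ 1) (hG : (3 * R) ^ 4 < G.card) :
    ∃ a ∈ G, ∃ a' ∈ G, a < a' ∧ ‖x a - x a'‖ ≤ 2 / R ∧ ‖y a - y a'‖ ≤ 2 / R := by
  have hR0 : 0 < R := by linarith
  set S := (Finset.Icc ⌊-R⌋ ⌊R⌋) ×ˢ (Finset.Icc ⌊-R⌋ ⌊R⌋) with hS
  have hcard : (S ×ˢ S).card < G.card := by
    have h1 := card_cells_le hR
    have : ((S ×ˢ S).card : ℝ) < G.card := by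
      refine lt_of_le_of_lt ?_ hG
      rw [Finset.card_product, hS, Finset.card_product]
      push_cast
      calc _ = ((Finset.Icc ⌊-R⌋ ⌊R⌋).card : ℝ) ^ 4 := by ring
        _ ≤ _ := pow_le_pow_left₀ (by positivity) h1 4
    exact_mod_cast this
  obtain ⟨a, ha, a', ha', hne, he⟩ := Finset.exists_ne_map_eq_of_card_lt_of_maps_to hcard
    (f := fun i => (cell R (x i), cell R (y i)))
    (fun i _ => Finset.mem_product.2 ⟨cell_mem hR0 (hx i), cell_mem hR0 (hy i)⟩)
  have h1 := norm_sub_le_of_cell_eq hR0 (Prod.ext_iff.1 he).1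
  have h2 := norm_sub_le_of_cell_eq hR0 (Prod.ext_iff.1 he).2
  rcases lt_or_gt_of_ne hne with h | h
  · exact ⟨a, ha, a', ha', h, h1, h2⟩
  · refine ⟨a', ha', a, ha, h, ?_, ?_⟩ <;> rw [norm_sub_rev] <;> assumption

theorem norm_le_of_det_one {T : ℂ →L[ℝ] ℂ} (hT : LinearMap.det T.toLinearMap = 1) {K : ℝ} (hK : ‖T‖ ≤ K)
    (v : ℂ) : ‖v‖ ≤ K * ‖T v‖ := by
  have h1 : om (T v) (T (Complex.I * v)) = ‖v‖ ^ 2 := by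
    rw [om_map, hT, one_mul, Complex.sq_norm, Complex.normSq_apply]; simp [om]
  have h2 := abs_om_le (T v) (T (Complex.I * v))
  rw [h1, abs_of_nonneg (by positivity)] at h2
  have h3 : ‖T (Complex.I * v)‖ ≤ K * ‖v‖ := by
    refine (T.le_opNorm _).trans ?_
    rw [norm_mul, Complex.norm_I, one_mul]; gcongr
  rcases (norm_nonneg v).eq_or_lt with h0 | h0
  · rw [← h0]; have := (norm_nonneg T).trans hK; positivity
  · have : ‖v‖ * ‖v‖ ≤ K * ‖T v‖ * ‖v‖ := by
      calc ‖v‖ * ‖v‖ = ‖v‖ ^ 2 := by ring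
        _ ≤ ‖T v‖ * ‖T (Complex.I * v)‖ := h2
        _ ≤ ‖T v‖ * (K * ‖v‖) := by gcongr
        _ = _ := by ring
    exact le_of_mul_le_mul_right this h0

theorem four_mul_om_sq {u s : ℂ} (hu : ‖u‖ = 1) (hs : ‖s‖ = 1) :
    (2 * om u s) ^ 2 = ‖u - s‖ ^ 2 * ‖u + s‖ ^ 2 := by
  have h1 : u.re * u.re + u.im * u.im = 1 := by
    rw [← Complex.normSq_apply, ← Complex.sq_norm, hu]; norm_num
  have h2 : s.re * s.re + s.im * s.im = 1 := by
    rw [← Complex.normSq_apply, ← Complex.sq_norm, hs]; norm_num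
  rw [Complex.sq_norm, Complex.sq_norm, Complex.normSq_apply, Complex.normSq_apply]
  simp only [om, Complex.sub_re, Complex.sub_im, Complex.add_re, Complex.add_im]
  have e1 : (u.re - s.re) * (u.re - s.re) + (u.im - s.im) * (u.im - s.im) =
    2 - 2 * (u.re * s.re + u.im * s.im) := by linear_combination h1 + h2
  have e2 : (u.re + s.re) * (u.re + s.re) + (u.im + s.im) * (u.im + s.im) =
    2 + 2 * (u.re * s.re + u.im * s.im) := by linear_combination h1 + h2
  rw [e1, e2]
  linear_combination 4 * h1 * (s.re * s.re + s.im * s.im) + 4 * h2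

/-- A vector that is expanded and a vector that is contracted make a definite angle. -/
theorem angle_of_expansion {T : ℂ →L[ℝ] ℂ} {b : ℝ} (hb : 1000 ≤ b) (hT : ‖T‖ ≤ b ^ 20)
    {u s : ℂ} (hu0 : u ≠ 0) (hs0 : s ≠ 0) (hu : b ^ 19 * ‖u‖ ≤ ‖T u‖) (hs : ‖T s‖ ≤ ‖s‖) :
    ‖u‖ * ‖s‖ ≤ 4 * b * |om u s| := by
  have hb0 : 0 < b := by linarith
  have hun : 0 < ‖u‖ := norm_pos_iff.2 hu0
  have hsn : 0 < ‖s‖ := norm_pos_iff.2 hs0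
  set u1 : ℂ := (‖u‖⁻¹ : ℝ) * u with hu1
  set s1 : ℂ := (‖s‖⁻¹ : ℝ) * s with hs1
  have nu : ‖u1‖ = 1 := by
    rw [hu1, norm_mul, Complex.norm_real, norm_inv, norm_norm, inv_mul_cancel₀ hun.ne']
  have ns : ‖s1‖ = 1 := by
    rw [hs1, norm_mul, Complex.norm_real, norm_inv, norm_norm, inv_mul_cancel₀ hsn.ne']
  have Tu : b ^ 19 ≤ ‖T u1‖ := by
    rw [hu1, ← Complex.real_smul, map_smul, norm_smul, norm_inv, norm_norm, ← div_eq_inv_mul,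
      le_div_iff₀ hun]; exact hu
  have Ts : ‖T s1‖ ≤ 1 := by
    rw [hs1, ← Complex.real_smul, map_smul, norm_smul, norm_inv, norm_norm, ← div_eq_inv_mul,
      div_le_one hsn]; exact hs
  have hb19 : 2 ≤ b ^ 19 := by
    calc (2 : ℝ) ≤ b := by linarith
      _ ≤ b ^ 19 := le_self_pow₀ (by linarith) (by norm_num)
  have hm : 1 ≤ 2 * b * ‖u1 - s1‖ := by
    have h1 : b ^ 19 - 1 ≤ b ^ 20 * ‖u1 - s1‖ := by
      have := T.le_opNorm (u1 - s1)
      rw [map_sub] at this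
      have h2 := norm_sub_norm_le (T u1) (T s1)
      have h3 : ‖T‖ * ‖u1 - s1‖ ≤ b ^ 20 * ‖u1 - s1‖ := by gcongr
      linarith
    have h4 : b ^ 19 * 1 ≤ b ^ 19 * (2 * b * ‖u1 - s1‖) := by
      have : b ^ 19 * (2 * b * ‖u1 - s1‖) = 2 * (b ^ 20 * ‖u1 - s1‖) := by ring
      linarith
    exact le_of_mul_le_mul_left h4 (by positivity)
  have hp : 1 ≤ 2 * b * ‖u1 + s1‖ := by
    have h1 : b ^ 19 - 1 ≤ b ^ 20 * ‖u1 + s1‖ := by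
      have := T.le_opNorm (u1 + s1)
      rw [map_add] at this
      have h2 := norm_sub_le_norm_add (T u1) (T s1)
      have h3 : ‖T‖ * ‖u1 + s1‖ ≤ b ^ 20 * ‖u1 + s1‖ := by gcongr
      linarith
    have h4 : b ^ 19 * 1 ≤ b ^ 19 * (2 * b * ‖u1 + s1‖) := by
      have : b ^ 19 * (2 * b * ‖u1 + s1‖) = 2 * (b ^ 20 * ‖u1 + s1‖) := by ring
      linarith
    exact le_of_mul_le_mul_left h4 (by positivity)
  have hsum : 2 ≤ ‖u1 - s1‖ + ‖u1 + s1‖ := by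
    have := norm_add_le (u1 - s1) (u1 + s1)
    rw [show u1 - s1 + (u1 + s1) = (2 : ℂ) * u1 by ring, norm_mul, nu] at this
    simpa using this
  have hom : 1 ≤ 4 * b * |om u1 s1| := by
    have h1 := four_mul_om_sq nu ns
    have h2 : |2 * om u1 s1| = ‖u1 - s1‖ * ‖u1 + s1‖ := by
      rw [← abs_of_nonneg (by positivity : 0 ≤ ‖u1 - s1‖ * ‖u1 + s1‖)]
      rw [← sq_eq_sq_iff_abs_eq_abs, h1]; ring
    rw [abs_mul, abs_two] at h2
    rcases le_total ‖u1 - s1‖ ‖u1 + s1‖ with h | h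
    · have : 1 ≤ ‖u1 + s1‖ := by linarith
      nlinarith [norm_nonneg (u1 - s1), mul_nonneg hb0.le (norm_nonneg (u1 - s1))]
    · have : 1 ≤ ‖u1 - s1‖ := by linarith
      nlinarith [norm_nonneg (u1 + s1), mul_nonneg hb0.le (norm_nonneg (u1 + s1))]
  have e : om u1 s1 = ‖u‖⁻¹ * (‖s‖⁻¹ * om u s) := by
    rw [hu1, hs1, om_smul_left, om_smul_right]
  rw [e, abs_mul, abs_mul, abs_inv, abs_inv, abs_norm, abs_norm] at hom
  have h5 : ‖u‖ * ‖s‖ * 1 ≤ ‖u‖ * ‖s‖ * (4 * b * (‖u‖⁻¹ * (‖s‖⁻¹ * |om u s|))) := by gcongr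
  have h6 : ‖u‖ * ‖s‖ * (4 * b * (‖u‖⁻¹ * (‖s‖⁻¹ * |om u s|))) = 4 * b * |om u s| := by
    field_simp
  rwa [h6, mul_one] at h5

theorem le_mul_rpow_of_log_le {b x y t : ℝ} (hb : 0 < b) (hx : 0 < x) (hy : 0 < y)
    (h : Real.log x ≤ Real.log y + t * Real.log b) : x ≤ y * b ^ t := by
  have h1 : 0 < b ^ t := Real.rpow_pos_of_pos hb t
  rw [← Real.log_le_log_iff hx (by positivity), Real.log_mul hy.ne' h1.ne', Real.log_rpow hb]
  exact h

theorem exists_apply_eq_of_det_one {T : ℂ →L[ℝ] ℂ} (hT : LinearMap.det T.toLinearMap = 1) (w : ℂ) :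
    ∃ v, T v = w := by
  have hu : IsUnit (LinearMap.det T.toLinearMap) := by rw [hT]; exact isUnit_one
  exact ((Module.End.isUnit_iff _).1 ((LinearMap.isUnit_iff_isUnit_det _).2 hu)).2 w

/-- The data of a finite orbit with an expanded and a contracted vector field, and defects `D`. -/
structure DefectOrbit (b : ℝ) (M : ℕ) (T : ℕ → ℂ →L[ℝ] ℂ) (u s : ℕ → ℂ) (D : ℕ → ℝ) : Prop where
  hb : 1000 ≤ b
  det : ∀ i, LinearMap.det (T i).toLinearMap = 1
  bd : ∀ i, ‖T i‖ ≤ b ^ 20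
  hu : ∀ i, u (i + 1) = T i (u i)
  hs : ∀ i, s (i + 1) = T i (s i)
  hu0 : ∀ i, u i ≠ 0
  hs0 : ∀ i, s i ≠ 0
  hD : ∀ i, D i = 40 * Real.log b - (Real.log ‖u (i + 1)‖ - Real.log ‖u i‖) +
    (Real.log ‖s (i + 1)‖ - Real.log ‖s i‖)

namespace DefectOrbit

variable {b : ℝ} {M : ℕ} {T : ℕ → ℂ →L[ℝ] ℂ} {u s : ℕ → ℂ} {D : ℕ → ℝ}

theorem b_pos (h : DefectOrbit b M T u s D) : 0 < b := by have := h.hb; linarith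

theorem log_pos (h : DefectOrbit b M T u s D) : 0 < Real.log b :=
  Real.log_pos (by have := h.hb; linarith)

theorem u_step (h : DefectOrbit b M T u s D) (i : ℕ) :
    Real.log ‖u (i + 1)‖ ≤ Real.log ‖u i‖ + 20 * Real.log b := by
  have hb := h.b_pos
  have h0 := norm_pos_iff.2 (h.hu0 i)
  have h1 := norm_pos_iff.2 (h.hu0 (i + 1))
  have : ‖u (i + 1)‖ ≤ b ^ 20 * ‖u i‖ := by
    rw [h.hu]; exact (T i).le_of_opNorm_le (h.bd i) _
  have := Real.log_le_log h1 this
  rw [Real.log_mul (by positivity) h0.ne', Real.log_pow] at this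
  push_cast at this; linarith

theorem s_step (h : DefectOrbit b M T u s D) (i : ℕ) :
    Real.log ‖s i‖ ≤ Real.log ‖s (i + 1)‖ + 20 * Real.log b := by
  have hb := h.b_pos
  have h0 := norm_pos_iff.2 (h.hs0 i)
  have h1 := norm_pos_iff.2 (h.hs0 (i + 1))
  have : ‖s i‖ ≤ b ^ 20 * ‖s (i + 1)‖ := by
    rw [h.hs]; exact norm_le_of_det_one (h.det i) (h.bd i) _
  have := Real.log_le_log h0 this
  rw [Real.log_mul (by positivity) h1.ne', Real.log_pow] at this
  push_cast at this; linarith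

theorem D_nonneg (h : DefectOrbit b M T u s D) (i : ℕ) : 0 ≤ D i := by
  rw [h.hD]; linarith [h.u_step i, h.s_step i]

theorem u_growth (h : DefectOrbit b M T u s D) {i j : ℕ} (hij : i ≤ j) :
    Real.log ‖u i‖ + 20 * ((j : ℝ) - i) * Real.log b ≤ Real.log ‖u j‖ + ∑ l ∈ Finset.Ico i j, D l := by
  induction j, hij using Nat.le_induction with
  | base => simp
  | succ j hj ih =>
    rw [Finset.sum_Ico_succ_top hj, h.hD j]
    push_cast
    linarith [h.s_step j]

theorem s_growth (h : DefectOrbit b M T u s D) {i j : ℕ} (hij : i ≤ j) :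
    Real.log ‖s j‖ + 20 * ((j : ℝ) - i) * Real.log b ≤ Real.log ‖s i‖ + ∑ l ∈ Finset.Ico i j, D l := by
  induction j, hij using Nat.le_induction with
  | base => simp
  | succ j hj ih =>
    rw [Finset.sum_Ico_succ_top hj, h.hD j]
    push_cast
    linarith [h.u_step j]

theorem us_growth (h : DefectOrbit b M T u s D) {i j : ℕ} (hij : i ≤ j) :
    Real.log ‖u j‖ + Real.log ‖s j‖ ≤ Real.log ‖u i‖ + Real.log ‖s i‖ + ∑ l ∈ Finset.Ico i j, D l := by
  induction j, hij using Nat.le_induction with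
  | base => simp
  | succ j hj ih =>
    rw [Finset.sum_Ico_succ_top hj, h.hD j]
    linarith [h.u_step j]

theorem us_growth' (h : DefectOrbit b M T u s D) {i j : ℕ} (hij : i ≤ j) :
    Real.log ‖u i‖ + Real.log ‖s i‖ ≤ Real.log ‖u j‖ + Real.log ‖s j‖ + ∑ l ∈ Finset.Ico i j, D l := by
  induction j, hij using Nat.le_induction with
  | base => simp
  | succ j hj ih =>
    rw [Finset.sum_Ico_succ_top hj, h.hD j]
    linarith [h.s_step j]

theorem sum_mono (h : DefectOrbit b M T u s D) {i j i' j' : ℕ} (hi : i' ≤ i) (hj : j ≤ j') :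
    ∑ l ∈ Finset.Ico i j, D l ≤ ∑ l ∈ Finset.Ico i' j', D l :=
  Finset.sum_le_sum_of_subset_of_nonneg (Finset.Ico_subset_Ico hi hj) fun l _ _ => h.D_nonneg l

theorem angle (h : DefectOrbit b M T u s D) {a : ℕ} (ha : D a ≤ Real.log b) :
    ‖u a‖ * ‖s a‖ ≤ 4 * b * |om (u a) (s a)| := by
  have hb := h.b_pos
  have hb1000 := h.hb
  have h1 := h.u_growth (Nat.le_succ a)
  have h2 := h.s_growth (Nat.le_succ a)
  have hl := h.log_pos
  simp only [Nat.succ_eq_add_one, Nat.Ico_succ_singleton, Finset.sum_singleton] at h1 h2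
  push_cast at h1 h2
  have u0 := norm_pos_iff.2 (h.hu0 a)
  have u1 := norm_pos_iff.2 (h.hu0 (a + 1))
  have s0 := norm_pos_iff.2 (h.hs0 a)
  have s1 := norm_pos_iff.2 (h.hs0 (a + 1))
  refine angle_of_expansion h.hb (h.bd a) (h.hu0 a) (h.hs0 a) ?_ ?_
  · rw [← h.hu, ← Real.log_le_log_iff (by positivity) u1, Real.log_mul (by positivity) u0.ne',
      Real.log_pow]
    push_cast; linarith
  · rw [← h.hs, ← Real.log_le_log_iff s1 s0]; linarith

theorem om_eq (h : DefectOrbit b M T u s D) (i : ℕ) : om (u i) (s i) = om (u 0) (s 0) := by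
  induction i with
  | zero => rfl
  | succ i ih => rw [h.hu i, h.hs i, om_map, h.det i, one_mul, ih]

/-- Two good times at which the stable directions are close bound a hyperbolic orbit segment. -/
theorem hypSeq (h : DefectOrbit b M T u s D) {a k : ℕ} (hk : 1 ≤ k)
    (hf : ∀ n, n ≤ k → ∑ l ∈ Finset.Ico a (a + n), D l ≤ n * Real.log b)
    (hbk : ∀ n, n ≤ k → ∑ l ∈ Finset.Ico (a + n) (a + k), D l ≤ ((k : ℝ) - n) * Real.log b)
    (hlast : D (a + k) ≤ Real.log b)
    (hclose : ‖(‖s a‖⁻¹ : ℝ) * s a - (‖s (a + k)‖⁻¹ : ℝ) * s (a + k)‖ * (8 * b) ≤ 1) :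
    HypSeq b k (fun i => T (a + i)) (fun i => u (a + i)) (fun i => s (a + i)) (om (u a) (s a)) := by
  have hb := h.b_pos
  have hb1000 := h.hb
  have hl := h.log_pos
  have un : ∀ i, 0 < ‖u i‖ := fun i => norm_pos_iff.2 (h.hu0 i)
  have sn : ∀ i, 0 < ‖s i‖ := fun i => norm_pos_iff.2 (h.hs0 i)
  have hS1 : ∀ i j, i ≤ j → j ≤ k → ∑ l ∈ Finset.Ico (a + i) (a + j), D l ≤ j * Real.log b :=
    fun i j hij hj => (h.sum_mono (by omega) le_rfl).trans (hf j hj)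
  have hS2 : ∀ i j, i ≤ j → j ≤ k → ∑ l ∈ Finset.Ico (a + i) (a + j), D l ≤ ((k : ℝ) - i) * Real.log b :=
    fun i j hij hj => (h.sum_mono le_rfl (by omega)).trans (hbk i (by omega))
  have hfirst : D a ≤ Real.log b := by
    have := hf 1 hk
    simpa using this
  have ang0 := h.angle hfirst
  have angk := h.angle hlast
  have hom : ∀ i, om (u i) (s i) = om (u a) (s a) := fun i => by rw [h.om_eq i, h.om_eq a]
  have hΔ : 0 < |om (u a) (s a)| := by
    have := mul_pos (un a) (sn a)
    by_contra hcon
    rw [le_antisymm (not_lt.1 hcon) (abs_nonneg _), mul_zero] at ang0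
    linarith
  refine ⟨h.hb, hk, fun i _ => h.det _, fun i _ => h.hu _, fun i _ => h.hs _, rfl, abs_pos.1 hΔ,
    fun i _ => h.hu0 _, fun i _ => h.hs0 _, ?_, ?_, ?_, ?_⟩
  · intro i j hji hi
    refine le_mul_rpow_of_log_le hb (sn _) (sn _) ?_
    have h1 := h.s_growth (Nat.add_le_add_left hji a)
    have h2 := hS1 j i hji hi
    have h3 := hS2 j i hji hi
    push_cast at h1
    have hR : (j : ℝ) ≤ i := by exact_mod_cast hji
    unfold mid
    rcases le_total (j : ℝ) (k - j) with hm | hm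
    · rw [min_eq_left hm]; nlinarith
    · rw [min_eq_right hm]; nlinarith
  · intro i j hij hj
    refine le_mul_rpow_of_log_le hb (un _) (un _) ?_
    have h1 := h.u_growth (Nat.add_le_add_left hij a)
    have h2 := hS1 i j hij hj
    have h3 := hS2 i j hij hj
    push_cast at h1
    have hR : (i : ℝ) ≤ j := by exact_mod_cast hij
    unfold mid
    rcases le_total (j : ℝ) (k - j) with hm | hm
    · rw [min_eq_left hm]; nlinarith
    · rw [min_eq_right hm]; nlinarith
  · intro j hj
    have h1 := h.us_growth (Nat.le_add_right a j)
    have h2 := h.us_growth' (Nat.add_le_add_left hj a)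
    have h3 := hf j hj
    have h4 := hbk j hj
    have l0 := Real.log_le_log (mul_pos (un _) (sn _)) ang0
    have lk := Real.log_le_log (mul_pos (un _) (sn _)) angk
    rw [hom (a + k)] at lk
    rw [Real.log_mul (un _).ne' (sn _).ne', Real.log_mul (by positivity) hΔ.ne'] at l0 lk
    have e : 4 * b ^ (1 + mid k j) * |om (u a) (s a)| = (4 * b * |om (u a) (s a)|) * b ^ mid k j := by
      rw [Real.rpow_add hb, Real.rpow_one]; ring
    rw [e]
    refine le_mul_rpow_of_log_le hb (mul_pos (un _) (sn _)) (by positivity) ?_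
    rw [Real.log_mul (un _).ne' (sn _).ne', Real.log_mul (by positivity) hΔ.ne']
    unfold mid
    rcases le_total (j : ℝ) (k - j) with hm | hm
    · rw [min_eq_left hm]; linarith
    · rw [min_eq_right hm]; linarith
  · set s0 : ℂ := (‖s a‖⁻¹ : ℝ) * s a with hs0
    set sk : ℂ := (‖s (a + k)‖⁻¹ : ℝ) * s (a + k) with hsk
    have e0 : om (u (a + k)) s0 = ‖s a‖⁻¹ * om (u (a + k)) (s a) := by rw [hs0, om_smul_right]
    have ek : om (u (a + k)) sk = ‖s (a + k)‖⁻¹ * om (u (a + k)) (s (a + k)) := by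
      rw [hsk, om_smul_right]
    have k1 : ‖u (a + k)‖ ≤ 4 * b * |om (u (a + k)) sk| := by
      rw [ek, abs_mul, abs_inv, abs_norm]
      have := sn (a + k)
      field_simp
      linarith
    have k2 : |om (u (a + k)) sk| ≤ |om (u (a + k)) s0| + ‖u (a + k)‖ * ‖s0 - sk‖ := by
      have e1 : om (u (a + k)) sk = om (u (a + k)) s0 - om (u (a + k)) (s0 - sk) := by
        rw [om_sub_right]; ring
      rw [e1]
      exact (abs_sub _ _).trans (add_le_add le_rfl (abs_om_le _ _))
    have k3 : ‖u (a + k)‖ ≤ 8 * b * |om (u (a + k)) s0| := by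
      have h1 := mul_le_mul_of_nonneg_left k2 (by positivity : 0 ≤ 4 * b)
      have h2 := mul_le_mul_of_nonneg_left hclose (un (a + k)).le
      nlinarith
    rw [e0, abs_mul, abs_inv, abs_norm] at k3
    have h5 := mul_le_mul_of_nonneg_right k3 (sn a).le
    have h6 : 8 * b * (‖s a‖⁻¹ * |om (u (a + k)) (s a)|) * ‖s a‖ = 8 * b * |om (u (a + k)) (s a)| := by
      have := (sn a).ne'
      field_simp
    rw [h6] at h5
    simpa using h5

end DefectOrbit

variable {g : ℂ → ℂ} {g' : ℂ → ℂ →L[ℝ] ℂ} {Q b : ℝ}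

/-- A `C^{1,1}` area preserving map of the disk whose derivative is moderate at the origin and on
the boundary. -/
structure TameMap (g : ℂ → ℂ) (g' : ℂ → ℂ →L[ℝ] ℂ) (b : ℝ) : Prop where
  hb : 1000 ≤ b
  deriv : ∀ z ∈ Disk, HasFDerivWithinAt g (g' z) Disk z
  lip : ∀ z ∈ Disk, ∀ w ∈ Disk, ‖g' z - g' w‖ ≤ b ^ 80 * ‖z - w‖
  maps : MapsTo g Disk Disk
  det : ∀ z ∈ Disk, LinearMap.det (g' z).toLinearMap = 1
  bd : ∀ z ∈ Disk, ‖g' z‖ ≤ b ^ 20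
  tame : ∀ p, p = 0 ∨ ‖p‖ = 1 → ‖(g' (g p)).comp (g' p)‖ ≤ b ^ 30

namespace TameMap

theorem far_of_expansion (h : TameMap g g' b) {x p : ℂ} (hx : x ∈ Disk) (hp : p = 0 ∨ ‖p‖ = 1)
    {v : ℂ} (hv : v ≠ 0) (hexp : b ^ 38 * ‖v‖ ≤ ‖g' (g x) (g' x v)‖) : (b ^ 120)⁻¹ < ‖x - p‖ := by
  have hb := h.hb
  have hb0 : 0 < b := by linarith
  by_contra! hcon
  have hpD : p ∈ Disk := by
    rw [mem_Disk]; rcases hp with rfl | hp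
    · simp
    · exact hp.le
  have hgl : ‖g x - g p‖ ≤ b ^ 20 * ‖x - p‖ :=
    convex_Disk.norm_image_sub_le_of_norm_hasFDerivWithin_le h.deriv h.bd hpD hx
  have h1 : ‖g' (g x) - g' (g p)‖ ≤ b ^ 80 * (b ^ 20 * ‖x - p‖) :=
    (h.lip _ (h.maps hx) _ (h.maps hpD)).trans (by gcongr)
  have h2 := h.lip _ hx _ hpD
  have e : (g' (g x)).comp (g' x) = (g' (g x) - g' (g p)).comp (g' x) +
      (g' (g p)).comp (g' x - g' p) + (g' (g p)).comp (g' p) := by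
    ext w <;> simp
  have h3 : ‖(g' (g x)).comp (g' x)‖ ≤ (b ^ 80 * (b ^ 20 * ‖x - p‖)) * b ^ 20 +
      b ^ 20 * (b ^ 80 * ‖x - p‖) + b ^ 30 := by
    rw [e]
    refine (norm_add_le _ _).trans (add_le_add ((norm_add_le _ _).trans (add_le_add ?_ ?_))
      (h.tame p hp))
    · refine (ContinuousLinearMap.opNorm_comp_le _ _).trans ?_
      exact mul_le_mul h1 (h.bd _ hx) (norm_nonneg _) (by positivity)
    · refine (ContinuousLinearMap.opNorm_comp_le _ _).trans ?_
      exact mul_le_mul (h.bd _ (h.maps hpD)) h2 (norm_nonneg _) (by positivity)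
  have h4 : (b ^ 80 * (b ^ 20 * ‖x - p‖)) * b ^ 20 ≤ 1 := by
    calc _ = b ^ 120 * ‖x - p‖ := by ring
      _ ≤ b ^ 120 * (b ^ 120)⁻¹ := by gcongr
      _ = 1 := by field_simp
  have h5 : b ^ 20 * (b ^ 80 * ‖x - p‖) ≤ 1 := by
    refine le_trans ?_ h4
    have : 1 ≤ b ^ 20 := one_le_pow₀ (by linarith)
    calc b ^ 20 * (b ^ 80 * ‖x - p‖) = (b ^ 80 * (b ^ 20 * ‖x - p‖)) * 1 := by ring
      _ ≤ _ := by gcongr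
  have h6 : b ^ 38 * ‖v‖ ≤ ‖(g' (g x)).comp (g' x)‖ * ‖v‖ :=
    hexp.trans (((g' (g x)).comp (g' x)).le_opNorm v)
  have h7 := le_of_mul_le_mul_right h6 (norm_pos_iff.2 hv)
  have h8 : 1 ≤ b ^ 30 := one_le_pow₀ (by linarith)
  have h9 : b ^ 38 = b ^ 30 * b ^ 8 := by ring
  have h10 : 1000 ≤ b ^ 8 := hb.trans (le_self_pow₀ (by linarith) (by norm_num))
  nlinarith

theorem iterate_extD (h : TameMap g g' b) {y : ℂ} (hy : y ∈ Disk) (k : ℕ) :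
    (extD g g')^[k] y = g^[k] y ∧ g^[k] y ∈ Disk := by
  induction k with
  | zero => exact ⟨rfl, hy⟩
  | succ k ih =>
    rw [Function.iterate_succ_apply', Function.iterate_succ_apply', ih.1, extD_of_mem _ _ ih.2]
    exact ⟨rfl, h.maps ih.2⟩

/-- A tame map without periodic points other than the origin has derivative growth strictly below
the maximal one over long times. -/
theorem growth_lt (h : TameMap g g' b) (haper : ∀ z ∈ Disk, z ≠ 0 → ∀ n : ℕ, 1 ≤ n → g^[n] z ≠ z)
    {M : ℕ} (hM : b ^ 820 ≤ M) {x u : ℕ → ℂ} (hx0 : x 0 ∈ Disk) (hx : ∀ i, x (i + 1) = g (x i))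
    (hu : ∀ i, u (i + 1) = g' (x i) (u i)) : ‖u M‖ ≤ ‖u 0‖ * b ^ ((399 / 20 : ℝ) * M) := by
  have hb := h.hb
  have hb0 : 0 < b := by linarith
  have hb1 : 1 ≤ b := by linarith
  have hxD : ∀ i, x i ∈ Disk := fun i => by
    induction i with
    | zero => exact hx0
    | succ i ih => rw [hx]; exact h.maps ih
  by_contra! hcon
  have hu0 : u 0 ≠ 0 := by
    intro h0
    have : ∀ i, u i = 0 := fun i => by
      induction i with
      | zero => exact h0
      | succ i ih => rw [hu, ih, map_zero]
    rw [this, this, norm_zero, zero_mul] at hcon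
    exact lt_irrefl _ hcon
  have hstep : ∀ {i : ℕ} {v : ℂ}, v ≠ 0 → g' (x i) v ≠ 0 := fun {i v} hv h0 => by
    have := norm_le_of_det_one (h.det _ (hxD i)) le_rfl v
    rw [h0, norm_zero, mul_zero] at this
    exact hv (norm_le_zero_iff.1 this)
  have hune : ∀ i, u i ≠ 0 := fun i => by
    induction i with
    | zero => exact hu0
    | succ i ih => rw [hu]; exact hstep ih
  obtain ⟨s, hs, hsM⟩ : ∃ s : ℕ → ℂ, (∀ i, s (i + 1) = g' (x i) (s i)) ∧ s M = Complex.I * u M := by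
    have : ∀ m (w : ℂ), ∃ s : ℕ → ℂ, (∀ i, s (i + 1) = g' (x i) (s i)) ∧ s m = w := by
      intro m
      induction m with
      | zero => intro w
                exact ⟨fun i => Nat.rec w (fun i v => g' (x i) v) i, fun _ => rfl, rfl⟩
      | succ m ih =>
        intro w
        obtain ⟨v, hv⟩ := exists_apply_eq_of_det_one (h.det _ (hxD m)) w
        obtain ⟨s, h1, h2⟩ := ih v
        exact ⟨s, h1, by rw [h1, h2, hv]⟩
    exact this M _
  have hsne : ∀ i, s i ≠ 0 := by
    have h0 : s 0 ≠ 0 := by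
      intro h0
      have : ∀ i, s i = 0 := fun i => by
        induction i with
        | zero => exact h0
        | succ i ih => rw [hs, ih, map_zero]
      rw [this] at hsM
      exact hune M (by simpa using hsM.symm)
    intro i
    induction i with
    | zero => exact h0
    | succ i ih => rw [hs]; exact hstep ih
  set D : ℕ → ℝ := fun i => 40 * Real.log b - (Real.log ‖u (i + 1)‖ - Real.log ‖u i‖) +
    (Real.log ‖s (i + 1)‖ - Real.log ‖s i‖) with hDdef
  have hO : DefectOrbit b M (fun i => g' (x i)) u s D :=
    ⟨hb, fun i => h.det _ (hxD i), fun i => h.bd _ (hxD i), hu, hs, hune, hsne, fun _ => rfl⟩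
  have hl := hO.log_pos
  have un : ∀ i, 0 < ‖u i‖ := fun i => norm_pos_iff.2 (hune i)
  have sn : ∀ i, 0 < ‖s i‖ := fun i => norm_pos_iff.2 (hsne i)
  have hgr : Real.log ‖u 0‖ + (399 / 20 : ℝ) * M * Real.log b ≤ Real.log ‖u M‖ := by
    have := Real.log_le_log (mul_pos (un 0) (Real.rpow_pos_of_pos hb0 _)) hcon.le
    rwa [Real.log_mul (un 0).ne' (Real.rpow_pos_of_pos hb0 _).ne', Real.log_rpow hb0] at this
  have hsum : ∑ i ∈ Finset.range M, D i ≤ (1 / 10 : ℝ) * M * Real.log b := by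
    have e : ∑ i ∈ Finset.range M, D i = 40 * M * Real.log b - (Real.log ‖u M‖ - Real.log ‖u 0‖) +
        (Real.log ‖s M‖ - Real.log ‖s 0‖) := by
      simp only [hDdef]
      rw [Finset.sum_add_distrib, Finset.sum_sub_distrib, Finset.sum_range_sub (fun i => Real.log ‖u i‖),
        Finset.sum_range_sub (fun i => Real.log ‖s i‖)]
      simp; ring
    have hsMn : ‖s M‖ = ‖u M‖ := by rw [hsM, norm_mul, Complex.norm_I, one_mul]
    have h1 : ‖u M‖ * ‖u M‖ ≤ ‖u 0‖ * ‖s 0‖ := by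
      refine le_trans (le_of_eq ?_) (abs_om_le (u 0) (s 0))
      rw [← hO.om_eq M, hsM]
      have : om (u M) (Complex.I * u M) = ‖u M‖ * ‖u M‖ := by
        rw [← sq, Complex.sq_norm, Complex.normSq_apply]; simp [om]
      rw [this, abs_of_nonneg (by positivity)]
    have h2 := Real.log_le_log (mul_pos (un M) (un M)) h1
    rw [Real.log_mul (un M).ne' (un M).ne', Real.log_mul (un 0).ne' (sn 0).ne'] at h2
    rw [e, hsMn]
    linarith
  classical
  set BF := (Finset.range M).filter fun a => ∃ n : ℕ, a + n ≤ M ∧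
    n * Real.log b < ∑ i ∈ Finset.Ico a (a + n), D i with hBF
  set BB := (Finset.range M).filter fun a => ∃ n : ℕ, n ≤ a ∧
    n * Real.log b < ∑ i ∈ Finset.Ico (a - n) a, D i with hBB
  have cF : (BF.card : ℝ) ≤ (1 / 10 : ℝ) * M := by
    have := (card_forward_bad_le hO.D_nonneg hl M).trans hsum
    exact le_of_mul_le_mul_right this hl
  have cB : (BB.card : ℝ) ≤ (1 / 10 : ℝ) * M := by
    have := (card_backward_bad_le hO.D_nonneg hl M).trans hsum
    exact le_of_mul_le_mul_right this hl
  set G := (Finset.range (M - 1)).filter fun a => a ∉ BF ∧ a ∉ BB with hG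
  have hGcard : (M : ℝ) / 2 - 1 ≤ G.card := by
    have h1 : Finset.range (M - 1) ⊆ G ∪ (BF ∪ BB) := by
      intro a ha
      by_cases h1 : a ∈ BF
      · exact Finset.mem_union_right _ (Finset.mem_union_left _ h1)
      by_cases h2 : a ∈ BB
      · exact Finset.mem_union_right _ (Finset.mem_union_right _ h2)
      · exact Finset.mem_union_left _ (Finset.mem_filter.2 ⟨ha, h1, h2⟩)
    have h2 := (Finset.card_le_card h1).trans ((Finset.card_union_le _ _).trans
      (Nat.add_le_add_left (Finset.card_union_le _ _) _))
    rw [Finset.card_range] at h2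
    have h3 : M ≤ G.card + (BF.card + BB.card) + 1 := by omega
    have h4 : (M : ℝ) ≤ G.card + (BF.card + BB.card) + 1 := by exact_mod_cast h3
    have : (0 : ℝ) ≤ M := Nat.cast_nonneg _
    linarith
  have hGF : ∀ a ∈ G, ∀ n, a + n ≤ M → ∑ i ∈ Finset.Ico a (a + n), D i ≤ n * Real.log b := by
    intro a ha n hn
    by_contra! hc
    obtain ⟨h1, h2, h3⟩ := Finset.mem_filter.1 ha
    refine h2 (Finset.mem_filter.2 ⟨Finset.mem_range.2 ?_, n, hn, hc⟩)
    have := Finset.mem_range.1 h1; omega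
  have hGB : ∀ a ∈ G, ∀ n, n ≤ a → ∑ i ∈ Finset.Ico (a - n) a, D i ≤ n * Real.log b := by
    intro a ha n hn
    by_contra! hc
    obtain ⟨h1, h2, h3⟩ := Finset.mem_filter.1 ha
    refine h3 (Finset.mem_filter.2 ⟨Finset.mem_range.2 ?_, n, hn, hc⟩)
    have := Finset.mem_range.1 h1; omega
  have hR2 : 2 ≤ b ^ 150 := by
    calc (2 : ℝ) ≤ b := by linarith
      _ ≤ _ := le_self_pow₀ hb1 (by norm_num)
  have hlarge : (3 * b ^ 150) ^ 4 < (G.card : ℝ) := by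
    refine lt_of_lt_of_le ?_ hGcard
    have h1 : b ^ 820 = b ^ 600 * b ^ 220 := by ring
    have h2 : 1000 ≤ b ^ 220 := hb.trans (le_self_pow₀ hb1 (by norm_num))
    have h3 : 1 ≤ b ^ 600 := one_le_pow₀ hb1
    have h4 : (3 * b ^ 150) ^ 4 = 81 * b ^ 600 := by ring
    nlinarith
  obtain ⟨a, ha, a', ha', haa, hxx, hss⟩ := exists_close_pair hR2 G x
    (fun i => (‖s i‖⁻¹ : ℝ) * s i) (fun i => mem_Disk.1 (hxD i)) (fun i => by
      rw [norm_mul, Complex.norm_real, norm_inv, norm_norm, inv_mul_cancel₀ (sn i).ne']) hlarge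
  obtain ⟨k, rfl⟩ := Nat.exists_eq_add_of_lt haa
  rw [show a + k + 1 = a + (k + 1) by ring] at *
  set k1 := k + 1 with hk1
  have ham : a + k1 + 2 ≤ M := by
    have := Finset.mem_range.1 (Finset.mem_filter.1 ha').1; omega
  have hrp : b ^ (20 : ℝ) = b ^ 20 := by
    rw [← Real.rpow_natCast]; norm_num
  have hH := hO.hypSeq (a := a) (k := k1) (by omega) (fun n hn => hGF a ha n (by omega))
    (fun n hn => by
      have := hGB _ ha' (k1 - n) (by omega)
      rw [show a + k1 - (k1 - n) = a + n by omega, Nat.cast_sub hn] at this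
      exact this)
    (by have := hGF _ ha' 1 (by omega)
        simpa using this)
    (by
      calc _ ≤ 2 / b ^ 150 * (8 * b) := by gcongr
        _ = 16 * b / b ^ 150 := by ring
        _ ≤ 1 := by
          rw [div_le_one (by positivity)]
          calc 16 * b ≤ b * b := by nlinarith
            _ = b ^ 2 := by ring
            _ ≤ b ^ 150 := pow_le_pow_right₀ hb1 (by norm_num))
  obtain ⟨y, hy1, hy2⟩ := exists_periodic_of_hypSeq (g := g) (g' := g') (x := fun i => x (a + i)) h.deriv h.lip (by positivity) (fun i => hxD _)
    (fun i => hx _) hH (r := (b ^ 120)⁻¹) (by positivity)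
    (by
      rw [hrp]
      have e : 8 * b ^ 80 * (b ^ 120)⁻¹ * b ^ 20 = 8 / b ^ 20 := by field_simp
      rw [e, div_le_one (by positivity)]
      calc (8 : ℝ) ≤ b := by linarith
        _ ≤ _ := le_self_pow₀ hb1 (by norm_num))
    (by
      rw [hrp, Nat.add_zero]
      calc _ ≤ 2 / b ^ 150 * (2 * b ^ 20) := by gcongr
        _ = (b ^ 120)⁻¹ * (4 / b ^ 10) := by field_simp; norm_num
        _ ≤ (b ^ 120)⁻¹ * 1 := by
          gcongr
          rw [div_le_one (by positivity)]
          calc (4 : ℝ) ≤ b := by linarith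
            _ ≤ _ := le_self_pow₀ hb1 (by norm_num)
        _ = _ := mul_one _)
  simp only [Nat.add_zero] at hy1
  have hfar : ∀ p, p = 0 ∨ ‖p‖ = 1 → (b ^ 120)⁻¹ < ‖x a - p‖ := fun p hp => by
    refine h.far_of_expansion (hxD a) hp (hune a) ?_
    have h1 := hO.u_growth (i := a) (j := a + 2) (by omega)
    have h2 := hGF a ha 2 (by omega)
    push_cast at h1 h2
    rw [← hx, ← hu, ← hu, ← Real.log_le_log_iff (by have := un a; positivity) (un _),
      Real.log_mul (by positivity) (un a).ne', Real.log_pow]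
    push_cast
    show _ ≤ Real.log ‖u (a + 2)‖
    linarith
  have hy0 : y ≠ 0 := by
    rintro rfl
    have := hfar 0 (Or.inl rfl)
    rw [zero_sub, norm_neg] at hy1
    rw [sub_zero] at this
    linarith
  have hxa : 0 < ‖x a‖ := by
    have h1 := hfar 0 (Or.inl rfl)
    rw [sub_zero] at h1
    exact lt_trans (by positivity) h1
  have hyD : y ∈ Disk := by
    rw [mem_Disk]
    have h1 := hfar ((‖x a‖⁻¹ : ℝ) * x a) (Or.inr (by
      rw [norm_mul, Complex.norm_real, norm_inv, norm_norm, inv_mul_cancel₀ hxa.ne']))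
    have h2 : ‖x a - (‖x a‖⁻¹ : ℝ) * x a‖ = 1 - ‖x a‖ := by
      rw [show x a - (‖x a‖⁻¹ : ℝ) * x a = ((1 - ‖x a‖⁻¹ : ℝ) : ℂ) * x a by push_cast; ring, norm_mul,
        Complex.norm_real, Real.norm_eq_abs, ← abs_norm (x a), ← abs_mul, abs_norm, sub_mul, one_mul,
        inv_mul_cancel₀ hxa.ne', abs_sub_comm, abs_of_nonneg]
      have := mem_Disk.1 (hxD a); linarith
    rw [h2] at h1
    have := norm_sub_norm_le y (x a)
    linarith
  rw [(h.iterate_extD hyD _).1] at hy2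
  exact haper y hyD hy0 k1 (by omega) hy2

end TameMap

theorem summable_of_two_step {a : ℕ → ℝ} (ha : ∀ i, 0 ≤ a i) {θ : ℝ} (hθ0 : 0 ≤ θ) (hθ : θ < 1)
    (h : ∀ i, a (i + 2) ≤ θ * a i) : Summable a := by
  refine summable_of_sum_range_le (c := (a 0 + a 1) / (1 - θ)) ha fun m => ?_
  rw [le_div_iff₀ (by linarith)]
  have h1 : ∑ i ∈ Finset.range m, a i ≤ ∑ i ∈ Finset.range (m + 2), a i :=
    Finset.sum_le_sum_of_subset_of_nonneg (Finset.range_mono (by omega)) fun i _ _ => ha i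
  have h2 : ∑ i ∈ Finset.range (m + 2), a i ≤ θ * ∑ i ∈ Finset.range m, a i + (a 0 + a 1) := by
    rw [Finset.sum_range_succ', Finset.sum_range_succ', Finset.mul_sum, add_assoc, add_comm (a 0)]
    gcongr with i _
    exact h i
  linarith

theorem summable_indicator_of_two_step {a : ℕ → ℝ} (ha : ∀ i, 0 ≤ a i) (S : Set ℕ) {θ : ℝ}
    (hθ0 : 0 ≤ θ) (hθ : θ < 1)
    (h : ∀ i ∈ S, ∀ j ∈ S, ∀ k ∈ S, i < j → j < k → a k ≤ θ * a i) : Summable (S.indicator a) := by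
  rcases S.finite_or_infinite with hS | hS
  · exact summable_of_hasFiniteSupport (hS.subset support_indicator_subset)
  · haveI := hS.to_subtype
    classical
    rw [← summable_subtype_iff_indicator, ← (Nat.Subtype.orderIsoOfNat S).toEquiv.summable_iff]
    have hmono : StrictMono fun i => ((Nat.Subtype.orderIsoOfNat S i : S) : ℕ) := fun i j hij =>
      (Nat.Subtype.orderIsoOfNat S).strictMono hij
    refine summable_of_two_step (fun i => ha _) hθ0 hθ fun i => ?_
    exact h _ (Subtype.mem _) _ (Subtype.mem _) _ (Subtype.mem _) (hmono (Nat.lt_succ_self i))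
      (hmono (Nat.lt_succ_self (i + 1)))

theorem eventually_sq_le_exp (A : ℝ) : ∀ᶠ x : ℝ in atTop, A * x ^ 2 ≤ Real.exp (x / 4) := by
  have h := (Real.tendsto_exp_div_pow_atTop 2).comp
    (tendsto_id.atTop_div_const (by norm_num : (0 : ℝ) < 4))
  filter_upwards [h.eventually_ge_atTop (16 * A), eventually_gt_atTop 0] with x h1 h2
  simp only [Function.comp, id] at h1
  rw [le_div_iff₀ (by positivity)] at h1
  nlinarith

/-- A non-Bruno sequence of denominators has infinitely many gaps that are large compared with any
growth function that drops at each long time. -/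
theorem frequently_large_gap {q : ℕ → ℕ} (hq1 : ∀ n, 1 ≤ q n) (hqm : Monotone q)
    (hq2 : ∀ n, 2 * q n ≤ q (n + 2))
    (hnB : ¬ Summable fun n => Real.log (q (n + 1)) / q n) {κ : ℕ → ℝ} (hκ0 : ∀ n, 0 ≤ κ n)
    {C C₁ : ℝ} (hκ1 : ∀ n, κ n ≤ C₁ * n) {θ : ℝ} (hθ0 : 0 ≤ θ) (hθ : θ < 1)
    (hdrop : ∀ n, C * q n ≤ Real.exp (κ (q n)) → ∀ T : ℕ, 3 * q n * Real.exp (κ (q n)) ^ 41 ≤ T →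
      κ T / T ≤ θ * (κ (q n) / q n)) :
    ∃ᶠ n in atTop, Real.exp (4 * κ (q n)) ≤ q (n + 1) := by
  intro hcon
  have hq0 : ∀ n, (0 : ℝ) < q n := fun n => by exact_mod_cast hq1 n
  have hbad : ∀ᶠ n in atTop, Real.log (q (n + 1)) ≤ 4 * κ (q n) := by
    filter_upwards [hcon] with n hn
    rw [← Real.log_exp (4 * κ (q n))]
    exact Real.log_le_log (hq0 _) (not_le.1 hn).le
  have hsq : Summable fun n => (√(q n))⁻¹ := by
    refine summable_of_two_step (fun n => by positivity) (θ := (√2)⁻¹) (by positivity) ?_ fun n => ?_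
    · exact inv_lt_one_of_one_lt₀ (Real.one_lt_sqrt_two)
    · rw [← mul_inv, ← Real.sqrt_mul (by norm_num)]
      refine inv_anti₀ (Real.sqrt_pos.2 (by have := hq0 n; positivity)) (Real.sqrt_le_sqrt ?_)
      exact_mod_cast hq2 n
  have hx : Tendsto (fun n => √(q n)) atTop atTop := by
    have := hsq.tendsto_atTop_zero
    have h2 := (tendsto_nhdsWithin_iff.2 ⟨this, Eventually.of_forall fun n =>
      inv_pos.2 (Real.sqrt_pos.2 (hq0 n))⟩).inv_tendsto_nhdsGT_zero
    refine h2.congr fun n => by simp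
  obtain ⟨n₀, hn₀⟩ := eventually_atTop.1 (hbad.and (hx.eventually
    (eventually_sq_le_exp (max C (3 + 41 * C₁)))))
  have hsqs : ∀ n, √(q n) ^ 2 = q n := fun n => Real.sq_sqrt (hq0 n).le
  set S : Set ℕ := {n | n₀ ≤ n ∧ √(q n) ≤ Real.log (q (n + 1))} with hS
  have hexp : ∀ n ∈ S, Real.exp (√(q n)) ≤ q (n + 1) := fun n hn => by
    rw [← Real.le_log_iff_exp_le (hq0 _)]; exact hn.2
  have hsum : Summable (S.indicator fun n => κ (q n) / q n) := by
    refine summable_indicator_of_two_step (fun n => div_nonneg (hκ0 _) (hq0 n).le) S hθ0 hθ ?_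
    intro i hi j hj k hk hij hjk
    obtain ⟨b1, b2⟩ := hn₀ i hi.1
    rw [hsqs] at b2
    set x := √(q i) with hxd
    have hx0 : 0 ≤ x := Real.sqrt_nonneg _
    refine hdrop i ?_ (q k) ?_
    · calc C * q i ≤ max C (3 + 41 * C₁) * q i := by gcongr; exact le_max_left _ _
        _ ≤ Real.exp (x / 4) := b2
        _ ≤ Real.exp (κ (q i)) := by
          rw [Real.exp_le_exp]
          have := hi.2
          linarith
    · have hj1 : Real.exp x ≤ q j := (hexp i hi).trans (by exact_mod_cast hqm hij)
      have hj2 : Real.exp (x / 2) ≤ √(q j) := by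
        refine Real.le_sqrt_of_sq_le ?_
        rw [← Real.exp_nat_mul]
        convert hj1 using 2
        push_cast; ring
      have hk1 : Real.exp (Real.exp (x / 2)) ≤ q k :=
        (Real.exp_le_exp.2 hj2).trans ((hexp j hj).trans (by exact_mod_cast hqm hjk))
      refine le_trans ?_ hk1
      have e1 : (3 : ℝ) * q i ≤ Real.exp (3 * q i) := by
        have := Real.add_one_le_exp (3 * (q i : ℝ)); linarith
      have e2 : Real.exp (κ (q i)) ^ 41 ≤ Real.exp (41 * C₁ * q i) := by
        rw [← Real.exp_nat_mul, Real.exp_le_exp]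
        have := hκ1 (q i)
        push_cast; linarith
      calc 3 * q i * Real.exp (κ (q i)) ^ 41 ≤ Real.exp (3 * q i) * Real.exp (41 * C₁ * q i) := by
            gcongr
        _ = Real.exp ((3 + 41 * C₁) * q i) := by rw [← Real.exp_add]; ring_nf
        _ ≤ Real.exp (Real.exp (x / 2)) := by
          rw [Real.exp_le_exp]
          calc (3 + 41 * C₁) * q i ≤ max C (3 + 41 * C₁) * q i := by gcongr; exact le_max_right _ _
            _ ≤ Real.exp (x / 4) := b2
            _ ≤ _ := by rw [Real.exp_le_exp]; linarith
  apply hnB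
  rw [← summable_nat_add_iff n₀]
  have hmaj := (summable_nat_add_iff n₀).2 ((hsum.mul_left 4).add hsq)
  refine hmaj.of_nonneg_of_le (fun n => ?_) fun n => ?_
  · exact div_nonneg (Real.log_natCast_nonneg _) (hq0 _).le
  · set m := n + n₀ with hm
    have hm0 : n₀ ≤ m := by omega
    by_cases hmS : m ∈ S
    · rw [indicator_of_mem hmS]
      have := (hn₀ m hm0).1
      have h2 : Real.log (q (m + 1)) / q m ≤ 4 * (κ (q m) / q m) := by
        rw [mul_div_assoc']; gcongr
      have h3 : 0 ≤ (√(q m))⁻¹ := by positivity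
      linarith
    · rw [indicator_of_notMem hmS, mul_zero, zero_add]
      have : Real.log (q (m + 1)) ≤ √(q m) := by
        by_contra! hc
        exact hmS ⟨hm0, hc.le⟩
      rw [div_le_iff₀ (hq0 m)]
      refine this.trans (le_of_eq ?_)
      have h0 := Real.sqrt_pos.2 (hq0 m)
      nth_rewrite 3 [← hsqs m]
      field_simp

/-- The largest norm of the derivative of an iterate of `f` of order at most `n`. -/
def KT (f : SympDiff) (n : ℕ) : ℝ := sSup {r | ∃ m ≤ n, ∃ z ∈ Disk, r = ‖cD f m z‖}

theorem norm_cD_le_KT (f : SympDiff) {m n : ℕ} (hmn : m ≤ n) {z : ℂ} (hz : z ∈ Disk) :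
    ‖cD f m z‖ ≤ KT f n := by
  refine le_csSup ?_ ⟨m, hmn, z, hz, rfl⟩
  have : BddAbove (⋃ m ∈ Finset.range (n + 1), (fun z => ‖cD f m z‖) '' Disk) := by
    refine (Set.Finite.bddAbove_biUnion (Finset.finite_toSet _)).2
      fun m _ => (isCompact_Disk.image_of_continuousOn (continuousOn_cD f m).norm).bddAbove
  refine this.mono ?_
  rintro r ⟨m, hm, z, hz, rfl⟩
  simp only [mem_iUnion]
  exact ⟨m, Finset.mem_range.2 (by omega), z, hz, rfl⟩

theorem zero_mem_Disk : (0 : ℂ) ∈ Disk := by simp [mem_Disk]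

theorem KT_le (f : SympDiff) {n : ℕ} {c : ℝ} (h : ∀ m ≤ n, ∀ z ∈ Disk, ‖cD f m z‖ ≤ c) :
    KT f n ≤ c := by
  refine csSup_le ⟨_, 0, Nat.zero_le n, 0, zero_mem_Disk, rfl⟩ ?_
  rintro r ⟨m, hm, z, hz, rfl⟩
  exact h m hm z hz

theorem one_le_KT (f : SympDiff) (n : ℕ) : 1 ≤ KT f n := by
  refine le_trans ?_ (norm_cD_le_KT f (Nat.zero_le n) zero_mem_Disk)
  rw [cD, ContinuousLinearMap.norm_id]

theorem norm_cD_mul_add_le (f : SympDiff) {N m r : ℕ} (hr : r ≤ N) {z : ℂ} (hz : z ∈ Disk) :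
    ‖cD f (m * N + r) z‖ ≤ KT f N ^ (m + 1) := by
  induction m with
  | zero => simpa using norm_cD_le_KT f hr hz
  | succ m ih =>
    rw [show (m + 1) * N + r = N + (m * N + r) by ring, cD_add]
    refine (ContinuousLinearMap.opNorm_comp_le _ _).trans ?_
    rw [pow_succ' _ (m + 1)]
    have := one_le_KT f N
    gcongr
    exact norm_cD_le_KT f le_rfl (iterate_mem f _ hz)

theorem KT_le_pow (f : SympDiff) (n : ℕ) : KT f n ≤ KT f 1 ^ (n + 1) := by
  refine KT_le f fun m hm z hz => ?_
  have := norm_cD_mul_add_le f (N := 1) (m := m) (r := 0) (Nat.zero_le _) hz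
  rw [mul_one, add_zero] at this
  exact this.trans (pow_le_pow_right₀ (one_le_KT f 1) (by omega))

theorem norm_cD_sub_le (f : SympDiff) {L : ℝ}
    (hL : ∀ z ∈ Disk, ∀ w ∈ Disk,
      ‖fderivWithin ℝ f.toFun Disk z - fderivWithin ℝ f.toFun Disk w‖ ≤ L * ‖z - w‖)
    (N : ℕ) {z w : ℂ} (hz : z ∈ Disk) (hw : w ∈ Disk) :
    ‖cD f N z - cD f N w‖ ≤ N * L * KT f N ^ 3 * ‖z - w‖ := by
  have hK0 : 0 ≤ KT f N := zero_le_one.trans (one_le_KT f N)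
  have key : ∀ j ≤ N, ‖cD f N z - (cD f (N - j) (f.toFun^[j] z)).comp (cD f j w)‖ ≤
      j * L * KT f N ^ 3 * ‖z - w‖ := by
    intro j
    induction j with
    | zero => intro _; simp [cD]
    | succ j ih =>
      intro hj
      have ih := ih (by omega)
      have hjz := iterate_mem f j hz
      have hjw := iterate_mem f j hw
      have e1 : cD f (N - j) (f.toFun^[j] z) = (cD f (N - (j + 1)) (f.toFun^[j + 1] z)).comp
          (fderivWithin ℝ f.toFun Disk (f.toFun^[j] z)) := by
        rw [show N - j = (N - (j + 1)) + 1 by omega, cD_add]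
        congr 1
        · rw [Function.iterate_succ_apply' (n := j)]; rfl
      have e2 : cD f N z - (cD f (N - (j + 1)) (f.toFun^[j + 1] z)).comp (cD f (j + 1) w) =
          (cD f N z - (cD f (N - j) (f.toFun^[j] z)).comp (cD f j w)) +
          (cD f (N - (j + 1)) (f.toFun^[j + 1] z)).comp
          ((fderivWithin ℝ f.toFun Disk (f.toFun^[j] z) -
            fderivWithin ℝ f.toFun Disk (f.toFun^[j] w)).comp (cD f j w)) := by
        rw [e1, cD]
        ext v
        simp
      have hd : ‖f.toFun^[j] z - f.toFun^[j] w‖ ≤ KT f N * ‖z - w‖ :=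
        convex_Disk.norm_image_sub_le_of_norm_hasFDerivWithin_le
          (fun x hx => hasFDerivWithinAt_iterate f j hx)
          (fun x hx => norm_cD_le_KT f (by omega) hx) hw hz
      have hb : ‖(cD f (N - (j + 1)) (f.toFun^[j + 1] z)).comp
          ((fderivWithin ℝ f.toFun Disk (f.toFun^[j] z) -
            fderivWithin ℝ f.toFun Disk (f.toFun^[j] w)).comp (cD f j w))‖ ≤
          KT f N * ((L * (KT f N * ‖z - w‖)) * KT f N) := by
        have hL0 : ∀ x ∈ Disk, ∀ y ∈ Disk, ‖x - y‖ ≤ KT f N * ‖z - w‖ →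
            ‖fderivWithin ℝ f.toFun Disk x - fderivWithin ℝ f.toFun Disk y‖ ≤
              L * (KT f N * ‖z - w‖) := by
          intro x hx y hy hxy
          have hLn : 0 ≤ L := by
            have := hL 1 (by simp [mem_Disk]) 0 zero_mem_Disk
            simp at this
            exact (norm_nonneg _).trans this
          exact (hL x hx y hy).trans (by gcongr)
        refine (ContinuousLinearMap.opNorm_comp_le _ _).trans ?_
        refine mul_le_mul (norm_cD_le_KT f (by omega) (iterate_mem f _ hz)) ?_ (norm_nonneg _) hK0
        refine (ContinuousLinearMap.opNorm_comp_le _ _).trans ?_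
        have h1 := hL0 _ hjz _ hjw hd
        exact mul_le_mul h1 (norm_cD_le_KT f (by omega) hw) (norm_nonneg _)
          ((norm_nonneg _).trans h1)
      rw [e2]
      refine (norm_add_le _ _).trans ((add_le_add ih hb).trans (le_of_eq ?_))
      push_cast
      ring
  have := key N le_rfl
  rw [Nat.sub_self] at this
  exact this

theorem KT_drop (f : SympDiff)
    (haper : ∀ z ∈ Disk, z ≠ 0 → ∀ n : ℕ, 1 ≤ n → f.toFun^[n] z ≠ z) {L : ℝ}
    (hL : ∀ z ∈ Disk, ∀ w ∈ Disk,
      ‖fderivWithin ℝ f.toFun Disk z - fderivWithin ℝ f.toFun Disk w‖ ≤ L * ‖z - w‖)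
    {N : ℕ} (hN : 1 ≤ N) {b : ℝ} (hb : 1000 ≤ b) (hE : KT f N = b ^ 20)
    (hNL : N * L ≤ KT f N)
    (htame : ∀ p, p = 0 ∨ ‖p‖ = 1 → ‖cD f (2 * N) p‖ ≤ b ^ 30) {T : ℕ}
    (hT : 3 * N * KT f N ^ 41 ≤ T) :
    Real.log (KT f T) / T ≤ (799 / 800) * (Real.log (KT f N) / N) := by
  have hb0 : 0 < b := by linarith
  have htm : TameMap f.toFun^[N] (cD f N) b := by
    refine ⟨hb, fun z hz => hasFDerivWithinAt_iterate f N hz, fun z hz w hw => ?_,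
      f.mapsTo.iterate N, fun z hz => det_cD f N hz, fun z hz => hE ▸ norm_cD_le_KT f le_rfl hz, ?_⟩
    · refine (norm_cD_sub_le f hL N hz hw).trans ?_
      refine mul_le_mul_of_nonneg_right ?_ (norm_nonneg _)
      calc N * L * KT f N ^ 3 ≤ KT f N * KT f N ^ 3 := by
            have := one_le_KT f N
            gcongr
        _ = b ^ 80 := by rw [hE]; ring
    · intro p hp
      rw [← cD_add, ← two_mul]
      exact htame p hp
  have haper' : ∀ z ∈ Disk, z ≠ 0 → ∀ n : ℕ, 1 ≤ n → (f.toFun^[N])^[n] z ≠ z := by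
    intro z hz hz0 n hn
    rw [← Function.iterate_mul]
    exact haper z hz hz0 _ (Nat.mul_pos hN hn)
  have hgrow : ∀ M : ℕ, KT f N ^ 41 ≤ M → ∀ z ∈ Disk,
      ‖cD f (M * N) z‖ ≤ b ^ ((399 / 20 : ℝ) * M) := by
    intro M hM z hz
    refine ContinuousLinearMap.opNorm_le_bound _ (by positivity) fun v => ?_
    have := htm.growth_lt haper' (M := M) (by rw [hE, ← pow_mul] at hM; exact hM) (x := fun i => f.toFun^[i * N] z) (u := fun i => cD f (i * N) z v)
      (by simpa using hz)
      (fun i => by rw [← Function.iterate_add_apply]; congr 2; ring)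
      (fun i => by
        rw [show (i + 1) * N = N + i * N by ring, cD_add]; rfl)
    simpa [cD, mul_comm] using this
  set E := KT f N with hEd
  have hE0 : 0 < E := by rw [hE]; positivity
  have hE1 : 1 ≤ E := one_le_KT f N
  have hlogE : Real.log E = 20 * Real.log b := by rw [hE, Real.log_pow]; norm_num
  have hlb : 0 ≤ Real.log b := Real.log_nonneg (by linarith)
  have hNpos : (0 : ℝ) < N := by exact_mod_cast hN
  have hE800 : 800 ≤ E ^ 41 := by
    calc (800 : ℝ) ≤ b := by linarith
      _ ≤ b ^ 820 := le_self_pow₀ (by linarith) (by norm_num)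
      _ = E ^ 41 := by rw [hE]; ring
  set X : ℝ := T / N with hX
  have hXE : 3 * E ^ 41 ≤ X := by
    rw [hX, le_div_iff₀ hNpos]
    linarith
  have hT0 : (0 : ℝ) < T := by
    have : 0 < 3 * (N : ℝ) * E ^ 41 := by positivity
    linarith
  have hKT : KT f T ≤ Real.exp ((799 / 800) * X * Real.log E) := by
    refine KT_le f fun m hm z hz => ?_
    have hmd : m = (m / N) * N + m % N := by rw [mul_comm]; exact (Nat.div_add_mod m N).symm
    have hr : m % N ≤ N := (Nat.mod_lt _ hN).le
    set M := m / N with hM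
    have hMX : (M : ℝ) ≤ X := by
      rw [hX, le_div_iff₀ hNpos]
      have : M * N ≤ T := (Nat.div_mul_le_self m N).trans hm
      exact_mod_cast this
    have hlE : 0 ≤ Real.log E := by rw [hlogE]; positivity
    rcases le_or_gt (E ^ 41) M with h41 | h41
    · have h1 : ‖cD f m z‖ ≤ E * b ^ ((399 / 20 : ℝ) * M) := by
        rw [hmd, add_comm, cD_add]
        refine (ContinuousLinearMap.opNorm_comp_le _ _).trans ?_
        exact mul_le_mul (norm_cD_le_KT f hr (iterate_mem f _ hz)) (hgrow M h41 z hz)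
          (norm_nonneg _) hE0.le
      refine h1.trans ?_
      rw [Real.rpow_def_of_pos hb0]
      nth_rewrite 1 [← Real.exp_log hE0]
      rw [← Real.exp_add, Real.exp_le_exp]
      have : Real.log b = Real.log E / 20 := by rw [hlogE]; ring
      rw [this]
      have h2 : 1 + 399 / 400 * (M : ℝ) ≤ 799 / 800 * X := by linarith
      nlinarith [mul_le_mul_of_nonneg_right h2 hlE]
    · have h1 : ‖cD f m z‖ ≤ E ^ (M + 1) := by
        rw [hmd]; exact norm_cD_mul_add_le f hr hz
      refine h1.trans ?_
      nth_rewrite 1 [← Real.exp_log hE0]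
      rw [← Real.exp_nat_mul, Real.exp_le_exp]
      push_cast
      gcongr
      linarith
  have h1 : Real.log (KT f T) ≤ (799 / 800) * X * Real.log E := by
    rw [Real.log_le_iff_le_exp (zero_lt_one.trans_le (one_le_KT f T))]
    exact hKT
  rw [div_le_iff₀ hT0]
  refine h1.trans (le_of_eq ?_)
  rw [hX]
  ring

theorem exists_lipschitz (f : SympDiff) (hs : ContDiffOn ℝ 2 f.toFun Disk) : ∃ L : ℝ,
    ∀ z ∈ Disk, ∀ w ∈ Disk,
      ‖fderivWithin ℝ f.toFun Disk z - fderivWithin ℝ f.toFun Disk w‖ ≤ L * ‖z - w‖ := by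
  have h1 : ContDiffOn ℝ 1 (fderivWithin ℝ f.toFun Disk) Disk :=
    hs.fderivWithin uniqueDiffOn_Disk (by norm_num)
  obtain ⟨L, hL⟩ := isCompact_Disk.exists_bound_of_continuousOn
    (h1.continuousOn_fderivWithin uniqueDiffOn_Disk le_rfl)
  refine ⟨L, fun z hz w hw => ?_⟩
  exact convex_Disk.norm_image_sub_le_of_norm_fderivWithin_le
    (h1.differentiableOn (by norm_num)) hL hw hz

theorem periodic_of_exp_periodic {d : ℝ → ℂ} (hd : Continuous d) {c : ℂ} (hc : c ≠ 0)
    (hs : ∀ t, 0 < (c * Complex.exp (d t)).re) {T : ℝ}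
    (hT : ∀ t, Complex.exp (d (t + T)) = Complex.exp (d t)) (t : ℝ) : d (t + T) = d t := by
  have hc' : Continuous fun t => Complex.log (c * Complex.exp (d t)) :=
    Continuous.clog (by fun_prop) fun t => Or.inl (hs t)
  obtain ⟨k, hk⟩ := exists_int_of_exp_eq' (g₁ := fun t => d t + Complex.log c)
    (g₂ := fun t => Complex.log (c * Complex.exp (d t))) (by fun_prop) hc' (fun t => by
      have h1 : c * Complex.exp (d t) ≠ 0 := mul_ne_zero hc (Complex.exp_ne_zero _)
      rw [Complex.exp_add, Complex.exp_log hc, Complex.exp_log h1, mul_comm])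
  have h1 := hk t
  have h2 := hk (t + T)
  simp only [hT] at h1 h2
  linear_combination h2 - h1

/-- A continuous plane map which preserves the unit circle and fixes only the origin cannot be
hyperbolic with positive eigenvalues there. -/
theorem trace_le_two {g : ℂ → ℂ} (hg : Continuous g) (hfix : ∀ z, z ≠ 0 → g z ≠ z) (h0 : g 0 = 0)
    (hcirc : ∀ z, ‖z‖ = 1 → ‖g z‖ = 1) {B : ℂ →L[ℝ] ℂ} (hB : HasFDerivAt g B 0)
    (hdet : (B 1).re * (B Complex.I).im - (B 1).im * (B Complex.I).re = 1) :
    (B 1).re + (B Complex.I).im ≤ 2 := by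
  by_contra! hcon
  obtain ⟨m, hm, hexp⟩ := exists_continuous_log (f := fun ζ : ℂ => g (Complex.exp ζ) - Complex.exp ζ)
    (by fun_prop) (fun ζ => sub_ne_zero.2 (hfix _ (Complex.exp_ne_zero _)))
  have hper : ∀ ζ, Complex.exp (ζ + 2 * π * Complex.I) = Complex.exp ζ := Complex.exp_periodic
  obtain ⟨k, hk⟩ := exists_int_of_exp_eq' (g₁ := fun ζ => m (ζ + 2 * π * Complex.I)) (g₂ := m)
    (by fun_prop) hm (fun ζ => by rw [hexp, hexp, hper])
  have hI : Complex.exp (2 * π * Complex.I) = 1 := Complex.exp_two_pi_mul_I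
  -- winding along the unit circle
  have hw : ∀ w : ℂ, ‖w‖ = 1 → w ≠ 1 → w.re < 1 := by
    intro w hw hw1
    have hn : w.re ^ 2 + w.im ^ 2 = 1 := by
      have := Complex.sq_norm w; rw [hw, Complex.normSq_apply] at this; nlinarith
    by_contra! h
    apply hw1
    have h1 : w.re = 1 := by nlinarith [sq_nonneg w.im]
    have h2 : w.im = 0 := by rw [h1] at hn; nlinarith
    exact Complex.ext h1 h2
  have a1 := periodic_of_exp_periodic (d := fun t : ℝ => m (t * Complex.I) - t * Complex.I)
    (c := -1) (T := 2 * π) (by fun_prop) (by norm_num) (fun t => by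
      have hz : ‖Complex.exp (t * Complex.I)‖ = 1 := Complex.norm_exp_ofReal_mul_I t
      have hz0 := Complex.exp_ne_zero (t * Complex.I)
      rw [Complex.exp_sub, hexp, sub_div, div_self hz0]
      have h1 := hw (g (Complex.exp (t * Complex.I)) / Complex.exp (t * Complex.I))
        (by rw [norm_div, hcirc _ hz, hz, div_one])
        (by rw [Ne, div_eq_one_iff_eq hz0]; exact hfix _ hz0)
      simp only [Complex.mul_re, Complex.neg_re, Complex.one_re, Complex.sub_re, Complex.neg_im,
        Complex.one_im]
      linarith) (fun t => by
      rw [show ((t + 2 * π : ℝ) : ℂ) * Complex.I = t * Complex.I + 2 * π * Complex.I by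
        push_cast; ring, Complex.exp_sub, Complex.exp_sub, hexp, hexp, hper]) 0
  -- winding along small circles
  set p := (B 1).re - 1 with hp
  set q := (B 1).im with hq
  set r := (B Complex.I).re with hr
  set s := (B Complex.I).im - 1 with hs
  have hps : p * s - q * r < 0 := by
    have : p * s - q * r = 2 - ((B 1).re + (B Complex.I).im) := by
      rw [hp, hs]; linear_combination hdet
    linarith
  set a : ℂ := ⟨(p + s) / 2, (q - r) / 2⟩ with ha
  set b : ℂ := ⟨(p - s) / 2, (q + r) / 2⟩ with hb
  have hab : ‖a‖ < ‖b‖ := by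
    rw [← sq_lt_sq₀ (norm_nonneg _) (norm_nonneg _), Complex.sq_norm, Complex.sq_norm,
      Complex.normSq_mk, Complex.normSq_mk]
    linarith
  have hlin : ∀ w : ℂ, B w - w = a * w + b * starRingEnd ℂ w := by
    intro w
    have e : B w = (w.re : ℝ) • B 1 + (w.im : ℝ) • B Complex.I := by
      rw [← map_smul, ← map_smul, ← map_add]
      congr 1
      simpa using (Complex.re_add_im w).symm
    rw [e]
    apply Complex.ext
    · simp [ha, hb]
      rw [hp, hs, hr, hq]
      ring
    · simp [ha, hb]
      rw [hp, hs, hr, hq]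
      ring
  have hb0 : b ≠ 0 := by rw [← norm_pos_iff]; exact (norm_nonneg _).trans_lt hab
  have hε : 0 < (‖b‖ - ‖a‖) / 2 := by linarith
  obtain ⟨δ, hδ, hδ2⟩ := Metric.eventually_nhds_iff.1
    ((hasFDerivAt_iff_isLittleO_nhds_zero.1 hB).def hε)
  set S := Real.log (δ / 2) with hS
  have hSn : ∀ t : ℝ, ‖Complex.exp (S + t * Complex.I)‖ = δ / 2 := fun t => by
    rw [Complex.norm_exp]
    simp [hS, Real.exp_log (half_pos hδ)]
  have a2 := periodic_of_exp_periodic (d := fun t : ℝ => m (S + t * Complex.I) + t * Complex.I)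
    (c := b⁻¹) (T := 2 * π) (by fun_prop) (inv_ne_zero hb0) (fun t => by
      set w := Complex.exp (S + t * Complex.I) with hwd
      have hwn : ‖w‖ = δ / 2 := hSn t
      have hwn' := hδ2 (y := w) (by rw [dist_zero_right, hwn]; linarith)
      rw [zero_add, h0, sub_zero, hwn] at hwn'
      have e1 : Complex.exp (t * Complex.I) = w / (δ / 2 : ℝ) := by
        rw [hwd, Complex.exp_add, hS, ← Complex.ofReal_exp, Real.exp_log (half_pos hδ),
          mul_div_cancel_left₀]
        exact Complex.ofReal_ne_zero.2 (half_pos hδ).ne'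
      have hwc : starRingEnd ℂ w * w = ((δ / 2 : ℝ) : ℂ) ^ 2 := by
        rw [← Complex.normSq_eq_conj_mul_self, ← hwn, Complex.normSq_eq_norm_sq]; push_cast; ring
      have hδc : ((δ / 2 : ℝ) : ℂ) ≠ 0 := Complex.ofReal_ne_zero.2 (half_pos hδ).ne'
      set R := g w - B w with hR
      have e2 : b⁻¹ * Complex.exp (m (S + t * Complex.I) + t * Complex.I) =
          (δ / 2 : ℝ) + b⁻¹ * ((a * w + R) * w / (δ / 2 : ℝ)) := by
        rw [Complex.exp_add, hexp, e1, ← hwd]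
        have : g w - w = a * w + b * starRingEnd ℂ w + R := by rw [← hlin, hR]; ring
        rw [this]
        field_simp
        linear_combination b * hwc
      rw [e2]
      have e3 : ‖b⁻¹ * ((a * w + R) * w / (δ / 2 : ℝ))‖ < δ / 2 := by
        rw [norm_mul, norm_inv, norm_div, norm_mul, hwn, Complex.norm_real, Real.norm_of_nonneg
          (half_pos hδ).le, mul_div_assoc, div_self (half_pos hδ).ne', mul_one,
          inv_mul_lt_iff₀ (norm_pos_iff.2 hb0)]
        calc ‖a * w + R‖ ≤ ‖a‖ * (δ / 2) + (‖b‖ - ‖a‖) / 2 * (δ / 2) :=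
              (norm_add_le _ _).trans (by rw [norm_mul, hwn]; gcongr)
          _ < ‖b‖ * (δ / 2) := by nlinarith
      have e4 := (abs_lt.1 ((Complex.abs_re_le_norm _).trans_lt e3)).1
      rw [Complex.add_re, Complex.ofReal_re]
      linarith) (fun t => by
      have : (S : ℂ) + ((t + 2 * π : ℝ) : ℂ) * Complex.I = S + t * Complex.I + 2 * π * Complex.I := by
        push_cast; ring
      rw [this, Complex.exp_add, Complex.exp_add, hexp, hexp, hper]
      congr 1
      rw [← hper (t * Complex.I)]
      congr 1
      push_cast; ring) 0
  have k1 := hk 0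
  have k2 := hk S
  have hne := two_pi_I_ne_zero'
  simp only [zero_add, Complex.ofReal_mul, Complex.ofReal_ofNat, Complex.ofReal_zero, zero_mul,
    add_zero, sub_zero] at a1 a2 k1
  have e1 : (k : ℂ) = 1 := by
    apply mul_right_cancel₀ hne
    linear_combination a1 - k1
  have e2 : (k : ℂ) = -1 := by
    apply mul_right_cancel₀ hne
    linear_combination a2 - k2
  rw [e1] at e2
  norm_num at e2

/-- Powers of an area preserving linear map which is not hyperbolic grow at most linearly. -/
theorem norm_le_of_recurrence {t : ℝ} (ht : t ^ 2 ≤ 4) {w : ℕ → ℂ}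
    (hw : ∀ n, w (n + 2) = t * w (n + 1) - w n) (n : ℕ) : ‖w n‖ ≤ n * (‖w 1‖ + ‖w 0‖) + ‖w 0‖ := by
  obtain ⟨c, hc0, hc1, hc⟩ : ∃ c : ℕ → ℝ, c 0 = 0 ∧ c 1 = 1 ∧ ∀ n, c (n + 2) = t * c (n + 1) - c n := by
    let P : ℕ → ℝ × ℝ := fun n => (fun x : ℝ × ℝ => (x.2, t * x.2 - x.1))^[n] (0, 1)
    have hP : ∀ n, P (n + 1) = ((P n).2, t * (P n).2 - (P n).1) := fun n => by
      simp only [P, Function.iterate_succ_apply']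
    refine ⟨fun n => (P n).1, rfl, by simp [P], fun n => ?_⟩
    have h2 := hP (n + 1)
    have h1 := hP n
    simp only [h2, h1]
  have hinv : ∀ n, c (n + 1) ^ 2 - t * c n * c (n + 1) + c n ^ 2 = 1 := by
    intro n
    induction n with
    | zero => rw [hc0, zero_add, hc1]; ring
    | succ n ih => rw [hc]; linear_combination ih
  have hcb : ∀ n, |c n| ≤ n := by
    intro n
    induction n with
    | zero => simp [hc0]
    | succ n ih =>
      have h1 : (c (n + 1) - t / 2 * c n) ^ 2 ≤ 1 ^ 2 := by
        nlinarith [hinv n, mul_nonneg (sub_nonneg.2 ht) (sq_nonneg (c n))]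
      have h2 := abs_le_of_sq_le_sq h1 zero_le_one
      have h3 : |t| ≤ 2 := abs_le_of_sq_le_sq (by linarith) (by norm_num)
      have h4 : |t / 2 * c n| ≤ n := by
        rw [abs_mul, abs_div, abs_two]
        calc |t| / 2 * |c n| ≤ 1 * n := by gcongr; linarith
          _ = n := one_mul _
      rw [abs_le] at h2 h4 ⊢
      push_cast
      constructor <;> linarith [h2.1, h2.2, h4.1, h4.2]
  have hform : ∀ n, w (n + 1) = c (n + 1) * w 1 - c n * w 0 := by
    intro n
    induction n using Nat.twoStepInduction with
    | zero => simp [hc0, hc1]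
    | one => rw [hw, hc, hc0, zero_add, hc1]; push_cast; ring
    | more n ih1 ih2 =>
      rw [hw, ih2, ih1, hc (n + 1), hc n]; push_cast; ring
  cases n with
  | zero => simp
  | succ n =>
    rw [hform]
    have h1 := hcb (n + 1)
    have h2 := hcb n
    refine (norm_sub_le _ _).trans ?_
    rw [norm_mul, norm_mul, Complex.norm_real, Complex.norm_real, Real.norm_eq_abs, Real.norm_eq_abs]
    have h3 : |c (n + 1)| * ‖w 1‖ ≤ (n + 1 : ℕ) * ‖w 1‖ := by gcongr
    have h4 : |c n| * ‖w 0‖ ≤ n * ‖w 0‖ := by gcongr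
    have := norm_nonneg (w 0)
    push_cast at *
    linarith

theorem cD_succ_zero (f : SympDiff) (hfix : f.toFun 0 = 0) (n : ℕ) (v : ℂ) :
    cD f (n + 1) 0 v = cD f 1 0 (cD f n 0 v) := by
  rw [add_comm, cD_add, Function.iterate_fixed hfix]; rfl

theorem cD_zero_recurrence (f : SympDiff) (hfix : f.toFun 0 = 0) (n : ℕ) (v : ℂ) :
    cD f (n + 2) 0 v = (((cD f 1 0 1).re + (cD f 1 0 Complex.I).im : ℝ) : ℂ) * cD f (n + 1) 0 v -
      cD f n 0 v := by
  rw [cD_succ_zero f hfix (n + 1), cD_succ_zero f hfix n]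
  have hd := om_map (cD f 1 0) 1 Complex.I
  rw [det_cD f 1 zero_mem_Disk] at hd
  set w := cD f n 0 v
  set B := cD f 1 0
  have e : ∀ w : ℂ, B w = (w.re : ℝ) • B 1 + (w.im : ℝ) • B Complex.I := by
    intro w
    rw [← map_smul, ← map_smul, ← map_add]
    congr 1
    simpa using (Complex.re_add_im w).symm
  simp only [om, Complex.one_re, Complex.I_im, Complex.one_im, Complex.I_re] at hd
  rw [e (B w), e w]
  apply Complex.ext
  · simp
    linear_combination (-w.re) * hd
  · simp
    linear_combination (-w.im) * hd

theorem exists_norm_cD_zero_le (f : SympDiff) (hfix : f.toFun 0 = 0) {F E : ℂ ≃ₜ ℂ} {l : ℝ → ℝ}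
    {α : ℝ} (h : PseudoRot F E l α) (hE : ∀ n, ∀ z ∈ Disk, E^[n] z = f.toFun^[n] z) :
    ∃ C : ℝ, 0 ≤ C ∧ ∀ n : ℕ, ‖cD f n 0‖ ≤ C * (n + 1) := by
  set B := cD f 1 0 with hB
  set t := (B 1).re + (B Complex.I).im with ht
  have hE0 : E 0 = 0 := h.isLift.zero
  have hD : Disk ∈ 𝓝 (0 : ℂ) := closedBall_mem_nhds _ one_pos
  have hder : HasFDerivAt E^[2] (cD f 2 0) 0 :=
    ((hasFDerivWithinAt_iterate f 2 zero_mem_Disk).hasFDerivAt hD).congr_of_eventuallyEq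
      (by filter_upwards [hD] with z hz using hE 2 z hz)
  have hd2 := om_map (cD f 2 0) 1 Complex.I
  rw [det_cD f 2 zero_mem_Disk] at hd2
  simp only [om, Complex.one_re, Complex.I_im, Complex.one_im, Complex.I_re] at hd2
  have htr := trace_le_two (g := E^[2]) (E.continuous.iterate 2) (fun z hz => h.aper 2 (by norm_num) z hz)
    (Function.iterate_fixed hE0 2)
    (fun z hz => (h.isLift.circ _).2 ((h.isLift.circ z).2 hz)) hder (by linarith)
  have hrec := cD_zero_recurrence f hfix
  have e1 := hrec 0 1
  have e2 := hrec 0 Complex.I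
  rw [zero_add, zero_add, ← hB, ← ht] at e1 e2
  rw [e1, e2] at htr
  have ht4 : t ^ 2 ≤ 4 := by
    simp [cD] at htr
    simp [hB, cD] at ht
    nlinarith
  refine ⟨‖B‖ + 1, by positivity, fun n => ?_⟩
  refine ContinuousLinearMap.opNorm_le_bound _ (by positivity) fun v => ?_
  have h1 := norm_le_of_recurrence ht4 (w := fun n => cD f n 0 v) (fun n => hrec n v) n
  have h2 : cD f 0 0 v = v := rfl
  simp only [h2, ← hB] at h1
  have h3 := B.le_opNorm v
  have h4 := norm_nonneg v
  have h5 : (0 : ℝ) ≤ n := n.cast_nonneg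
  have h6 := norm_nonneg B
  nlinarith [mul_le_mul_of_nonneg_left h3 h5, mul_nonneg h6 h4]

/-- Denjoy–Koksma inequality for a lift which is monotonically semiconjugate to a translation. -/
theorem abs_sum_sub_sum_le {l H φ : ℝ → ℝ} {α Λ : ℝ} (hl : ∀ θ, l (θ + 1) = l θ + 1)
    (hH : Monotone H) (hH1 : ∀ θ, H (θ + 1) = H θ + 1) (hHl : ∀ θ, H (l θ) = H θ + α)
    (hφ1 : ∀ θ, φ (θ + 1) = φ θ) (hφ : ∀ x y, |φ x - φ y| ≤ Λ * |x - y|) {q : ℕ} (hq : 1 ≤ q) {p : ℤ}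
    (hpq : IsCoprime p (q : ℤ)) (hα : q * |q * α - p| ≤ 1) (x y : ℝ) :
    |∑ j ∈ Finset.range q, φ (l^[j] y) - ∑ j ∈ Finset.range q, φ (l^[j] x)| ≤ 5 * Λ := by
  have hqp : (0 : ℝ) < q := by exact_mod_cast hq
  have hqz : (0 : ℤ) < q := by exact_mod_cast hq
  have hΛ : 0 ≤ Λ := by
    have := hφ 1 0
    rw [sub_zero, abs_one, mul_one] at this
    exact (abs_nonneg _).trans this
  obtain ⟨r, s, hrs⟩ := hpq
  have hHz : ∀ (m : ℤ) θ, H (θ + m) = H θ + m := by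
    intro m θ
    induction m using Int.induction_on with
    | zero => simp
    | succ i ih => push_cast at *; rw [← add_assoc, hH1, ih]; ring
    | pred i ih =>
      have := hH1 (θ + (-(i : ℝ) - 1))
      push_cast at *
      rw [show θ + (-(i : ℝ) - 1) + 1 = θ + -i by ring, ih] at this
      linarith
  have hφz : ∀ (m : ℤ) θ, φ (θ + m) = φ θ := by
    intro m θ
    have hp : Function.Periodic φ 1 := hφ1
    simpa using hp.int_mul m θ
  have hHit : ∀ (j : ℕ) θ, H (l^[j] θ) = H θ + j * α := by
    intro j θ
    induction j with
    | zero => simp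
    | succ j ih => rw [Function.iterate_succ_apply', hHl, ih]; push_cast; ring
  let J : ℤ → ℕ := fun k => ((k * r) % q).toNat
  have hJz : ∀ k, (J k : ℤ) = (k * r) % q := fun k =>
    Int.toNat_of_nonneg (Int.emod_nonneg _ hqz.ne')
  have hJlt : ∀ k, J k < q := fun k => by
    have := Int.emod_lt_of_pos (k * r) hqz
    rw [← hJz] at this
    exact_mod_cast this
  have hJdvd : ∀ k, (q : ℤ) ∣ k - J k * p := fun k => by
    rw [hJz]
    have h1 : (q : ℤ) ∣ k * r - (k * r) % q := Int.dvd_self_sub_emod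
    have h2 : k - (k * r) % q * p = (k * r - (k * r) % q) * p + q * (k * s) := by
      linear_combination (-k) * hrs
    rw [h2]
    exact dvd_add (h1.mul_right p) (dvd_mul_right _ _)
  let m : ℤ → ℤ := fun k => (k - J k * p) / q
  have hm : ∀ k, (q : ℤ) * m k = k - J k * p := fun k => Int.mul_ediv_cancel' (hJdvd k)
  have hJper : ∀ k, J (k + q) = J k := fun k => by
    simp only [J]
    rw [add_mul, Int.add_mul_emod_self_left]
  have hmper : ∀ k, m (k + q) = m k + 1 := fun k => by
    have h1 := hm (k + q)
    rw [hJper] at h1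
    have h2 := hm k
    apply mul_left_cancel₀ hqz.ne'
    linarith
  let ξ : ℝ → ℤ → ℝ := fun x k => l^[J k] x + m k
  have hξper : ∀ x k, ξ x (k + q) = ξ x k + 1 := fun x k => by
    simp only [ξ, hJper, hmper]; push_cast; ring
  have hHξ : ∀ x k, |q * (H (ξ x k) - H x) - k| < 1 := fun x k => by
    have e : (q : ℝ) * (H (ξ x k) - H x) - k = J k * (q * α - p) := by
      simp only [ξ]
      rw [hHz, hHit]
      have : (q : ℝ) * m k = k - J k * p := by exact_mod_cast hm k
      linear_combination this
    rw [e, abs_mul, Nat.abs_cast]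
    have h1 : (J k : ℝ) < q := by exact_mod_cast hJlt k
    rcases (abs_nonneg (q * α - p)).eq_or_lt with h0 | h0
    · rw [← h0]; simp
    · exact (mul_lt_mul_of_pos_right h1 h0).trans_le hα
  have hlt : ∀ a b, H a < H b → a < b := fun a b h => hH.reflect_lt h
  set c : ℤ := ⌊q * (H y - H x)⌋ with hc
  have hc1 := Int.floor_le (q * (H y - H x))
  have hc2 := Int.lt_floor_add_one (q * (H y - H x))
  rw [← hc] at hc1 hc2
  have hsum : ∀ (x : ℝ) (c : ℤ), ∑ k ∈ Finset.range q, φ (ξ x (k + c)) =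
      ∑ j ∈ Finset.range q, φ (l^[j] x) := by
    intro x c
    have hinj : Set.InjOn (fun k : ℕ => J (k + c)) (Finset.range q : Finset ℕ) := by
      intro a ha b hb hab
      simp only [Finset.coe_range, mem_Iio] at ha hb hab
      have h1 := hJdvd (a + c)
      have h2 := hJdvd (b + c)
      rw [hab] at h1
      have h3 : (q : ℤ) ∣ a - b := by
        have := dvd_sub h1 h2
        rwa [show ((a : ℤ) + c - J (b + c) * p) - ((b : ℤ) + c - J (b + c) * p) = a - b by ring] at this
      have h4 := Int.eq_zero_of_abs_lt_dvd h3 (by rw [abs_lt]; constructor <;> omega)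
      omega
    have hmaps : Set.MapsTo (fun k : ℕ => J (k + c)) (Finset.range q : Finset ℕ)
        (Finset.range q : Finset ℕ) := fun a _ => by simpa using hJlt _
    refine Finset.sum_nbij (fun k => J (k + c)) hmaps hinj
      (Finset.surjOn_of_injOn_of_card_le _ hmaps hinj le_rfl) fun k _ => ?_
    simp only [ξ]
    rw [hφz]
  have htel : ∀ (x : ℝ) (a : ℤ), ∑ k ∈ Finset.range q, (ξ x (k + (a + 1)) - ξ x (k + a)) = 1 := by
    intro x a
    have := Finset.sum_range_sub (fun k : ℕ => ξ x (k + a)) q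
    rw [show ((q : ℕ) : ℤ) + a = a + q by ring, hξper] at this
    rw [show (1 : ℝ) = ξ x a + 1 - ξ x ((0 : ℕ) + a) by simp, ← this]
    refine Finset.sum_congr rfl fun k _ => ?_
    congr 2
    push_cast; ring
  have hpt : ∀ k : ℤ, |ξ y (k + 0) - ξ x (k + c)| ≤ ξ x (k + (c + 3)) - ξ x (k + (c - 2)) := by
    intro k
    have cmp : ∀ u v : ℝ, q * (H u - H x) < q * (H v - H x) → u ≤ v := fun u v h => by
      have := lt_of_mul_lt_mul_left h hqp.le
      exact (hlt u v (by linarith)).le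
    have h0 := abs_lt.1 (hHξ y (k + 0))
    have h1 := abs_lt.1 (hHξ x (k + c))
    have h2 := abs_lt.1 (hHξ x (k + (c + 3)))
    have h3 := abs_lt.1 (hHξ x (k + (c - 2)))
    push_cast at h0 h1 h2 h3
    have a1 := cmp (ξ y (k + 0)) (ξ x (k + (c + 3))) (by linarith)
    have a2 := cmp (ξ x (k + (c - 2))) (ξ y (k + 0)) (by linarith)
    have a3 := cmp (ξ x (k + c)) (ξ x (k + (c + 3))) (by linarith)
    have a4 := cmp (ξ x (k + (c - 2))) (ξ x (k + c)) (by linarith)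
    rw [abs_le]
    constructor <;> linarith
  rw [← hsum y 0, ← hsum x c, ← Finset.sum_sub_distrib]
  calc |∑ k ∈ Finset.range q, (φ (ξ y (k + 0)) - φ (ξ x (k + c)))|
      ≤ ∑ k ∈ Finset.range q, Λ * (ξ x (k + (c + 3)) - ξ x (k + (c - 2))) := by
        refine (Finset.abs_sum_le_sum_abs _ _).trans (Finset.sum_le_sum fun k _ => ?_)
        exact (hφ _ _).trans (by gcongr; exact hpt k)
    _ = 5 * Λ := by
        rw [← Finset.mul_sum, mul_comm]
        congr 1
        have t1 := htel x (c - 2)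
        have t2 := htel x (c - 1)
        have t3 := htel x c
        have t4 := htel x (c + 1)
        have t5 := htel x (c + 2)
        rw [show c - 2 + 1 = c - 1 by ring] at t1
        rw [show c - 1 + 1 = c by ring] at t2
        rw [show c + 1 + 1 = c + 2 by ring] at t4
        rw [show c + 2 + 1 = c + 3 by ring] at t5
        rw [Finset.sum_sub_distrib] at *
        linarith

/-- The standard parametrisation of the unit circle. -/
def circPt (θ : ℝ) : ℂ := Complex.exp (2 * π * Complex.I * θ)

theorem norm_circPt (θ : ℝ) : ‖circPt θ‖ = 1 := norm_exp_two_pi θ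

theorem circPt_mem (θ : ℝ) : circPt θ ∈ Disk := mem_Disk.2 (norm_circPt θ).le

theorem circPt_ne_zero (θ : ℝ) : circPt θ ≠ 0 := Complex.exp_ne_zero _

theorem hasDerivAt_circPt (θ : ℝ) :
    HasDerivAt circPt (2 * π * (Complex.I * circPt θ)) θ := by
  have h : HasDerivAt (fun x : ℝ => 2 * π * Complex.I * (x : ℂ)) (2 * π * Complex.I) θ := by
    simpa using (Complex.ofRealCLM.hasDerivAt (x := θ)).const_mul (2 * π * Complex.I)
  have := h.cexp
  refine this.congr_deriv ?_
  simp only [circPt]; ring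

theorem norm_circPt_sub_le (x y : ℝ) : ‖circPt x - circPt y‖ ≤ 2 * π * |x - y| := by
  refine convex_univ.norm_image_sub_le_of_norm_hasDerivWithin_le (f := circPt)
    (fun t _ => (hasDerivAt_circPt t).hasDerivWithinAt) (fun t _ => ?_) (mem_univ y) (mem_univ x)
  rw [norm_mul, norm_mul, norm_mul, norm_circPt, Complex.norm_I, Complex.norm_real,
    Real.norm_of_nonneg Real.pi_pos.le]
  simp

/-- The derivative of the circle lift of `f`, computed from the derivative of `f`. -/
def liftDeriv (f : SympDiff) (θ : ℝ) : ℝ :=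
  (starRingEnd ℂ (f.toFun (circPt θ)) *
    fderivWithin ℝ f.toFun Disk (circPt θ) (Complex.I * circPt θ)).im

section

variable {f : SympDiff} {l : ℝ → ℝ}

theorem circPt_iterate (hproj : ∀ θ : ℝ, f.toFun (circPt θ) = circPt (l θ)) (n : ℕ) (θ : ℝ) :
    f.toFun^[n] (circPt θ) = circPt (l^[n] θ) := by
  induction n with
  | zero => rfl
  | succ n ih => rw [Function.iterate_succ_apply', ih, hproj, Function.iterate_succ_apply']

theorem hasDerivAt_circ (θ : ℝ) : HasDerivAt (fun x => f.toFun (circPt x))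
    (2 * π * fderivWithin ℝ f.toFun Disk (circPt θ) (Complex.I * circPt θ)) θ := by
  have h1 := ((f.contDiffOn.differentiableOn (by norm_num)) _ (circPt_mem θ)).hasFDerivWithinAt
  have h2 := h1.comp_hasDerivWithinAt (s := univ) θ (hasDerivAt_circPt θ).hasDerivWithinAt
    (fun x _ => circPt_mem x)
  rw [hasDerivWithinAt_univ] at h2
  refine h2.congr_deriv ?_
  have : (2 * π * (Complex.I * circPt θ) : ℂ) = (2 * π : ℝ) • (Complex.I * circPt θ) := by
    rw [Complex.real_smul]; push_cast; ring
  rw [this, map_smul, Complex.real_smul]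
  push_cast; ring

theorem hasDerivAt_lift (hc : Continuous l)
    (hproj : ∀ θ : ℝ, f.toFun (circPt θ) = circPt (l θ)) (θ : ℝ) :
    HasDerivAt l (liftDeriv f θ) θ := by
  have hn0 : f.toFun (circPt θ) ≠ 0 := by rw [hproj]; exact circPt_ne_zero _
  have h1 := ((hasDerivAt_circ (f := f) θ).div_const (f.toFun (circPt θ))).clog_real (by
    rw [div_self hn0]; exact Complex.one_mem_slitPlane)
  have h2 := (Complex.imCLM.hasFDerivAt.comp_hasDerivAt θ h1).div_const (2 * π)
  have h3 := h2.const_add (l θ)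
  refine (h3.congr_of_eventuallyEq ?_).congr_deriv ?_
  · have hcl : ∀ᶠ x in 𝓝 θ, |l x - l θ| < 1 / 2 := by
      have := Metric.tendsto_nhds.1 (hc.tendsto θ) (1 / 2) (by norm_num)
      simpa [Real.dist_eq] using this
    filter_upwards [hcl] with x hx
    have e : f.toFun (circPt x) / f.toFun (circPt θ) =
        Complex.exp ((2 * π * (l x - l θ) : ℝ) * Complex.I) := by
      rw [hproj, hproj, circPt, circPt, ← Complex.exp_sub]
      congr 1
      push_cast; ring
    have hx' := abs_lt.1 hx
    have hπ := Real.pi_pos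
    simp only [Function.comp, e]
    rw [Complex.log_exp]
    · simp
    · simp; nlinarith
    · simp; nlinarith
  · have hns : f.toFun (circPt θ) * starRingEnd ℂ (f.toFun (circPt θ)) = 1 := by
      rw [Complex.mul_conj, Complex.normSq_eq_norm_sq, hproj, norm_circPt]; simp
    have hinv : (f.toFun (circPt θ))⁻¹ = starRingEnd ℂ (f.toFun (circPt θ)) :=
      inv_eq_of_mul_eq_one_right hns
    rw [div_self hn0, div_one, div_eq_mul_inv _ (f.toFun (circPt θ)), hinv, liftDeriv,
      Complex.imCLM_apply]
    have : (2 * π * fderivWithin ℝ f.toFun Disk (circPt θ) (Complex.I * circPt θ) *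
        starRingEnd ℂ (f.toFun (circPt θ)) : ℂ) = ((2 * π : ℝ) : ℂ) * (starRingEnd ℂ
        (f.toFun (circPt θ)) * fderivWithin ℝ f.toFun Disk (circPt θ) (Complex.I * circPt θ)) := by
      push_cast; ring
    rw [this, Complex.im_ofReal_mul]
    field_simp

theorem fderivWithin_tangent (hc : Continuous l)
    (hproj : ∀ θ : ℝ, f.toFun (circPt θ) = circPt (l θ)) (θ : ℝ) :
    fderivWithin ℝ f.toFun Disk (circPt θ) (Complex.I * circPt θ) =
      liftDeriv f θ * (Complex.I * circPt (l θ)) := by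
  have h1 := hasDerivAt_circ (f := f) θ
  have h2 : HasDerivAt (fun x => f.toFun (circPt x))
      (liftDeriv f θ • (2 * π * (Complex.I * circPt (l θ)))) θ := by
    have := (hasDerivAt_circPt (l θ)).scomp θ (hasDerivAt_lift hc hproj θ)
    refine this.congr_of_eventuallyEq (Eventually.of_forall fun x => hproj x)
  have h3 := h1.unique h2
  rw [Complex.real_smul] at h3
  have hπ : (2 * π : ℂ) ≠ 0 := by simp [Real.pi_ne_zero]
  apply mul_left_cancel₀ hπ
  rw [h3]; ring

theorem hasDerivAt_lift_iterate (hc : Continuous l)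
    (hproj : ∀ θ : ℝ, f.toFun (circPt θ) = circPt (l θ)) (n : ℕ) (θ : ℝ) :
    HasDerivAt l^[n] (∏ j ∈ Finset.range n, liftDeriv f (l^[j] θ)) θ := by
  induction n with
  | zero => simpa using hasDerivAt_id θ
  | succ n ih =>
    rw [Function.iterate_succ', Finset.prod_range_succ, mul_comm]
    exact (hasDerivAt_lift hc hproj _).comp θ ih

theorem cD_tangent (hc : Continuous l)
    (hproj : ∀ θ : ℝ, f.toFun (circPt θ) = circPt (l θ)) (n : ℕ) (θ : ℝ) :
    cD f n (circPt θ) (Complex.I * circPt θ) =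
      (∏ j ∈ Finset.range n, liftDeriv f (l^[j] θ) : ℝ) * (Complex.I * circPt (l^[n] θ)) := by
  induction n with
  | zero => simp [cD]
  | succ n ih =>
    rw [cD, ContinuousLinearMap.comp_apply, ih, circPt_iterate hproj, ← Complex.real_smul, map_smul,
      fderivWithin_tangent hc hproj, Finset.prod_range_succ, Complex.real_smul,
      Function.iterate_succ_apply']
    push_cast; ring

theorem cD_one (f : SympDiff) (z : ℂ) : cD f 1 z = fderivWithin ℝ f.toFun Disk z := by
  ext v; simp [cD]

theorem liftDeriv_pos (hc : Continuous l) (hmono : StrictMono l)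
    (hproj : ∀ θ : ℝ, f.toFun (circPt θ) = circPt (l θ)) (θ : ℝ) :
    1 / KT f 1 ≤ liftDeriv f θ := by
  have h0 : 0 ≤ liftDeriv f θ := by
    rw [← (hasDerivAt_lift hc hproj θ).deriv]
    exact hmono.monotone.deriv_nonneg
  have hK := zero_lt_one.trans_le (one_le_KT f 1)
  have h1 := norm_le_of_det_one (det_cD f 1 (circPt_mem θ)) (norm_cD_le_KT f le_rfl (circPt_mem θ))
    (Complex.I * circPt θ)
  rw [cD_one, fderivWithin_tangent hc hproj, norm_mul, norm_mul, norm_mul, Complex.norm_I,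
    norm_circPt, norm_circPt, Complex.norm_real, Real.norm_of_nonneg h0] at h1
  rw [div_le_iff₀ hK]
  linarith

theorem exists_lipschitz_log_liftDeriv (hs : ContDiffOn ℝ 2 f.toFun Disk) (hc : Continuous l)
    (hmono : StrictMono l) (hproj : ∀ θ : ℝ, f.toFun (circPt θ) = circPt (l θ)) :
    ∃ Λ : ℝ, ∀ x y : ℝ, |Real.log (liftDeriv f x) - Real.log (liftDeriv f y)| ≤ Λ * |x - y| := by
  obtain ⟨L, hL⟩ := exists_lipschitz f hs
  set K := KT f 1 with hK
  have hK1 : 1 ≤ K := one_le_KT f 1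
  have hK0 : 0 < K := by linarith
  have hD : ∀ z ∈ Disk, ‖fderivWithin ℝ f.toFun Disk z‖ ≤ K := fun z hz => by
    rw [← cD_one]; exact norm_cD_le_KT f le_rfl hz
  have hlip : ∀ x y : ℝ, |liftDeriv f x - liftDeriv f y| ≤ (K * K + L + K) * (2 * π) * |x - y| := by
    intro x y
    set z := circPt x
    set w := circPt y
    have hz : z ∈ Disk := circPt_mem x
    have hw : w ∈ Disk := circPt_mem y
    have hz1 : ‖z‖ = 1 := norm_circPt x
    have hw1 : ‖w‖ = 1 := norm_circPt y
    have hfw : ‖f.toFun w‖ ≤ 1 := mem_Disk.1 (f.mapsTo hw)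
    have hfl : ‖f.toFun z - f.toFun w‖ ≤ K * ‖z - w‖ :=
      convex_Disk.norm_image_sub_le_of_norm_fderivWithin_le
        (f.contDiffOn.differentiableOn (by norm_num)) hD hw hz
    have e : liftDeriv f x - liftDeriv f y =
        (starRingEnd ℂ (f.toFun z - f.toFun w) * fderivWithin ℝ f.toFun Disk z (Complex.I * z) +
        starRingEnd ℂ (f.toFun w) * ((fderivWithin ℝ f.toFun Disk z - fderivWithin ℝ f.toFun Disk w)
          (Complex.I * z) + fderivWithin ℝ f.toFun Disk w (Complex.I * (z - w)))).im := by
      rw [liftDeriv, liftDeriv, ← Complex.sub_im]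
      congr 1
      rw [mul_sub Complex.I, map_sub (fderivWithin ℝ f.toFun Disk w), map_sub, sub_apply]
      ring
    rw [e]
    refine (Complex.abs_im_le_norm _).trans ?_
    have hb1 : ‖fderivWithin ℝ f.toFun Disk z (Complex.I * z)‖ ≤ K := by
      refine ((fderivWithin ℝ f.toFun Disk z).le_opNorm _).trans ?_
      rw [norm_mul, Complex.norm_I, hz1]
      linarith [hD z hz]
    have hb2 : ‖(fderivWithin ℝ f.toFun Disk z - fderivWithin ℝ f.toFun Disk w) (Complex.I * z)‖ ≤
        L * ‖z - w‖ := by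
      refine (ContinuousLinearMap.le_opNorm _ _).trans ?_
      rw [norm_mul, Complex.norm_I, hz1, one_mul, mul_one]
      exact hL z hz w hw
    have hb3 : ‖fderivWithin ℝ f.toFun Disk w (Complex.I * (z - w))‖ ≤ K * ‖z - w‖ := by
      refine ((fderivWithin ℝ f.toFun Disk w).le_opNorm _).trans ?_
      rw [norm_mul, Complex.norm_I, one_mul]
      gcongr
      exact hD w hw
    have hL0 : 0 ≤ K * K + L + K := by
      have := hL 1 (by simp [mem_Disk]) 0 zero_mem_Disk
      have h2 := (norm_nonneg _).trans this
      simp at h2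
      nlinarith
    calc _ ≤ K * ‖z - w‖ * K + 1 * (L * ‖z - w‖ + K * ‖z - w‖) := by
          refine (norm_add_le _ _).trans ?_
          rw [norm_mul, norm_mul, Complex.norm_conj, Complex.norm_conj]
          gcongr
          exact (norm_add_le _ _).trans (add_le_add hb2 hb3)
      _ = (K * K + L + K) * ‖z - w‖ := by ring
      _ ≤ (K * K + L + K) * (2 * π * |x - y|) := by gcongr; exact norm_circPt_sub_le x y
      _ = _ := by ring
  refine ⟨K * ((K * K + L + K) * (2 * π)), fun x y => ?_⟩
  have key : ∀ a b : ℝ, 1 / K ≤ a → 1 / K ≤ b → Real.log a - Real.log b ≤ K * |a - b| := by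
    intro a b ha hb
    have hK' : 0 < 1 / K := by positivity
    have ha0 := hK'.trans_le ha
    have hb0 := hK'.trans_le hb
    rw [← Real.log_div ha0.ne' hb0.ne']
    have h1 := Real.log_le_sub_one_of_pos (div_pos ha0 hb0)
    have h2 : a / b - 1 = (a - b) / b := by field_simp
    have h3 : (a - b) / b ≤ |a - b| / (1 / K) := by
      refine (div_le_div_of_nonneg_right (le_abs_self _) hb0.le).trans ?_
      gcongr
    have h4 : |a - b| / (1 / K) = K * |a - b| := by field_simp
    linarith
  have hx := liftDeriv_pos hc hmono hproj x
  have hy := liftDeriv_pos hc hmono hproj y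
  have h1 := key _ _ hx hy
  have h2 := key _ _ hy hx
  rw [abs_sub_comm (liftDeriv f y)] at h2
  have h3 := mul_le_mul_of_nonneg_left (hlip x y) hK0.le
  rw [abs_le]
  constructor <;> linarith

end

/-- A circle lift with translation number `α` is monotonically semiconjugate to the translation
by `α`. -/
theorem exists_semiconj {l : ℝ → ℝ} (hc : Continuous l) (hmono : StrictMono l)
    (hper : ∀ θ : ℝ, l (θ + 1) = l θ + 1) {α : ℝ}
    (hα : ∀ θ : ℝ, Tendsto (fun n : ℕ => (l^[n] θ - θ) / n) atTop (𝓝 α)) :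
    ∃ H : ℝ → ℝ, Monotone H ∧ (∀ θ, H (θ + 1) = H θ + 1) ∧ ∀ θ, H (l θ) = H θ + α := by
  set g : CircleDeg1Lift := ⟨⟨l, hmono.monotone⟩, hper⟩ with hg
  have hgl : ⇑g = l := rfl
  set r : CircleDeg1Lift := (CircleDeg1Lift.translate (Multiplicative.ofAdd α)).1 with hr
  have hrl : ∀ x, r x = α + x := fun x => CircleDeg1Lift.translate_apply α x
  have hτ : CircleDeg1Lift.translationNumber g = CircleDeg1Lift.translationNumber r := by
    rw [hr, CircleDeg1Lift.translationNumber_translate]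
    refine CircleDeg1Lift.translationNumber_eq_of_tendsto₀ g ?_
    rw [hgl]
    simpa using hα 0
  obtain ⟨H, hH⟩ := CircleDeg1Lift.semiconj_of_bijective_of_translationNumber_eq
    (f₁ := g) (f₂ := r) ⟨hgl ▸ hmono.injective, hgl ▸ lift_surjective hc hper⟩
    (CircleDeg1Lift.isUnit_iff_bijective.1 (Units.isUnit _)) hτ
  refine ⟨H, H.monotone, H.map_add_one, fun θ => ?_⟩
  have := hH θ
  rw [hrl, hgl] at this
  rw [this, add_comm]

theorem circPt_add_one (θ : ℝ) : circPt (θ + 1) = circPt θ := by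
  rw [circPt, circPt, Complex.exp_eq_exp_iff_exists_int]
  exact ⟨1, by push_cast; ring⟩

theorem liftDeriv_add_one (f : SympDiff) (θ : ℝ) : liftDeriv f (θ + 1) = liftDeriv f θ := by
  rw [liftDeriv, circPt_add_one, liftDeriv]

/-- Bounded distortion at the denominators of the rotation number. -/
theorem exists_abs_log_prod_liftDeriv_le {f : SympDiff} {l : ℝ → ℝ}
    (hs : ContDiffOn ℝ 2 f.toFun Disk) (hc : Continuous l) (hmono : StrictMono l)
    (hper : ∀ θ : ℝ, l (θ + 1) = l θ + 1)
    (hproj : ∀ θ : ℝ, f.toFun (circPt θ) = circPt (l θ)) {α : ℝ}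
    (hα : ∀ θ : ℝ, Tendsto (fun n : ℕ => (l^[n] θ - θ) / n) atTop (𝓝 α)) :
    ∃ V : ℝ, ∀ q : ℕ, 1 ≤ q → ∀ p : ℤ, IsCoprime p (q : ℤ) → q * |q * α - p| ≤ 1 → ∀ θ : ℝ,
      |Real.log (∏ j ∈ Finset.range q, liftDeriv f (l^[j] θ))| ≤ V := by
  obtain ⟨H, hH, hH1, hHl⟩ := exists_semiconj hc hmono hper hα
  obtain ⟨Λ, hΛ⟩ := exists_lipschitz_log_liftDeriv hs hc hmono hproj
  have hpos : ∀ θ, 0 < liftDeriv f θ := fun θ =>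
    (one_div_pos.2 (zero_lt_one.trans_le (one_le_KT f 1))).trans_le (liftDeriv_pos hc hmono hproj θ)
  refine ⟨5 * Λ, fun q hq p hpq hqα θ => ?_⟩
  have hperq : l^[q] 1 = l^[q] 0 + 1 := by
    have := (show Function.Semiconj (fun θ : ℝ => θ + 1) l l from fun x => (hper x).symm).iterate_right q
    simpa using (this 0).symm
  have hd := hasDerivAt_lift_iterate hc hproj q
  obtain ⟨y, -, hy⟩ := exists_hasDerivAt_eq_slope l^[q]
    (fun θ => ∏ j ∈ Finset.range q, liftDeriv f (l^[j] θ)) zero_lt_one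
    (fun x _ => (hd x).continuousAt.continuousWithinAt) (fun x _ => hd x)
  have hlog : ∀ x, Real.log (∏ j ∈ Finset.range q, liftDeriv f (l^[j] x)) =
      ∑ j ∈ Finset.range q, Real.log (liftDeriv f (l^[j] x)) := fun x =>
    Real.log_prod fun j _ => (hpos _).ne'
  have hy0 : ∑ j ∈ Finset.range q, Real.log (liftDeriv f (l^[j] y)) = 0 := by
    rw [← hlog, hy, hperq]; simp
  have := abs_sum_sub_sum_le hper hH hH1 hHl
    (φ := fun x => Real.log (liftDeriv f x)) (fun x => by simp only [liftDeriv_add_one]) hΛ hq hpq hqα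
    y θ
  rwa [hy0, sub_zero, ← hlog] at this

theorem abs_prod_le_of_abs_log_le {t V : ℝ} (ht : 0 < t) (h : |Real.log t| ≤ V) :
    t ≤ Real.exp V ∧ 1 / t ≤ Real.exp V := by
  have h' := abs_le.1 h
  refine ⟨(Real.log_le_iff_le_exp ht).1 h'.2, ?_⟩
  rw [← Real.log_le_iff_le_exp (by positivity), one_div, Real.log_inv]
  linarith

/-- A boundary estimate: the derivative at time `2 q` along the circle is controlled by the
derivative at time `q`. -/
theorem exists_norm_cD_circ_le {f : SympDiff} {l : ℝ → ℝ}
    (hs : ContDiffOn ℝ 2 f.toFun Disk) (hc : Continuous l) (hmono : StrictMono l)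
    (hper : ∀ θ : ℝ, l (θ + 1) = l θ + 1)
    (hproj : ∀ θ : ℝ, f.toFun (circPt θ) = circPt (l θ)) {α : ℝ}
    (hα : ∀ θ : ℝ, Tendsto (fun n : ℕ => (l^[n] θ - θ) / n) atTop (𝓝 α)) :
    ∃ C : ℝ, 0 ≤ C ∧ ∀ q : ℕ, 1 ≤ q → ∀ p : ℤ, IsCoprime p (q : ℤ) → q * |q * α - p| ≤ 1 →
      ∀ z : ℂ, ‖z‖ = 1 → ‖cD f (2 * q) z‖ ≤ C * KT f q := by
  obtain ⟨V, hV⟩ := exists_abs_log_prod_liftDeriv_le hs hc hmono hper hproj hα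
  have hpos : ∀ θ, 0 < liftDeriv f θ := fun θ =>
    (one_div_pos.2 (zero_lt_one.trans_le (one_le_KT f 1))).trans_le (liftDeriv_pos hc hmono hproj θ)
  refine ⟨2 * Real.exp V + Real.exp V * Real.exp V, by positivity, fun q hq p hpq hqα z hz => ?_⟩
  obtain ⟨θ, rfl⟩ : ∃ θ : ℝ, z = circPt θ := exists_exp_of_norm_one hz
  set E := KT f q with hE
  have hE1 : 1 ≤ E := one_le_KT f q
  set M := Real.exp V
  have hM0 : 0 < M := Real.exp_pos V
  set θ' := l^[q] θ with hθ'
  set A := cD f q (circPt θ) with hA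
  set A' := cD f q (circPt θ') with hA'
  set t := ∏ j ∈ Finset.range q, liftDeriv f (l^[j] θ) with ht
  set t' := ∏ j ∈ Finset.range q, liftDeriv f (l^[j] θ') with ht'
  have ht0 : 0 < t := Finset.prod_pos fun j _ => hpos _
  have ht0' : 0 < t' := Finset.prod_pos fun j _ => hpos _
  obtain ⟨htM, htM'⟩ := abs_prod_le_of_abs_log_le ht0 (hV q hq p hpq hqα θ)
  obtain ⟨htM2, -⟩ := abs_prod_le_of_abs_log_le ht0' (hV q hq p hpq hqα θ')
  have hAn : ‖A‖ ≤ E := norm_cD_le_KT f le_rfl (circPt_mem θ)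
  have hAn' : ‖A'‖ ≤ E := norm_cD_le_KT f le_rfl (circPt_mem θ')
  have hAi : A (Complex.I * circPt θ) = t * (Complex.I * circPt θ') := cD_tangent hc hproj q θ
  have hAi' : A' (Complex.I * circPt θ') = t' * (Complex.I * circPt (l^[q] θ')) :=
    cD_tangent hc hproj q θ'
  have hcomp : cD f (2 * q) (circPt θ) = A'.comp A := by
    rw [two_mul, cD_add, circPt_iterate hproj]
  have hom : ∀ x, om (circPt x) (Complex.I * circPt x) = 1 := fun x => by
    have h := Complex.sq_norm (circPt x)
    rw [norm_circPt, Complex.normSq_apply] at h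
    simp only [om, Complex.mul_re, Complex.mul_im, Complex.I_re, Complex.I_im]
    linarith
  set w := circPt θ'
  set v := A (circPt θ) with hv
  have hvn : ‖v‖ ≤ E := by
    have := A.le_opNorm (circPt θ)
    rw [norm_circPt, mul_one] at this
    exact this.trans hAn
  have ha : om v (Complex.I * w) = 1 / t := by
    have h := om_map A (circPt θ) (Complex.I * circPt θ)
    rw [det_cD f q (circPt_mem θ), hom, hAi, om_smul_right] at h
    rw [eq_div_iff ht0.ne']; linarith
  have hdec : v = (1 / t : ℝ) * w + (om w v : ℝ) * (Complex.I * w) := by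
    have h := om_decomp w (Complex.I * w) v
    rw [hom, ha] at h
    simpa using h
  have hsb : |om w v| ≤ E := (abs_om_le w v).trans (by rw [norm_circPt, one_mul]; exact hvn)
  have hb1 : ‖A' v‖ ≤ 2 * M * E := by
    rw [hdec, map_add, ← Complex.real_smul, ← Complex.real_smul, map_smul, map_smul, hAi']
    refine (norm_add_le _ _).trans ?_
    rw [norm_smul, norm_smul, norm_mul, norm_mul, Complex.norm_I, norm_circPt, Complex.norm_real,
      Real.norm_of_nonneg ht0'.le, Real.norm_of_nonneg (by positivity : 0 ≤ 1 / t), Real.norm_eq_abs]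
    have h1 : ‖A' w‖ ≤ E := by
      have := A'.le_opNorm w
      rw [norm_circPt, mul_one] at this
      exact this.trans hAn'
    have h2 : 1 / t * ‖A' w‖ ≤ M * E := by gcongr
    have h3 : |om w v| * (t' * (1 * 1)) ≤ E * (M * (1 * 1)) := by gcongr
    linarith
  have hb2 : ‖A' (A (Complex.I * circPt θ))‖ ≤ M * M := by
    rw [hAi, ← Complex.real_smul, map_smul, hAi', norm_smul, norm_mul, norm_mul, Complex.norm_I,
      norm_circPt, Complex.norm_real, Real.norm_of_nonneg ht0.le, Real.norm_of_nonneg ht0'.le]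
    rw [mul_one, mul_one]
    gcongr
  rw [hcomp]
  refine ContinuousLinearMap.opNorm_le_bound _ (by positivity) fun u => ?_
  have hu : u = (om u (Complex.I * circPt θ) : ℝ) * circPt θ +
      (om (circPt θ) u : ℝ) * (Complex.I * circPt θ) := by
    have h := om_decomp (circPt θ) (Complex.I * circPt θ) u
    rw [hom] at h
    simpa using h
  have hu1 : |om u (Complex.I * circPt θ)| ≤ ‖u‖ := (abs_om_le _ _).trans (by
    rw [norm_mul, Complex.norm_I, norm_circPt]; simp)
  have hu2 : |om (circPt θ) u| ≤ ‖u‖ := (abs_om_le _ _).trans (by rw [norm_circPt]; simp)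
  conv_lhs => rw [hu]
  rw [ContinuousLinearMap.comp_apply, ← Complex.real_smul, ← Complex.real_smul, map_add, map_smul,
    map_smul, map_add, map_smul, map_smul]
  refine (norm_add_le _ _).trans ?_
  rw [norm_smul, norm_smul, Real.norm_eq_abs, Real.norm_eq_abs]
  have h1 : |om u (Complex.I * circPt θ)| * ‖A' v‖ ≤ ‖u‖ * (2 * M * E) := by gcongr
  have h2 : |om (circPt θ) u| * ‖A' (A (Complex.I * circPt θ))‖ ≤ ‖u‖ * (M * M * E) := by
    gcongr
    exact hb2.trans (le_mul_of_one_le_right (by positivity) hE1)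
  calc _ ≤ ‖u‖ * (2 * M * E) + ‖u‖ * (M * M * E) := add_le_add h1 h2
    _ = _ := by ring

/-- Integral form of the basic properties of the convergents of an irrational number. -/
theorem exists_convergents {α : ℝ} (hirr : Irrational α) : ∃ (q : ℕ → ℕ) (p : ℕ → ℤ),
    (∀ n, (q n : ℝ) = (GenContFract.of α).dens n) ∧ (∀ n, 1 ≤ q n) ∧ Monotone q ∧
    (∀ n, 2 * q n ≤ q (n + 2)) ∧ (∀ n, IsCoprime (p n) (q n : ℤ)) ∧
    ∀ n, q (n + 1) * |q n * α - p n| ≤ 1 := by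
  set g := GenContFract.of α with hg
  have hterm : ∀ n, ¬ g.TerminatedAt n := by
    intro n hn
    obtain ⟨r, hr⟩ := (GenContFract.terminates_iff_rat α).1 ⟨n, hn⟩
    exact hirr ⟨r, hr.symm⟩
  have hs : ∀ n, ∃ z : ℤ, 1 ≤ z ∧ g.s.get? n = some ⟨1, (z : ℝ)⟩ := by
    intro n
    obtain ⟨gp, hgp⟩ := Option.ne_none_iff_exists'.1 (hterm n)
    obtain ⟨h1, z, hz⟩ := GenContFract.of_partNum_eq_one_and_exists_int_partDen_eq hgp
    have h2 := GenContFract.of_one_le_get?_partDen (GenContFract.partDen_eq_s_b hgp)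
    refine ⟨z, ?_, ?_⟩
    · rw [hz] at h2; exact_mod_cast h2
    · rw [hgp, ← h1, ← hz]
  choose a ha1 ha using hs
  have hInt : ∀ n, (∃ P Q : ℤ, g.nums n = P ∧ g.dens n = Q) ∧
      ∃ P Q : ℤ, g.nums (n + 1) = P ∧ g.dens (n + 1) = Q := by
    intro n
    induction n with
    | zero =>
      refine ⟨⟨⌊α⌋, 1, ?_, ?_⟩, ⟨a 0 * ⌊α⌋ + 1, a 0, ?_, ?_⟩⟩
      · rw [GenContFract.zeroth_num_eq_h, hg, GenContFract.of_h_eq_floor]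
      · rw [GenContFract.zeroth_den_eq_one]; simp
      · rw [GenContFract.first_num_eq (ha 0), hg, GenContFract.of_h_eq_floor]; push_cast; ring
      · rw [GenContFract.first_den_eq (ha 0)]
    | succ n ih =>
      obtain ⟨⟨P, Q, h1, h2⟩, P', Q', h3, h4⟩ := ih
      refine ⟨⟨P', Q', h3, h4⟩, a (n + 1) * P' + P, a (n + 1) * Q' + Q, ?_, ?_⟩
      · rw [GenContFract.nums_recurrence (ha (n + 1)) h1 h3]; push_cast; ring
      · rw [GenContFract.dens_recurrence (ha (n + 1)) h2 h4]; push_cast; ring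
  choose P Q hP hQ using fun n => (hInt n).1
  have hQrec : ∀ n, Q (n + 2) = a (n + 1) * Q (n + 1) + Q n := by
    intro n
    have := GenContFract.dens_recurrence (ha (n + 1)) (hQ n) (hQ (n + 1))
    rw [hQ] at this
    have h2 : (Q (n + 2) : ℝ) = ((a (n + 1) * Q (n + 1) + Q n : ℤ) : ℝ) := by
      rw [this]; push_cast; ring
    exact_mod_cast h2
  have hQm : ∀ n, Q n ≤ Q (n + 1) := fun n => by
    have := GenContFract.of_den_mono (v := α) (n := n)
    rw [← hg, hQ, hQ] at this
    exact_mod_cast this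
  have hQ1 : ∀ n, 1 ≤ Q n := by
    intro n
    induction n with
    | zero =>
      have := hQ 0
      rw [GenContFract.zeroth_den_eq_one] at this
      have h : Q 0 = 1 := by exact_mod_cast this.symm
      exact h.ge
    | succ n ih => exact ih.trans (hQm n)
  have hdet : ∀ n, P n * Q (n + 1) - Q n * P (n + 1) = (-1) ^ (n + 1) := by
    intro n
    have h := SimpContFract.determinant (s := SimpContFract.of α) (hterm n)
    change g.nums n * g.dens (n + 1) - g.dens n * g.nums (n + 1) = _ at h
    rw [hP, hP, hQ, hQ] at h
    exact_mod_cast h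
  have hqQ : ∀ n, ((Q n).toNat : ℤ) = Q n := fun n => Int.toNat_of_nonneg (by linarith [hQ1 n])
  have hqR : ∀ n, ((Q n).toNat : ℝ) = Q n := fun n => by exact_mod_cast congrArg (Int.cast (R := ℝ)) (hqQ n)
  refine ⟨fun n => (Q n).toNat, P, fun n => by rw [hQ, hqR], fun n => ?_, ?_, fun n => ?_,
    fun n => ?_, fun n => ?_⟩
  · have := hQ1 n
    have := hqQ n
    dsimp only
    omega
  · exact monotone_nat_of_le_succ fun n => Int.toNat_le_toNat (hQm n)
  · have h1 := hQrec n
    have h2 := hQm n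
    have h3 := hQ1 n
    have h4 : Q (n + 1) ≤ a (n + 1) * Q (n + 1) :=
      le_mul_of_one_le_left (by linarith [hQ1 (n + 1)]) (ha1 (n + 1))
    dsimp only
    omega
  · rw [hqQ]
    have h := hdet n
    rcases neg_one_pow_eq_or ℤ (n + 1) with e | e
    · exact ⟨Q (n + 1), -P (n + 1), by linarith⟩
    · exact ⟨-Q (n + 1), P (n + 1), by linarith⟩
  · rw [hqR, hqR]
    have h := GenContFract.abs_sub_convs_le (v := α) (hterm n)
    rw [← hg, GenContFract.conv_eq_num_div_den, hP, hQ, hQ] at h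
    have h1 : (0 : ℝ) < Q n := by exact_mod_cast (zero_lt_one.trans_le (hQ1 n))
    have h2 : (0 : ℝ) < Q (n + 1) := by exact_mod_cast (zero_lt_one.trans_le (hQ1 (n + 1)))
    have e : (Q n : ℝ) * α - P n = Q n * (α - P n / Q n) := by field_simp
    rw [e, abs_mul, abs_of_pos h1]
    calc (Q (n + 1) : ℝ) * (Q n * |α - P n / Q n|)
        ≤ Q (n + 1) * (Q n * (1 / (Q n * Q (n + 1)))) := by gcongr
      _ = 1 := by field_simp

theorem log_KT_le (f : SympDiff) (n : ℕ) : Real.log (KT f n) ≤ 2 * Real.log (KT f 1) * n := by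
  have hK := zero_lt_one.trans_le (one_le_KT f n)
  have hl := Real.log_nonneg (one_le_KT f 1)
  rcases Nat.eq_zero_or_pos n with rfl | hn
  · have : KT f 0 ≤ 1 := KT_le f fun m hm z _ => by
      rw [Nat.le_zero.1 hm]
      exact ContinuousLinearMap.norm_id_le
    simpa using Real.log_nonpos hK.le this
  · have h := Real.log_le_log hK (KT_le_pow f n)
    rw [Real.log_pow] at h
    have hn' : (1 : ℝ) ≤ n := by exact_mod_cast hn
    push_cast at h
    nlinarith

theorem tendsto_atTop_of_two_step {q : ℕ → ℕ} (hq1 : ∀ n, 1 ≤ q n) (hqm : Monotone q)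
    (hq2 : ∀ n, 2 * q n ≤ q (n + 2)) : Tendsto q atTop atTop := by
  have h : ∀ k, k ≤ q (2 * k) := by
    intro k
    induction k with
    | zero => omega
    | succ k ih =>
      have := hq2 (2 * k)
      have := hq1 (2 * k)
      rw [mul_add, mul_one]
      omega
  exact tendsto_atTop_atTop.2 fun b => ⟨2 * b, fun n hn => (h b).trans (hqm hn)⟩

/-- Growth drop at the denominators of the rotation number. -/
theorem exists_log_KT_drop {f : SympDiff} (hs : ContDiffOn ℝ 2 f.toFun Disk)
    (hfix : f.toFun 0 = 0) (hpseudo : ∀ z ∈ Disk, z ≠ 0 → ∀ n : ℕ, 1 ≤ n → f.toFun^[n] z ≠ z)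
    {l : ℝ → ℝ} (hc : Continuous l) (hmono : StrictMono l) (hper : ∀ θ : ℝ, l (θ + 1) = l θ + 1)
    (hproj : ∀ θ : ℝ, f.toFun (circPt θ) = circPt (l θ)) {α : ℝ} {F E : ℂ ≃ₜ ℂ}
    (h : PseudoRot F E l α) (hE : ∀ n, ∀ z ∈ Disk, E^[n] z = f.toFun^[n] z) :
    ∃ C : ℝ, ∀ q : ℕ, 1 ≤ q → ∀ p : ℤ, IsCoprime p (q : ℤ) → q * |q * α - p| ≤ 1 →
      C * q ≤ KT f q → ∀ T : ℕ, 3 * q * KT f q ^ 41 ≤ T →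
        Real.log (KT f T) / T ≤ (799 / 800) * (Real.log (KT f q) / q) := by
  obtain ⟨L, hL⟩ := exists_lipschitz f hs
  obtain ⟨C₁, hC₁, h₁⟩ := exists_norm_cD_circ_le hs hc hmono hper hproj h.rot
  obtain ⟨C₂, hC₂, h₂⟩ := exists_norm_cD_zero_le f hfix h hE
  set D := C₁ + 3 * C₂ with hD
  have hD0 : 0 ≤ D := by positivity
  refine ⟨1000 ^ 20 + |L| + D ^ 2, fun q hq p hpq hqα hqE T hT => ?_⟩
  have hq1 : (1 : ℝ) ≤ q := by exact_mod_cast hq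
  have hEl : 1000 ^ 20 * (q : ℝ) + |L| * q + D ^ 2 * q ≤ KT f q := by linarith
  have hLq : 0 ≤ |L| * q := by positivity
  have hDq : D ^ 2 ≤ D ^ 2 * q := le_mul_of_one_le_right (by positivity) hq1
  have hD2 : 0 ≤ D ^ 2 := sq_nonneg D
  have hE0 : 0 < KT f q := zero_lt_one.trans_le (one_le_KT f q)
  obtain ⟨b, hb0, hb⟩ : ∃ b : ℝ, 0 ≤ b ∧ KT f q = b ^ 20 :=
    ⟨KT f q ^ ((20 : ℕ) : ℝ)⁻¹, by positivity, (Real.rpow_inv_natCast_pow hE0.le (by norm_num)).symm⟩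
  have hb1000 : 1000 ≤ b := by
    refine le_of_pow_le_pow_left₀ (n := 20) (by norm_num) hb0 ?_
    rw [← hb]; linarith
  have hDb : D ≤ b ^ 10 := by
    refine le_of_pow_le_pow_left₀ (n := 2) (by norm_num) (by positivity) ?_
    rw [← pow_mul, ← hb]; linarith
  have hDE : D * KT f q ≤ b ^ 30 := by
    calc D * KT f q ≤ b ^ 10 * KT f q := by gcongr
      _ = b ^ 30 := by rw [hb]; ring
  have hqE' : (q : ℝ) ≤ KT f q := by linarith
  refine KT_drop f hpseudo hL hq hb1000 hb ?_ (fun z hz => ?_) hT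
  · have := mul_le_mul_of_nonneg_left (le_abs_self L) (by positivity : (0 : ℝ) ≤ q)
    linarith
  · rcases hz with rfl | hz
    · refine (h₂ (2 * q)).trans (le_trans ?_ hDE)
      push_cast
      have e1 : C₂ * (2 * q + 1) ≤ C₂ * (3 * KT f q) := by gcongr; linarith
      have e2 : 0 ≤ C₁ * KT f q := by positivity
      rw [hD]; linarith
    · refine (h₁ q hq p hpq hqα z hz).trans (le_trans ?_ hDE)
      gcongr
      linarith

/-- The integral of the action vanishes for a pseudo-rotation whose rotation number is not of Bruno
type. -/
theorem integral_action_eq_zero {f : SympDiff} (hs : ContDiffOn ℝ 2 f.toFun Disk)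
    (hfix : f.toFun 0 = 0) (hpseudo : ∀ z ∈ Disk, z ≠ 0 → ∀ n : ℕ, 1 ≤ n → f.toFun^[n] z ≠ z)
    {l : ℝ → ℝ} (hc : Continuous l) (hmono : StrictMono l) (hper : ∀ θ : ℝ, l (θ + 1) = l θ + 1)
    (hproj : ∀ θ : ℝ, f.toFun (circPt θ) = circPt (l θ)) {α : ℝ}
    (hα : ∀ θ : ℝ, Tendsto (fun n : ℕ => (l^[n] θ - θ) / n) atTop (𝓝 α)) (hirr : Irrational α)
    (hnB : ¬ Summable fun n : ℕ =>
      Real.log ((GenContFract.of α).dens (n + 1)) / (GenContFract.of α).dens n)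
    {A : ℂ → ℝ} (hA : IsNormalizedAction f A) : ∫ z in Disk, A z = 0 := by
  obtain ⟨F, E, h, hE⟩ := exists_pseudoRot f hfix hpseudo hc hmono hper hproj hα
  obtain ⟨q, p, hqd, hq1, hqm, hq2, hqp, hqα⟩ := exists_convergents hirr
  simp only [← hqd] at hnB
  obtain ⟨C, hC⟩ := exists_log_KT_drop hs hfix hpseudo hc hmono hper hproj h hE
  have hexp : ∀ n, Real.exp (Real.log (KT f n)) = KT f n := fun n =>
    Real.exp_log (zero_lt_one.trans_le (one_le_KT f n))
  have hfreq := frequently_large_gap hq1 hqm hq2 hnB (κ := fun n => Real.log (KT f n))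
    (fun n => Real.log_nonneg (one_le_KT f n)) (log_KT_le f) (C := C) (θ := 799 / 800)
    (by norm_num) (by norm_num) (fun n hn T hT => by
      simp only [hexp] at hn hT
      refine hC (q n) (hq1 n) (p n) (hqp n) (le_trans ?_ (hqα n)) hn T hT
      gcongr
      exact hqm (Nat.le_succ n))
  have hqt := tendsto_atTop_of_two_step hq1 hqm hq2
  by_contra hne
  have hpos : 0 < |∫ z in Disk, A z| := abs_pos.2 hne
  have hev : ∀ᶠ n in atTop, 48 * π / |∫ z in Disk, A z| < q n :=
    (tendsto_natCast_atTop_atTop.comp hqt).eventually_gt_atTop _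
  obtain ⟨n, hn, hn1, hn2⟩ := (hfreq.and_eventually (hev.and (hqt.eventually_ge_atTop 2))).exists
  set K := KT f (q n) with hK
  have hK1 : 1 ≤ K := one_le_KT f (q n)
  have hK4 : K ^ 4 ≤ q (n + 1) := by
    rw [mul_comm, Real.exp_mul, hexp] at hn
    exact_mod_cast hn
  have hqn : 2 ≤ q (n + 1) := hn2.trans (hqm (Nat.le_succ n))
  have hNc : ((q (n + 1) - 1 : ℕ) : ℝ) = q (n + 1) - 1 := by
    rw [Nat.cast_sub (by omega)]; simp
  have hqn' : (2 : ℝ) ≤ q (n + 1) := by exact_mod_cast hqn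
  have hmain := mul_abs_integral_le h hirr hE hA (hq1 n) (p n) (N := q (n + 1) - 1) (by omega) (by
    rw [hNc, sub_mul, one_mul]
    have h1 := hqα n
    have h2 : 0 < |(q n : ℝ) * α - p n| := by
      refine abs_pos.2 fun h0 => ?_
      have h3 : Irrational ((q n : ℝ) * α) := by
        exact_mod_cast hirr.natCast_mul (Nat.pos_iff_ne_zero.1 (hq1 n))
      exact h3 ⟨p n, by push_cast; linarith⟩
    linarith) hK1 fun z hz => norm_cD_le_KT f le_rfl hz
  have hs0 : 0 < √((q (n + 1) - 1 : ℕ) : ℝ) := Real.sqrt_pos.2 (by rw [hNc]; linarith)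
  have hsq : K ^ 2 ≤ 2 * √((q (n + 1) - 1 : ℕ) : ℝ) := by
    refine le_of_pow_le_pow_left₀ (n := 2) (by norm_num) (by positivity) ?_
    rw [mul_pow, Real.sq_sqrt (by positivity), hNc]
    nlinarith
  have hb : 24 * K ^ 2 / √((q (n + 1) - 1 : ℕ) : ℝ) ≤ 48 := by
    rw [div_le_iff₀ hs0]; linarith
  have h3 : (q n : ℝ) * |∫ z in Disk, A z| ≤ 48 * π := by
    have := mul_le_mul_of_nonneg_left hb Real.pi_pos.le
    linarith
  rw [div_lt_iff₀ hpos] at hn1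
  linarith

end PlaneTop

/-- A `C²` irrational pseudo-rotation of the disk whose rotation
number is not of Bruno type has vanishing Calabi invariant. -/
theorem cal_pseudo_rotation_nonBruno (f : SympDiff)
    (hsmooth : ContDiffOn ℝ 2 f.toFun Disk) (hsmooth' : ContDiffOn ℝ 2 f.invFun Disk)
    (hfix : f.toFun 0 = 0)
    (hpseudo : ∀ z ∈ Disk, z ≠ 0 → ∀ n : ℕ, 1 ≤ n → f.toFun^[n] z ≠ z)
    (lift : ℝ → ℝ) (hlift_cont : Continuous lift) (hlift_mono : StrictMono lift)
    (hlift_per : ∀ θ : ℝ, lift (θ + 1) = lift θ + 1)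
    (hlift_proj : ∀ θ : ℝ,
      f.toFun (Complex.exp (2 * Real.pi * Complex.I * θ)) =
        Complex.exp (2 * Real.pi * Complex.I * lift θ))
    (α : ℝ)
    (hα : ∀ θ : ℝ, Filter.Tendsto (fun n : ℕ => (lift^[n] θ - θ) / n)
      Filter.atTop (nhds α))
    (hirr : Irrational α)
    (hnB : ¬ Summable (fun n : ℕ =>
      Real.log ((GenContFract.of α).dens (n + 1)) / (GenContFract.of α).dens n))
    (A : ℂ → ℝ) (hA : IsNormalizedAction f A) :
    (1 / Real.pi) * ∫ z in Disk, A z = 0 := by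
  rw [PlaneTop.integral_action_eq_zero hsmooth hfix hpseudo hlift_cont hlift_mono hlift_per
    hlift_proj hα hirr hnB hA, mul_zero]
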